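/- Let 𝔤 be a finite-dimensional semisimple Lie algebra over an algebraically closed field K of characteristic 0 and let V be a faithful irreducible 𝔤-module of dimension r such that (V^{⊗n})^𝔤 = 0 for all integers n with 1 ≤ n < r. Then every simple ideal (component) of 𝔤 is of type A, i.e. isomorphic to the special linear Lie algebra sl_m(K) for some m ≥ 2. -/

import Mathlib

open scoped TensorProduct

/-- The action of an element `x` of a Lie algebra `𝔤` on the `n`-fold tensor power `V^{⊗n}`
of a `𝔤`-module `V`, acting as a derivation (i.e. by the Leibniz rule, applying `x` to one
tensor factor at a time and summing). -/
noncomputable def tensorPowerLieAction (K : Type*) [CommRing K]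
    (𝔤 : Type*) [LieRing 𝔤] [LieAlgebra K 𝔤]
    (V : Type*) [AddCommGroup V] [Module K V] [LieRingModule 𝔤 V] [LieModule K 𝔤 V]
    (n : ℕ) (x : 𝔤) : Module.End K (⨂[K]^n V) :=
  ∑ i : Fin n, PiTensorProduct.map
    (Function.update (fun _ : Fin n => (LinearMap.id : V →ₗ[K] V)) i (LieModule.toEnd K 𝔤 V x))

/-- The subspace `(V^{⊗n})^𝔤` of `𝔤`-invariants of the `n`-fold tensor power of `V`. -/
noncomputable def tensorPowerInvariants (K : Type*) [CommRing K]
    (𝔤 : Type*) [LieRing 𝔤] [LieAlgebra K 𝔤]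
    (V : Type*) [AddCommGroup V] [Module K V] [LieRingModule 𝔤 V] [LieModule K 𝔤 V]
    (n : ℕ) : Submodule K (⨂[K]^n V) :=
  ⨅ x : 𝔤, LinearMap.ker (tensorPowerLieAction K 𝔤 V n x)

/-- A Lie algebra is of type `A` if it is isomorphic to `sl_m` for some `m ≥ 2`. -/
def IsTypeA (K : Type*) [CommRing K] (L : Type*) [LieRing L] [LieAlgebra K L] : Prop :=
  ∃ m : ℕ, 2 ≤ m ∧ Nonempty (L ≃ₗ⁅K⁆ LieAlgebra.SpecialLinear.sl (Fin m) K)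

set_option linter.unusedSectionVars false

/-- A reduced crystallographic root system in a rational inner product space, together with a
linear functional `ht` that separates positive from negative roots. -/
structure RootFrame (E : Type*) [AddCommGroup E] [Module ℚ E] where
  form : LinearMap.BilinForm ℚ E
  roots : Finset E
  ht : E →ₗ[ℚ] ℚ
  form_comm : ∀ x y, form x y = form y x
  form_pos : ∀ x, x ≠ 0 → 0 < form x x
  zero_notMem : (0 : E) ∉ roots
  neg_mem : ∀ β ∈ roots, -β ∈ roots
  refl_mem : ∀ β ∈ roots, ∀ γ ∈ roots, γ - (2 * form γ β / form β β) • β ∈ roots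
  exists_int : ∀ β ∈ roots, ∀ γ ∈ roots, ∃ n : ℤ, 2 * form γ β / form β β = n
  eq_of_smul : ∀ β ∈ roots, ∀ q : ℚ, q • β ∈ roots → q = 1 ∨ q = -1
  sub_mem : ∀ β ∈ roots, ∀ γ ∈ roots, 0 < form β γ → β ≠ γ → β - γ ∈ roots
  ht_ne_zero : ∀ β ∈ roots, ht β ≠ 0
  eq_zero_of_form : ∀ x, (∀ β ∈ roots, form x β = 0) → x = 0

namespace RootFrame

variable {E : Type*} [AddCommGroup E] [Module ℚ E] (R : RootFrame E)

/-- The coroot functional `x ↦ 2 (x, β) / (β, β)`. -/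
noncomputable def co (β : E) : E →ₗ[ℚ] ℚ := (2 / R.form β β) • R.form.flip β

lemma co_apply (β x : E) : R.co β x = 2 * R.form x β / R.form β β := by
  simp [co]; ring

lemma form_self_nonneg (x : E) : 0 ≤ R.form x x := by
  by_cases h : x = 0
  · simp [h]
  · exact (R.form_pos x h).le

lemma eq_zero_of_form_self {x : E} (h : R.form x x = 0) : x = 0 := by
  by_contra hx
  exact (R.form_pos x hx).ne' h

lemma ne_zero {β : E} (h : β ∈ R.roots) : β ≠ 0 := fun h0 => R.zero_notMem (h0 ▸ h)

lemma two_form (β x : E) : 2 * R.form x β = R.co β x * R.form β β := by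
  by_cases h : β = 0
  · simp [h]
  · rw [co_apply, div_mul_cancel₀ _ (R.form_pos β h).ne']

lemma co_self {β : E} (h : β ≠ 0) : R.co β β = 2 := by
  rw [co_apply, mul_div_cancel_right₀ _ (R.form_pos β h).ne']

lemma co_pos_iff {β x : E} (h : β ≠ 0) : 0 < R.co β x ↔ 0 < R.form x β := by
  have := R.form_pos β h
  have h2 := R.two_form β x
  constructor
  · intro h1; nlinarith [mul_pos h1 this]
  · intro h1; by_contra hc; nlinarith [mul_nonneg (neg_nonneg.2 (not_lt.1 hc)) this.le]

lemma co_eq_zero_iff {β x : E} (h : β ≠ 0) : R.co β x = 0 ↔ R.form x β = 0 := by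
  have := R.form_pos β h
  have h2 := R.two_form β x
  constructor
  · intro h1; rw [h1] at h2; linarith
  · intro h1; rw [h1] at h2; simpa [this.ne'] using h2.symm

lemma co_nonneg_iff {β x : E} (h : β ≠ 0) : 0 ≤ R.co β x ↔ 0 ≤ R.form x β := by
  have h1 := R.co_pos_iff h (x := -x)
  simp only [map_neg, LinearMap.neg_apply, Left.neg_pos_iff] at h1
  rw [← not_lt, h1, not_lt]

lemma co_neg_left (β x : E) : R.co (-β) x = - R.co β x := by
  simp [co_apply]; ring

/-- The orthogonal reflection in the hyperplane orthogonal to `β`. -/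
noncomputable def refl (β : E) : E ≃ₗ[ℚ] E :=
  LinearEquiv.ofInvolutive (LinearMap.id - (R.co β).smulRight β) (by
    intro x
    by_cases h : β = 0
    · simp [h]
    · simp [R.co_self h]; module)

lemma refl_apply (β x : E) : R.refl β x = x - R.co β x • β := rfl

lemma refl_refl (β x : E) : R.refl β (R.refl β x) = x :=
  (R.refl β).symm_apply_apply x

lemma form_refl (β x y : E) : R.form (R.refl β x) (R.refl β y) = R.form x y := by
  have h1 := R.two_form β x
  have h2 := R.two_form β y
  simp only [refl_apply, map_sub, map_smul, LinearMap.sub_apply, LinearMap.smul_apply, smul_eq_mul,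
    R.form_comm β y]
  linear_combination - R.co β y / 2 * h1 - R.co β x / 2 * h2

lemma form_refl_left (β x y : E) : R.form (R.refl β x) y = R.form x (R.refl β y) := by
  rw [← R.form_refl β, refl_refl]

lemma refl_mem_roots {β γ : E} (hβ : β ∈ R.roots) (hγ : γ ∈ R.roots) : R.refl β γ ∈ R.roots := by
  rw [refl_apply, co_apply]; exact R.refl_mem β hβ γ hγ

lemma refl_self {β : E} (h : β ≠ 0) : R.refl β β = -β := by
  rw [refl_apply, R.co_self h]; module

lemma co_refl (β γ x : E) : R.co (R.refl β γ) x = R.co γ (R.refl β x) := by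
  simp only [co_apply, form_refl_left, refl_refl]

lemma refl_eq_self_iff {β x : E} (h : β ≠ 0) : R.refl β x = x ↔ R.form x β = 0 := by
  rw [refl_apply, sub_eq_self, smul_eq_zero, or_iff_left h, R.co_eq_zero_iff h]

/-- The positive roots. -/
noncomputable def pos : Finset E := R.roots.filter (fun β => 0 < R.ht β)

lemma mem_pos {β : E} : β ∈ R.pos ↔ β ∈ R.roots ∧ 0 < R.ht β := by simp [pos]

lemma pos_or_neg {β : E} (h : β ∈ R.roots) : β ∈ R.pos ∨ -β ∈ R.pos := by
  rcases (R.ht_ne_zero β h).lt_or_gt with h1 | h1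
  · right; rw [mem_pos]; exact ⟨R.neg_mem β h, by simpa using h1⟩
  · left; exact R.mem_pos.2 ⟨h, h1⟩

/-- The half sum of the positive roots. -/
noncomputable def rho : E := (2⁻¹ : ℚ) • ∑ β ∈ R.pos, β

/-- The positive roots which are not the sum of two positive roots. -/
def IsSimple (α : E) : Prop := α ∈ R.pos ∧ ∀ β ∈ R.pos, ∀ γ ∈ R.pos, α ≠ β + γ

/-- The cone spanned by the positive roots. -/
noncomputable def cone : AddSubmonoid E := AddSubmonoid.closure (R.pos : Set E)

lemma mem_closure_simple {β : E} (hβ : β ∈ R.pos) :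
    β ∈ AddSubmonoid.closure {α | R.IsSimple α} := by
  by_contra hb
  obtain ⟨γ, hγ, hmin⟩ := Finset.exists_min_image
    (by classical exact R.pos.filter (fun γ => γ ∉ AddSubmonoid.closure {α | R.IsSimple α})) R.ht
    ⟨β, by simp [hβ, hb]⟩
  simp only [Finset.mem_filter] at hγ hmin
  apply hγ.2
  by_cases hs : R.IsSimple γ
  · exact AddSubmonoid.subset_closure hs
  · simp only [IsSimple, not_and, not_forall, not_not] at hs
    obtain ⟨a, ha, b, hb, rfl⟩ := hs hγ.1
    have h1 := (R.mem_pos.1 ha).2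
    have h2 := (R.mem_pos.1 hb).2
    apply add_mem
    · by_contra h; have := hmin a ⟨ha, h⟩; simp at this; linarith
    · by_contra h; have := hmin b ⟨hb, h⟩; simp at this; linarith

lemma cone_eq : R.cone = AddSubmonoid.closure {α | R.IsSimple α} := by
  apply le_antisymm
  · exact AddSubmonoid.closure_le.2 fun β hβ => R.mem_closure_simple hβ
  · exact AddSubmonoid.closure_mono fun β hβ => hβ.1

lemma ht_pos_of_mem_cone {q : E} (hq : q ∈ R.cone) : q = 0 ∨ 0 < R.ht q := by
  induction hq using AddSubmonoid.closure_induction with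
  | mem x hx => exact Or.inr (R.mem_pos.1 hx).2
  | zero => exact Or.inl rfl
  | add x y _ _ hx hy =>
    rcases hx with rfl | hx <;> rcases hy with rfl | hy <;> simp_all; right; linarith

lemma refl_simple_mem_pos {α : E} (hα : R.IsSimple α) : ∀ (n : ℕ) (β : E), β ∈ R.pos → β ≠ α →
    R.co α β ≤ n → R.refl α β ∈ R.pos := by
  have hα0 := R.ne_zero (R.mem_pos.1 hα.1).1
  have hαh := (R.mem_pos.1 hα.1).2
  have hle : ∀ β ∈ R.pos, R.co α β ≤ 0 → R.refl α β ∈ R.pos := by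
    intro β hβ hc
    refine R.mem_pos.2 ⟨R.refl_mem_roots (R.mem_pos.1 hα.1).1 (R.mem_pos.1 hβ).1, ?_⟩
    have := (R.mem_pos.1 hβ).2
    rw [refl_apply]; simp; nlinarith
  intro n
  induction n with
  | zero => intro β hβ _ hc; exact hle β hβ (by simpa using hc)
  | succ n ih =>
    intro β hβ hne hc
    by_cases hc0 : R.co α β ≤ 0
    · exact hle β hβ hc0
    push Not at hc0
    have hsub := R.sub_mem β (R.mem_pos.1 hβ).1 α (R.mem_pos.1 hα.1).1 ((R.co_pos_iff hα0).1 hc0) hne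
    rcases R.pos_or_neg hsub with hp | hp
    · have h2 : R.refl α (β - α) ∈ R.pos := by
        apply ih _ hp
        · intro h
          have hb : β = (2 : ℚ) • α := by rw [sub_eq_iff_eq_add] at h; rw [h]; module
          have := R.eq_of_smul α (R.mem_pos.1 hα.1).1 2 (hb ▸ (R.mem_pos.1 hβ).1)
          norm_num at this
        · rw [map_sub, R.co_self hα0]; push_cast at hc; linarith
      rcases R.pos_or_neg (R.refl_mem_roots (R.mem_pos.1 hα.1).1 (R.mem_pos.1 hβ).1) with h3 | h3
      · exact h3
      · exfalso
        apply hα.2 _ h2 _ h3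
        rw [map_sub, R.refl_self hα0]; abel
    · exfalso
      exact hα.2 _ hβ _ hp (by abel)

lemma refl_mem_pos {α β : E} (hα : R.IsSimple α) (hβ : β ∈ R.pos) (h : β ≠ α) :
    R.refl α β ∈ R.pos := by
  obtain ⟨n, hn⟩ := exists_nat_ge (R.co α β)
  exact R.refl_simple_mem_pos hα n β hβ h hn

lemma co_rho {α : E} (hα : R.IsSimple α) : R.co α R.rho = 1 := by
  classical
  have hα0 := R.ne_zero (R.mem_pos.1 hα.1).1
  have h : ∑ β ∈ R.pos.erase α, R.refl α β = ∑ β ∈ R.pos.erase α, β := by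
    apply Finset.sum_nbij' (R.refl α) (R.refl α)
    · intro β hβ
      rw [Finset.mem_erase] at hβ ⊢
      refine ⟨fun h => ?_, R.refl_mem_pos hα hβ.2 hβ.1⟩
      have h2 : β = -α := by rw [← R.refl_refl α β, h, R.refl_self hα0]
      have h3 := (R.mem_pos.1 hβ.2).2
      have h4 := (R.mem_pos.1 hα.1).2
      rw [h2] at h3; simp at h3; linarith
    · intro β hβ
      rw [Finset.mem_erase] at hβ ⊢
      refine ⟨fun h => ?_, R.refl_mem_pos hα hβ.2 hβ.1⟩
      have h2 : β = -α := by rw [← R.refl_refl α β, h, R.refl_self hα0]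
      have h3 := (R.mem_pos.1 hβ.2).2
      have h4 := (R.mem_pos.1 hα.1).2
      rw [h2] at h3; simp at h3; linarith
    · simp [refl_refl]
    · simp [refl_refl]
    · simp
  have h2 : R.co α (∑ β ∈ R.pos.erase α, β) = 0 := by
    rw [← map_sum, R.refl_apply, sub_eq_self, smul_eq_zero] at h
    exact h.resolve_right hα0
  rw [rho, ← Finset.add_sum_erase _ _ hα.1, map_smul, map_add, h2, R.co_self hα0]; norm_num

lemma form_rho_pos {q : E} (hq : q ∈ R.cone) (h0 : q ≠ 0) : 0 < R.form R.rho q := by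
  suffices q = 0 ∨ 0 < R.form R.rho q from this.resolve_left h0
  clear h0
  rw [cone_eq] at hq
  induction hq using AddSubmonoid.closure_induction with
  | mem x hx =>
    have hx0 := R.ne_zero (R.mem_pos.1 hx.1).1
    right; rw [← R.co_pos_iff hx0, R.co_rho hx]; norm_num
  | zero => exact Or.inl rfl
  | add x y _ _ hx hy =>
    rcases hx with rfl | hx <;> rcases hy with rfl | hy <;> simp_all; right; linarith

lemma form_nonneg_of_simple {x q : E} (hx : ∀ α, R.IsSimple α → 0 ≤ R.form x α)
    (hq : q ∈ R.cone) : 0 ≤ R.form x q := by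
  rw [cone_eq] at hq
  induction hq using AddSubmonoid.closure_induction with
  | mem y hy => exact hx y hy
  | zero => simp
  | add y z _ _ h1 h2 => rw [map_add]; exact add_nonneg h1 h2

lemma co_int_of_mem_cone {β q : E} (hβ : β ∈ R.roots) (hq : q ∈ R.cone) :
    ∃ n : ℤ, R.co β q = n := by
  induction hq using AddSubmonoid.closure_induction with
  | mem y hy => rw [co_apply]; exact R.exists_int β hβ y (R.mem_pos.1 hy).1
  | zero => exact ⟨0, by simp⟩
  | add y z _ _ h1 h2 =>
    obtain ⟨a, ha⟩ := h1
    obtain ⟨b, hb⟩ := h2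
    exact ⟨a + b, by rw [map_add, ha, hb]; push_cast; rfl⟩

/-- The function `F` on `E` has leading exponent `x`, with coefficient one. -/
def Leading {K : Type*} [Field K] (F : AddMonoidAlgebra K E) (x : E) : Prop :=
  F.coeff x = 1 ∧ ∀ y, F.coeff y ≠ 0 → x - y ∈ R.cone

lemma eq_of_sub_mem_cone {x y : E} (h : x - y ∈ R.cone) (h2 : y - x ∈ R.cone) : x = y := by
  rcases R.ht_pos_of_mem_cone h with h | h
  · exact sub_eq_zero.1 h
  rcases R.ht_pos_of_mem_cone h2 with h2 | h2
  · exact (sub_eq_zero.1 h2).symm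
  simp at h h2; linarith

lemma coeff_mul_of_unique {K : Type*} [Field K] {F G : AddMonoidAlgebra K E} {x y : E}
    (h : ∀ a b, F.coeff a ≠ 0 → G.coeff b ≠ 0 → a + b = x + y → a = x) :
    (F * G).coeff (x + y) = F.coeff x * G.coeff y := by
  apply AddMonoidAlgebra.coeff_mul_add_of_uniqueAdd
  intro a b ha hb hab
  have := h a b (by simpa using ha) (by simpa using hb) hab
  subst this
  exact ⟨rfl, by simpa using hab⟩

lemma exists_of_coeff_mul_ne_zero {K : Type*} [Field K] {F G : AddMonoidAlgebra K E} {z : E}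
    (h : (F * G).coeff z ≠ 0) : ∃ a b, F.coeff a ≠ 0 ∧ G.coeff b ≠ 0 ∧ a + b = z := by
  classical
  by_contra hc
  push Not at hc
  apply h
  rw [AddMonoidAlgebra.coeff_mul]
  apply Finset.sum_eq_zero; intro a ha
  apply Finset.sum_eq_zero; intro b hb
  exact if_neg (hc a b (by simpa using ha) (by simpa using hb))

variable {R} in
lemma Leading.mul {K : Type*} [Field K] {F G : AddMonoidAlgebra K E} {x y : E}
    (hF : R.Leading F x) (hG : R.Leading G y) : R.Leading (F * G) (x + y) := by
  constructor
  · rw [coeff_mul_of_unique, hF.1, hG.1, one_mul]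
    intro a b ha hb hab
    have h1 := hF.2 a ha
    have h2 := hG.2 b hb
    apply R.eq_of_sub_mem_cone _ h1
    have : a - x = y - b := by rw [sub_eq_sub_iff_add_eq_add, hab]; abel
    rwa [this]
  · intro z hz
    obtain ⟨a, b, ha, hb, rfl⟩ := exists_of_coeff_mul_ne_zero hz
    rw [add_sub_add_comm]
    exact add_mem (hF.2 a ha) (hG.2 b hb)

/-- The factor `e^{β/2} - e^{-β/2}` of the Weyl denominator. -/
noncomputable def theta (K : Type*) [Field K] (β : E) : AddMonoidAlgebra K E :=
  AddMonoidAlgebra.single ((2⁻¹ : ℚ) • β) 1 - AddMonoidAlgebra.single (-((2⁻¹ : ℚ) • β)) 1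

/-- The Weyl denominator. -/
noncomputable def denom (K : Type*) [Field K] : AddMonoidAlgebra K E := ∏ β ∈ R.pos, theta K β

lemma leading_theta (K : Type*) [Field K] {β : E} (hβ : β ∈ R.pos) :
    R.Leading (theta K β) ((2⁻¹ : ℚ) • β) := by
  classical
  have hne : -((2⁻¹ : ℚ) • β) ≠ (2⁻¹ : ℚ) • β := by
    intro h
    have h2 := congrArg R.ht h
    have := (R.mem_pos.1 hβ).2
    simp at h2; linarith
  constructor
  · simp [theta, hne]
  · intro y hy
    by_cases h1 : y = (2⁻¹ : ℚ) • β
    · simp [h1]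
    by_cases h2 : y = -((2⁻¹ : ℚ) • β)
    · rw [h2]
      have : (2⁻¹ : ℚ) • β - -((2⁻¹ : ℚ) • β) = β := by module
      rw [this]; exact AddSubmonoid.subset_closure hβ
    · exfalso; apply hy
      simp [theta, Ne.symm h1, Ne.symm h2]

lemma leading_denom (K : Type*) [Field K] : R.Leading (R.denom K) R.rho := by
  classical
  rw [rho, Finset.smul_sum, denom]
  suffices ∀ s ⊆ R.pos, R.Leading (∏ β ∈ s, theta K β) (∑ β ∈ s, (2⁻¹ : ℚ) • β) from this _ subset_rfl
  intro s
  induction s using Finset.induction_on with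
  | empty =>
    intro _
    constructor
    · simp [AddMonoidAlgebra.one_def]
    · intro y hy
      by_cases h : y = 0
      · simp [h]
      · simp [AddMonoidAlgebra.one_def, Ne.symm h] at hy
  | insert a s has ih =>
    intro hs
    rw [Finset.prod_insert has, Finset.sum_insert has]
    exact (R.leading_theta K (hs (by simp))).mul (ih fun x hx => hs (by simp [hx]))

/-- The algebra automorphism induced by a reflection. -/
noncomputable def reflHom (K : Type*) [Field K] (γ : E) :
    AddMonoidAlgebra K E →+* AddMonoidAlgebra K E :=
  AddMonoidAlgebra.mapDomainRingHom K (R.refl γ).toLinearMap.toAddMonoidHom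

lemma reflHom_theta (K : Type*) [Field K] (γ β : E) :
    R.reflHom K γ (theta K β) = theta K (R.refl γ β) := by
  simp only [reflHom, theta, map_sub]
  simp

lemma theta_neg (K : Type*) [Field K] (β : E) : theta K (-β) = - theta K β := by
  simp [theta]

lemma reflHom_denom (K : Type*) [Field K] {α : E} (hα : R.IsSimple α) :
    R.reflHom K α (R.denom K) = - R.denom K := by
  classical
  have hα0 := R.ne_zero (R.mem_pos.1 hα.1).1
  rw [denom, map_prod, ← Finset.mul_prod_erase _ _ hα.1, ← Finset.mul_prod_erase _ _ hα.1]
  have h : ∏ β ∈ R.pos.erase α, R.reflHom K α (theta K β) = ∏ β ∈ R.pos.erase α, theta K β := by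
    have key : ∀ β ∈ R.pos.erase α, R.refl α β ∈ R.pos.erase α := by
      intro β hβ
      rw [Finset.mem_erase] at hβ ⊢
      refine ⟨fun h => ?_, R.refl_mem_pos hα hβ.2 hβ.1⟩
      have h2 : β = -α := by rw [← R.refl_refl α β, h, R.refl_self hα0]
      have h3 := (R.mem_pos.1 hβ.2).2
      have h4 := (R.mem_pos.1 hα.1).2
      rw [h2] at h3; simp at h3; linarith
    apply Finset.prod_nbij' (R.refl α) (R.refl α) key key
    · simp [refl_refl]
    · simp [refl_refl]
    · simp [reflHom_theta]
  rw [h, reflHom_theta, R.refl_self hα0, theta_neg]; ring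

lemma coeff_reflHom (K : Type*) [Field K] (γ x : E) (F : AddMonoidAlgebra K E) :
    (R.reflHom K γ F).coeff x = F.coeff (R.refl γ x) := by
  classical
  induction F using AddMonoidAlgebra.induction_linear with
  | zero => simp
  | add f g hf hg => simp [hf, hg]
  | single m r =>
    have : R.refl γ m = x ↔ m = R.refl γ x := by
      constructor
      · rintro rfl; rw [refl_refl]
      · rintro rfl; rw [refl_refl]
    simp [reflHom, Finsupp.single_apply, this]

lemma form_eq_of_coeff_denom_ne_zero (K : Type*) [Field K] [CharZero K] (x : E)
    (hx : (R.denom K).coeff x ≠ 0) : R.form x x = R.form R.rho R.rho := by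
  classical
  by_contra hne
  obtain ⟨κ, hκ, hmax⟩ := Finset.exists_max_image
    ((R.denom K).coeff.support.filter (fun x => R.form x x ≠ R.form R.rho R.rho)) R.ht
    ⟨x, by simp [hx, hne]⟩
  simp only [Finset.mem_filter, Finsupp.mem_support_iff] at hκ hmax
  set q := R.rho - κ with hq
  have hqc : q ∈ R.cone := (R.leading_denom K).2 κ hκ.1
  have hκq : κ = R.rho - q := by simp [hq]
  have hdom : ∀ α, R.IsSimple α → 0 ≤ R.form (-q) α := by
    intro α hα
    have hα0 := R.ne_zero (R.mem_pos.1 hα.1).1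
    have hanti : (R.denom K).coeff (R.refl α κ) = - (R.denom K).coeff κ := by
      rw [← coeff_reflHom, R.reflHom_denom K hα]; simp
    have h1 : R.ht (R.refl α κ) ≤ R.ht κ := by
      apply hmax
      rw [hanti, form_refl]; simpa using hκ
    have h2 : 0 ≤ R.co α κ := by
      have := (R.mem_pos.1 hα.1).2
      rw [refl_apply] at h1; simp at h1
      by_contra hc; nlinarith
    have h3 : R.co α κ ≠ 0 := by
      intro h
      rw [refl_apply, h] at hanti
      simp only [zero_smul, sub_zero] at hanti
      exact hκ.1 (self_eq_neg.1 hanti)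
    obtain ⟨n, hn⟩ := R.co_int_of_mem_cone (R.mem_pos.1 hα.1).1 hqc
    have h4 : R.co α κ = ((1 - n : ℤ) : ℚ) := by
      rw [hκq, map_sub, R.co_rho hα, hn]; push_cast; rfl
    rw [← R.co_nonneg_iff hα0, map_neg, hn]
    have h5 : 0 < R.co α κ := lt_of_le_of_ne h2 (Ne.symm h3)
    rw [h4] at h5
    have : 0 < 1 - n := by exact_mod_cast h5
    have : (n : ℚ) ≤ 0 := by exact_mod_cast (by omega : n ≤ 0)
    linarith
  have h := R.form_nonneg_of_simple hdom hqc
  have hq0 : q = 0 := by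
    by_contra h0
    have := R.form_pos q h0
    simp at h; linarith
  apply hκ.2; rw [hκq, hq0, sub_zero]

/-- The operator on the group algebra multiplying `e^x` by `g x`. -/
noncomputable def diag {K : Type*} [Field K] (g : E → K) :
    AddMonoidAlgebra K E →ₗ[K] AddMonoidAlgebra K E :=
  (AddMonoidAlgebra.coeffLinearEquiv K).symm.toLinearMap ∘ₗ
    (Finsupp.lsum K fun x => g x • Finsupp.lsingle x) ∘ₗ
    (AddMonoidAlgebra.coeffLinearEquiv K).toLinearMap

@[simp] lemma diag_single {K : Type*} [Field K] (g : E → K) (x : E) (r : K) :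
    diag g (AddMonoidAlgebra.single x r) = AddMonoidAlgebra.single x (g x * r) := by
  apply AddMonoidAlgebra.coeff_injective
  simp [diag]

lemma coeff_diag {K : Type*} [Field K] (g : E → K) (F : AddMonoidAlgebra K E) (x : E) :
    (diag g F).coeff x = g x * F.coeff x := by
  classical
  induction F using AddMonoidAlgebra.induction_linear with
  | zero => simp
  | add f g hf hg => simp [hf, hg, mul_add]
  | single m r =>
    by_cases h : m = x
    · simp [h]
    · simp [h]

/-- The Laplace operator `e^x ↦ (x, x) e^x`. -/
noncomputable def lap (K : Type*) [Field K] [CharZero K] :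
    AddMonoidAlgebra K E →ₗ[K] AddMonoidAlgebra K E := diag fun x => ((R.form x x : ℚ) : K)

/-- The derivation `e^x ↦ (x, β) e^x`. -/
noncomputable def der (K : Type*) [Field K] [CharZero K] (β : E) :
    AddMonoidAlgebra K E →ₗ[K] AddMonoidAlgebra K E := diag fun x => ((R.form x β : ℚ) : K)

variable {K : Type*} [Field K] [CharZero K]

lemma lap_denom : R.lap K (R.denom K) = ((R.form R.rho R.rho : ℚ) : K) • R.denom K := by
  apply AddMonoidAlgebra.coeff_injective
  ext x
  rw [lap, coeff_diag, AddMonoidAlgebra.coeff_smul_apply, smul_eq_mul]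
  by_cases h : (R.denom K).coeff x = 0
  · simp [h]
  · rw [R.form_eq_of_coeff_denom_ne_zero K x h]

/-- The deviation of the Laplace operator from the Leibniz rule. -/
noncomputable def gam (F G : AddMonoidAlgebra K E) : AddMonoidAlgebra K E :=
  R.lap K (F * G) - R.lap K F * G - F * R.lap K G

lemma gam_single (a b : E) (r s : K) :
    R.gam (AddMonoidAlgebra.single a r) (AddMonoidAlgebra.single b s) =
      AddMonoidAlgebra.single (a + b) (2 * ((R.form a b : ℚ) : K) * r * s) := by
  simp only [gam, lap, AddMonoidAlgebra.single_mul_single, diag_single,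
    ← AddMonoidAlgebra.single_sub]
  congr 1
  simp only [map_add, LinearMap.add_apply, R.form_comm b a]
  push_cast; ring

lemma gam_add_left (F F' G : AddMonoidAlgebra K E) :
    R.gam (F + F') G = R.gam F G + R.gam F' G := by
  simp only [gam, add_mul, map_add]; ring

lemma gam_add_right (F G G' : AddMonoidAlgebra K E) :
    R.gam F (G + G') = R.gam F G + R.gam F G' := by
  simp only [gam, mul_add, map_add]; ring

lemma gam_zero_left (G : AddMonoidAlgebra K E) : R.gam 0 G = 0 := by simp [gam]

lemma gam_zero_right (G : AddMonoidAlgebra K E) : R.gam G 0 = 0 := by simp [gam]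

lemma gam_mul (F F' G : AddMonoidAlgebra K E) :
    R.gam (F * F') G = F * R.gam F' G + F' * R.gam F G := by
  induction F using AddMonoidAlgebra.induction_linear with
  | zero => simp [gam_zero_left]
  | add f g hf hg => simp only [add_mul, gam_add_left, hf, hg, mul_add]; ring
  | single a r =>
  induction F' using AddMonoidAlgebra.induction_linear with
  | zero => simp [gam_zero_left]
  | add f g hf hg => simp only [add_mul, gam_add_left, hf, hg, mul_add]; ring
  | single b s =>
  induction G using AddMonoidAlgebra.induction_linear with
  | zero => simp [gam_zero_right]
  | add f g hf hg => simp only [gam_add_right, hf, hg, mul_add]; ring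
  | single c t =>
  simp only [gam_single, AddMonoidAlgebra.single_mul_single]
  rw [← add_assoc, ← add_assoc, add_comm b a, ← AddMonoidAlgebra.single_add]
  congr 1
  simp only [map_add, LinearMap.add_apply]
  push_cast; ring

lemma gam_theta (β : E) (F : AddMonoidAlgebra K E) :
    R.gam (theta K β) F = (AddMonoidAlgebra.single ((2⁻¹ : ℚ) • β) 1 +
      AddMonoidAlgebra.single (-((2⁻¹ : ℚ) • β)) 1) * R.der K β F := by
  induction F using AddMonoidAlgebra.induction_linear with
  | zero => simp [gam_zero_right]
  | add f g hf hg => simp only [gam_add_right, hf, hg, mul_add, map_add]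
  | single a r =>
    have h : theta K β = AddMonoidAlgebra.single ((2⁻¹ : ℚ) • β) 1 +
      AddMonoidAlgebra.single (-((2⁻¹ : ℚ) • β)) (-1) := by
      simp [theta, sub_eq_add_neg]
    rw [h, gam_add_left, gam_single, gam_single, der, diag_single, add_mul,
      AddMonoidAlgebra.single_mul_single, AddMonoidAlgebra.single_mul_single]
    have : (2 : K) ≠ 0 := two_ne_zero
    congr 2
    · simp [R.form_comm β a]
    · simp [R.form_comm β a]

lemma gam_prod (s : Finset E) (F : AddMonoidAlgebra K E) [DecidableEq E] :
    R.gam (∏ β ∈ s, theta K β) F =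
      ∑ β ∈ s, (∏ γ ∈ s.erase β, theta K γ) * R.gam (theta K β) F := by
  induction s using Finset.induction_on with
  | empty =>
    simp only [Finset.prod_empty, Finset.sum_empty]
    have h : R.lap K 1 = 0 := by simp [lap, AddMonoidAlgebra.one_def]
    simp [gam, h]
  | insert a s has ih =>
    rw [Finset.prod_insert has, gam_mul, ih, Finset.sum_insert has, Finset.erase_insert has,
      Finset.mul_sum, add_comm]
    congr 1
    apply Finset.sum_congr rfl
    intro β hβ
    rw [Finset.erase_insert_of_ne (by rintro rfl; exact has hβ),
      Finset.prod_insert (by simp [has]), mul_assoc]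

lemma sum_roots {M : Type*} [AddCommMonoid M] (T : E → M) :
    ∑ β ∈ R.roots, T β = ∑ β ∈ R.pos, (T β + T (-β)) := by
  classical
  rw [Finset.sum_add_distrib, ← Finset.sum_filter_add_sum_filter_not R.roots (fun β => 0 < R.ht β)]
  congr 1
  apply Finset.sum_nbij' (fun x => -x) (fun x => -x)
  · intro β hβ
    simp only [Finset.mem_filter, not_lt] at hβ
    rw [mem_pos]
    refine ⟨R.neg_mem _ hβ.1, ?_⟩
    have := lt_of_le_of_ne hβ.2 (R.ht_ne_zero _ hβ.1)
    simpa using this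
  · intro β hβ
    rw [mem_pos] at hβ
    simp only [Finset.mem_filter, not_lt]
    exact ⟨R.neg_mem _ hβ.1, by simpa using hβ.2.le⟩
  · simp
  · simp
  · simp

/-- The radial part of the Laplace operator. -/
lemma lap_denom_mul (F : AddMonoidAlgebra K E) (T : E → AddMonoidAlgebra K E)
    (hT : ∀ β ∈ R.roots,
      theta K β * T β = AddMonoidAlgebra.single ((2⁻¹ : ℚ) • β) 1 * R.der K β F) :
    R.lap K (R.denom K * F) = R.denom K *
      (((R.form R.rho R.rho : ℚ) : K) • F + R.lap K F + ∑ β ∈ R.roots, T β) := by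
  classical
  have h1 : R.lap K (R.denom K * F) =
      R.gam (R.denom K) F + R.lap K (R.denom K) * F + R.denom K * R.lap K F := by
    rw [gam]; ring
  have h2 : R.gam (R.denom K) F = R.denom K * ∑ β ∈ R.roots, T β := by
    rw [denom, gam_prod, sum_roots, Finset.mul_sum]
    apply Finset.sum_congr rfl
    intro β hβ
    have e1 := hT β (R.mem_pos.1 hβ).1
    have e2 := hT (-β) (R.neg_mem _ (R.mem_pos.1 hβ).1)
    have e3 : R.der K (-β) F = - R.der K β F := by
      apply AddMonoidAlgebra.coeff_injective
      ext x
      simp [der, coeff_diag]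
    rw [e3, theta_neg, smul_neg] at e2
    rw [gam_theta, ← Finset.prod_erase_mul _ _ hβ]
    linear_combination - (∏ γ ∈ R.pos.erase β, theta K γ) * (e1 - e2)
  rw [h1, h2, lap_denom, mul_add, mul_add, smul_mul_assoc, mul_smul_comm]
  ring

end RootFrame

namespace RootFrame

variable {E : Type*} [AddCommGroup E] [Module ℚ E]

/-- The weights of a representation of dimension at most `r`, together with a predicate `Occ k ν`
which is meant to say that `ν` is a highest weight in the `k`-th tensor power. -/
structure WeightFrame (R : RootFrame E) (r : ℕ) where
  S : Finset E
  Occ : ℕ → E → Prop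
  refl_mem : ∀ β ∈ R.roots, ∀ π ∈ S, R.refl β π ∈ S
  exists_int : ∀ β ∈ R.roots, ∀ π ∈ S, ∃ n : ℤ, R.co β π = n
  sub_mem : ∀ β ∈ R.roots, ∀ π ∈ S, 0 < R.co β π → π - β ∈ S
  card_le : S.card ≤ r
  occ_zero : Occ 0 0
  occ_succ : ∀ k ν μ, Occ k ν → μ ∈ S → (∀ π ∈ S, R.form π π ≤ R.form μ μ) →
    (∀ β ∈ R.pos, 0 ≤ R.co β (ν + μ)) → Occ (k + 1) (ν + μ)
  le_of_occ : ∀ n, 1 ≤ n → Occ n 0 → r ≤ n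
  nonempty : S.Nonempty

namespace WeightFrame

variable {R : RootFrame E} {r : ℕ} (W : R.WeightFrame r)

/-- The weights of maximal length. -/
noncomputable def top : Finset E := W.S.filter fun μ => ∀ π ∈ W.S, R.form π π ≤ R.form μ μ

lemma mem_top {μ : E} : μ ∈ W.top ↔ μ ∈ W.S ∧ ∀ π ∈ W.S, R.form π π ≤ R.form μ μ := by
  simp [top]

lemma refl_mem_top {β μ : E} (hβ : β ∈ R.roots) (hμ : μ ∈ W.top) : R.refl β μ ∈ W.top := by
  rw [mem_top] at hμ ⊢
  exact ⟨W.refl_mem β hβ μ hμ.1, by simpa only [form_refl] using hμ.2⟩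

lemma co_sum_nonneg {F : Finset E} {β : E} (hβ : β ∈ R.pos) (hF : F ⊆ W.top)
    (hup : ∀ μ ∈ F, ∀ π ∈ W.top, R.ht μ < R.ht π → π ∈ F) : 0 ≤ R.co β (∑ μ ∈ F, μ) := by
  classical
  have hβ' := R.mem_pos.1 hβ
  rw [map_sum]
  set A := F.filter fun μ => R.co β μ < 0 with hA
  have hinj : Set.InjOn (R.refl β) (A : Set E) := (R.refl β).injective.injOn
  have hco : ∀ μ, R.co β (R.refl β μ) = - R.co β μ := by
    intro μ
    rw [refl_apply, map_sub, map_smul, R.co_self (R.ne_zero hβ'.1), smul_eq_mul]; ring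
  have hsub : A.image (R.refl β) ⊆ F.filter fun μ => ¬ R.co β μ < 0 := by
    intro x hx
    obtain ⟨μ, hμ, rfl⟩ := Finset.mem_image.1 hx
    rw [hA, Finset.mem_filter] at hμ
    rw [Finset.mem_filter]
    constructor
    · refine hup μ hμ.1 _ (W.refl_mem_top hβ'.1 (hF hμ.1)) ?_
      rw [refl_apply]; simp; nlinarith
    · rw [hco]; linarith
  rw [← Finset.sum_filter_add_sum_filter_not F (fun μ => R.co β μ < 0)]
  have h1 := Finset.sum_le_sum_of_subset_of_nonneg (f := fun μ => R.co β μ) hsub (by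
    intro i hi _; rw [Finset.mem_filter] at hi; linarith)
  rw [Finset.sum_image hinj] at h1
  simp only [hco, Finset.sum_neg_distrib] at h1
  linarith

lemma exists_upper (n : ℕ) (hn : n ≤ W.top.card) : ∃ F ⊆ W.top, F.card = n ∧
    (∀ μ ∈ F, ∀ π ∈ W.top, R.ht μ < R.ht π → π ∈ F) ∧ W.Occ n (∑ μ ∈ F, μ) := by
  classical
  induction n with
  | zero => exact ⟨∅, by simp, by simp, by simp, by simpa using W.occ_zero⟩
  | succ n ih =>
    obtain ⟨F, hF, hc, hup, hocc⟩ := ih (by omega)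
    obtain ⟨μ, hμ, hmax⟩ := Finset.exists_max_image (W.top \ F) R.ht (by
      rw [Finset.sdiff_nonempty]
      intro h
      have := Finset.card_le_card h
      omega)
    rw [Finset.mem_sdiff] at hμ
    have hsub : insert μ F ⊆ W.top := Finset.insert_subset hμ.1 hF
    have hup' : ∀ ν ∈ insert μ F, ∀ π ∈ W.top, R.ht ν < R.ht π → π ∈ insert μ F := by
      intro ν hν π hπ hlt
      rw [Finset.mem_insert] at hν ⊢
      rcases hν with rfl | hν
      · right
        by_contra h
        have := hmax π (Finset.mem_sdiff.2 ⟨hπ, h⟩)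
        linarith
      · exact Or.inr (hup ν hν π hπ hlt)
    refine ⟨insert μ F, hsub, by rw [Finset.card_insert_of_notMem hμ.2, hc], hup', ?_⟩
    have hs : ∑ x ∈ insert μ F, x = ∑ x ∈ F, x + μ := by
      rw [Finset.sum_insert hμ.2, add_comm]
    rw [hs]
    refine W.occ_succ _ _ _ hocc (W.mem_top.1 hμ.1).1 (W.mem_top.1 hμ.1).2 fun β hβ => ?_
    rw [← hs]
    exact W.co_sum_nonneg hβ hsub hup'

lemma form_sum_eq_zero {T : Finset E} {β : E} (hβ : β ≠ 0) (hT : ∀ π ∈ T, R.refl β π ∈ T) :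
    R.form (∑ π ∈ T, π) β = 0 := by
  rw [← R.refl_eq_self_iff hβ, map_sum]
  exact Finset.sum_nbij' (R.refl β) (R.refl β) hT hT (by simp [refl_refl]) (by simp [refl_refl])
    (by simp)

lemma top_eq_and_card : W.top = W.S ∧ W.S.card = r := by
  have hne : W.top.Nonempty := by
    obtain ⟨μ, h1, h2⟩ := Finset.exists_max_image W.S (fun x => R.form x x) W.nonempty
    exact ⟨μ, W.mem_top.2 ⟨h1, h2⟩⟩
  obtain ⟨F, hF, hc, -, hocc⟩ := W.exists_upper W.top.card le_rfl
  obtain rfl := Finset.eq_of_subset_of_card_le hF hc.ge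
  have h0 : ∑ μ ∈ W.top, μ = 0 := R.eq_zero_of_form _ fun β hβ =>
    form_sum_eq_zero (R.ne_zero hβ) fun π hπ => W.refl_mem_top hβ hπ
  rw [h0] at hocc
  have h1 := W.le_of_occ _ (Finset.card_pos.2 hne) hocc
  have hsub : W.top ⊆ W.S := fun x hx => (W.mem_top.1 hx).1
  have h2 := W.card_le
  have h3 := Finset.card_le_card hsub
  exact ⟨Finset.eq_of_subset_of_card_le hsub (by omega), by omega⟩

lemma card_eq : W.S.card = r := W.top_eq_and_card.2

lemma form_le {μ π : E} (hμ : μ ∈ W.S) (hπ : π ∈ W.S) : R.form π π ≤ R.form μ μ := by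
  rw [← W.top_eq_and_card.1, mem_top] at hμ
  exact hμ.2 π hπ

lemma co_le_one {β π : E} (hβ : β ∈ R.roots) (hπ : π ∈ W.S) : R.co β π ≤ 1 := by
  by_contra h
  push Not at h
  have h1 := W.form_le (W.sub_mem β hβ π hπ (by linarith)) hπ
  have h2 := R.two_form β π
  have h3 := R.form_pos β (R.ne_zero hβ)
  simp only [map_sub, LinearMap.sub_apply, R.form_comm β π] at h1
  nlinarith

lemma neg_one_le_co {β π : E} (hβ : β ∈ R.roots) (hπ : π ∈ W.S) : -1 ≤ R.co β π := by
  have := W.co_le_one (R.neg_mem β hβ) hπ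
  rw [co_neg_left] at this; linarith

lemma co_cases {β π : E} (hβ : β ∈ R.roots) (hπ : π ∈ W.S) :
    R.co β π = -1 ∨ R.co β π = 0 ∨ R.co β π = 1 := by
  obtain ⟨n, hn⟩ := W.exists_int β hβ π hπ
  have h1 := W.co_le_one hβ hπ
  have h2 := W.neg_one_le_co hβ hπ
  rw [hn] at h1 h2 ⊢
  have h1 : n ≤ 1 := by exact_mod_cast h1
  have h2 : -1 ≤ n := by exact_mod_cast h2
  have : n = -1 ∨ n = 0 ∨ n = 1 := by omega
  rcases this with rfl | rfl | rfl <;> simp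

variable (R) in
/-- The Weyl group, as a monoid. -/
def weyl : Submonoid (E ≃ₗ[ℚ] E) := Submonoid.closure (R.refl '' (R.roots : Set E))

lemma weyl_mem {w : E ≃ₗ[ℚ] E} (hw : w ∈ weyl R) {π : E} (hπ : π ∈ W.S) : w π ∈ W.S := by
  induction hw using Submonoid.closure_induction generalizing π with
  | mem w hw => obtain ⟨β, hβ, rfl⟩ := hw; exact W.refl_mem β hβ π hπ
  | one => exact hπ
  | mul a b _ _ ha hb => exact ha (hb hπ)

lemma exists_occ_weyl (l : List E) (hl : ∀ π ∈ l, π ∈ W.S) : ∃ w ∈ weyl R,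
    W.Occ l.length (w l.sum) ∧ ∀ β ∈ R.pos, ∃ n : ℕ, R.co β (w l.sum) = n := by
  classical
  induction l with
  | nil => exact ⟨1, one_mem _, by simpa using W.occ_zero, fun β _ => ⟨0, by simp⟩⟩
  | cons π₀ l ih =>
    obtain ⟨u, hu, hocc, hdom⟩ := ih fun π hπ => hl π (by simp [hπ])
    set ν := u l.sum with hν
    have hπ₀ := hl π₀ (by simp)
    obtain ⟨π, hπ, hmax⟩ := Finset.exists_max_image
      (W.S.filter fun π => ∃ w ∈ weyl R, w ν = ν ∧ w (u π₀) = π) R.ht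
      ⟨u π₀, by
        rw [Finset.mem_filter]
        exact ⟨W.weyl_mem hu hπ₀, 1, one_mem _, rfl, rfl⟩⟩
    rw [Finset.mem_filter] at hπ
    obtain ⟨hπS, w, hw, hwν, hwπ⟩ := hπ
    have hdom' : ∀ β ∈ R.pos, ∃ n : ℕ, R.co β (ν + π) = n := by
      intro β hβ
      have hβ' := R.mem_pos.1 hβ
      obtain ⟨n, hn⟩ := hdom β hβ
      rcases n.eq_zero_or_pos with rfl | hpos
      · have h1 : R.ht (R.refl β π) ≤ R.ht π := by
          apply hmax
          rw [Finset.mem_filter]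
          refine ⟨W.refl_mem β hβ'.1 π hπS, R.refl β * w,
            mul_mem (Submonoid.subset_closure ⟨β, hβ'.1, rfl⟩) hw, ?_, ?_⟩
          · rw [LinearEquiv.mul_apply, hwν, refl_apply, hn]; simp
          · rw [LinearEquiv.mul_apply, hwπ]
        have h2 : 0 ≤ R.co β π := by
          rw [refl_apply] at h1; simp at h1
          by_contra hc; nlinarith
        rcases W.co_cases hβ'.1 hπS with h | h | h
        · rw [h] at h2; norm_num at h2
        · exact ⟨0, by rw [map_add, hn, h]; norm_num⟩
        · exact ⟨1, by rw [map_add, hn, h]; norm_num⟩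
      · obtain ⟨m, rfl⟩ : ∃ m, n = m + 1 := ⟨n - 1, by omega⟩
        rcases W.co_cases hβ'.1 hπS with h | h | h
        · exact ⟨m, by rw [map_add, hn, h]; push_cast; ring⟩
        · exact ⟨m + 1, by rw [map_add, hn, h]; push_cast; ring⟩
        · exact ⟨m + 2, by rw [map_add, hn, h]; push_cast; ring⟩
    have hsum : (w * u) (π₀ :: l).sum = ν + π := by
      rw [LinearEquiv.mul_apply, List.sum_cons, map_add, map_add, hwπ, ← hν, hwν, add_comm]
    refine ⟨w * u, mul_mem hw hu, ?_, ?_⟩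
    · rw [hsum, List.length_cons]
      refine W.occ_succ _ _ _ hocc hπS (fun π' h => W.form_le hπS h) fun β hβ => ?_
      obtain ⟨n, hn⟩ := hdom' β hβ
      rw [hn]; exact Nat.cast_nonneg n
    · rwa [hsum]

lemma le_card_of_orthogonal {ι : Type*} (s : Finset ι) (hs : s.Nonempty) (f : ι → E)
    (hf : ∀ i ∈ s, f i ∈ W.S) (h : ∀ β ∈ R.roots, R.form (∑ i ∈ s, f i) β = 0) :
    r ≤ s.card := by
  obtain ⟨w, -, hocc, -⟩ := W.exists_occ_weyl (s.toList.map f) (by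
    intro π hπ
    simp only [List.mem_map, Finset.mem_toList] at hπ
    obtain ⟨i, hi, rfl⟩ := hπ
    exact hf i hi)
  rw [Finset.sum_map_toList, R.eq_zero_of_form _ h, map_zero] at hocc
  simp only [List.length_map, Finset.length_toList] at hocc
  exact W.le_of_occ _ (Finset.card_pos.2 hs) hocc

end WeightFrame

end RootFrame

namespace RootFrame

variable {E : Type*} [AddCommGroup E] [Module ℚ E] (R : RootFrame E)

/-- A union of irreducible components of the root system, orthogonal to all other roots. -/
structure IsComponent (Φ : Finset E) : Prop where
  subset : Φ ⊆ R.roots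
  orthogonal : ∀ β ∈ Φ, ∀ γ ∈ R.roots, γ ∉ Φ → R.form β γ = 0
  irreducible : ∀ A ⊆ Φ, A.Nonempty → (∀ a ∈ A, ∀ b ∈ Φ, b ∉ A → R.form a b = 0) → A = Φ

variable {R}

lemma IsComponent.refl_mem {Φ : Finset E} (h : R.IsComponent Φ) {β γ : E} (hβ : β ∈ Φ)
    (hγ : γ ∈ Φ) : R.refl β γ ∈ Φ := by
  by_contra hc
  have hm := R.refl_mem_roots (h.subset hβ) (h.subset hγ)
  have h1 := h.orthogonal β hβ _ hm hc
  have h2 := h.orthogonal γ hγ _ hm hc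
  have h3 : R.form (R.refl β γ) (R.refl β γ) = 0 := by
    conv_lhs => enter [1]; rw [refl_apply]
    simp [h1, h2]
  exact R.ne_zero hm (R.eq_zero_of_form_self h3)

lemma IsComponent.neg_mem {Φ : Finset E} (h : R.IsComponent Φ) {β : E} (hβ : β ∈ Φ) :
    -β ∈ Φ := by
  rw [← R.refl_self (R.ne_zero (h.subset hβ))]
  exact h.refl_mem hβ hβ

/-- No entry of the list is in the span of the later ones. -/
def Indep : List E → Prop
  | [] => True
  | a :: l => a ∉ Submodule.span ℚ {x | x ∈ l} ∧ Indep l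

lemma exists_indep (l₀ : List E) (h₀ : Indep l₀) (Z : Finset E) : ∃ l : List E,
    (∀ x ∈ l, x ∈ Z) ∧ Indep (l ++ l₀) ∧
    ∀ z ∈ Z, z ∈ Submodule.span ℚ {x | x ∈ l ++ l₀} := by
  classical
  induction Z using Finset.induction_on with
  | empty => exact ⟨[], by simp, h₀, by simp⟩
  | insert z Z _ ih =>
    obtain ⟨l, h1, h2, h3⟩ := ih
    by_cases hz : z ∈ Submodule.span ℚ {x | x ∈ l ++ l₀}
    · refine ⟨l, fun x hx => by simp [h1 x hx], h2, fun x hx => ?_⟩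
      rcases Finset.mem_insert.1 hx with rfl | hx
      · exact hz
      · exact h3 x hx
    · refine ⟨z :: l, ?_, ⟨hz, h2⟩, fun x hx => ?_⟩
      · intro x hx
        rcases List.mem_cons.1 hx with rfl | hx
        · simp
        · simp [h1 x hx]
      · rcases Finset.mem_insert.1 hx with rfl | hx
        · exact Submodule.subset_span (by simp)
        · refine Submodule.span_mono ?_ (h3 x hx)
          intro y hy
          simp only [List.cons_append, List.mem_cons, Set.mem_ofPred_eq] at hy ⊢
          exact Or.inr hy

variable (R) in
/-- The product of the reflections in the entries of a list. -/
noncomputable def prodRefl (l : List E) : E ≃ₗ[ℚ] E := (l.map R.refl).prod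

@[simp] lemma prodRefl_nil (x : E) : R.prodRefl [] x = x := rfl

@[simp] lemma prodRefl_cons (a : E) (l : List E) (x : E) :
    R.prodRefl (a :: l) x = R.refl a (R.prodRefl l x) := by
  simp [prodRefl, LinearEquiv.mul_apply]

lemma prodRefl_append (l l' : List E) (x : E) :
    R.prodRefl (l ++ l') x = R.prodRefl l (R.prodRefl l' x) := by
  simp [prodRefl, LinearEquiv.mul_apply]

lemma form_prodRefl (l : List E) (x y : E) :
    R.form (R.prodRefl l x) (R.prodRefl l y) = R.form x y := by
  induction l with
  | nil => rfl
  | cons a l ih => simp [form_refl, ih]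

lemma prodRefl_sub_mem (l : List E) (x : E) :
    R.prodRefl l x - x ∈ Submodule.span ℚ {y | y ∈ l} := by
  induction l with
  | nil => simp
  | cons a l ih =>
    rw [prodRefl_cons, refl_apply]
    have h1 : Submodule.span ℚ {y | y ∈ l} ≤ Submodule.span ℚ {y | y ∈ a :: l} :=
      Submodule.span_mono fun y hy => by simp_all
    have h2 : a ∈ Submodule.span ℚ {y | y ∈ a :: l} := Submodule.subset_span (by simp)
    rw [sub_right_comm]
    exact _root_.sub_mem (h1 ih) (Submodule.smul_mem _ _ h2)

lemma prodRefl_eq_self (l : List E) {x : E} (h : ∀ a ∈ l, R.form x a = 0) :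
    R.prodRefl l x = x := by
  induction l with
  | nil => rfl
  | cons a l ih =>
    rw [prodRefl_cons, ih fun b hb => h b (by simp [hb]), refl_apply, co_apply, h a (by simp)]
    simp

lemma form_eq_zero_of_prodRefl (l : List E) (hl : Indep l) {x : E} (h : R.prodRefl l x = x) :
    ∀ a ∈ l, R.form x a = 0 := by
  induction l generalizing x with
  | nil => simp
  | cons a l ih =>
    obtain ⟨hl1, hl2⟩ := hl
    have ha : a ≠ 0 := by rintro rfl; exact hl1 (zero_mem _)
    rw [prodRefl_cons] at h
    have h1 : R.prodRefl l x = R.refl a x := by rw [← h, refl_refl, h]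
    have h2 := R.prodRefl_sub_mem l x
    have h3 : R.co a x = 0 := by
      by_contra hne
      rw [h1, refl_apply, sub_sub_cancel_left, Submodule.neg_mem_iff,
        Submodule.smul_mem_iff _ hne] at h2
      exact hl1 h2
    have h4 : R.form x a = 0 := (R.co_eq_zero_iff ha).1 h3
    have h5 : R.prodRefl l x = x := by rw [h1]; exact (R.refl_eq_self_iff ha).2 h4
    intro b hb
    rcases List.mem_cons.1 hb with rfl | hb
    · exact h4
    · exact ih hl2 h5 b hb

lemma prodRefl_mem {A : Finset E} {l : List E} (h : ∀ a ∈ l, ∀ x ∈ A, R.refl a x ∈ A) {x : E}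
    (hx : x ∈ A) : R.prodRefl l x ∈ A := by
  induction l with
  | nil => exact hx
  | cons a l ih =>
    rw [prodRefl_cons]
    exact h a (by simp) _ (ih fun b hb => h b (by simp [hb]))

namespace WeightFrame

variable {r : ℕ} (W : R.WeightFrame r) {Φ : Finset E}

/-- The roots of a component orthogonal to the weight `μ`. -/
noncomputable def perp (R : RootFrame E) (Φ : Finset E) (μ : E) : Finset E :=
  Φ.filter fun γ => R.co γ μ = 0

lemma mem_span_perp (W : R.WeightFrame r) (hΦ : R.IsComponent Φ) {μ γ γ₁ : E} (hμ : μ ∈ W.S)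
    (hγ : γ ∈ Φ) (hγ₁ : γ₁ ∈ Φ) (h : R.co γ μ = 1) (h₁ : R.co γ₁ μ = 1)
    (hne : R.form γ γ₁ ≠ 0) :
    γ ∈ Submodule.span ℚ (insert γ₁ (perp R Φ μ : Set E)) := by
  have g0 := R.ne_zero (hΦ.subset hγ)
  have g10 := R.ne_zero (hΦ.subset hγ₁)
  have key : ∀ a ∈ Φ, ∀ b ∈ Φ, R.co a μ = 1 → R.co b μ = 1 → R.form a b ≠ 0 →
      (R.co a b = 1 ∧ R.refl b a ∈ perp R Φ μ) ∨ R.co a b = 2 := by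
    intro a ha b hb ha1 hb1 hab
    have hm := hΦ.refl_mem hb ha
    have h1 : R.co (R.refl b a) μ = 1 - R.co a b := by
      rw [co_refl, refl_apply, map_sub, map_smul, ha1, hb1]; simp
    obtain ⟨n, hn⟩ := R.exists_int a (hΦ.subset ha) b (hΦ.subset hb)
    rw [← co_apply] at hn
    have hn0 : R.co a b ≠ 0 := by
      rw [Ne, R.co_eq_zero_iff (R.ne_zero (hΦ.subset ha)), form_comm]; exact hab
    rcases W.co_cases (hΦ.subset hm) hμ with h2 | h2 | h2
    · right; linarith
    · left; exact ⟨by linarith, by rw [perp, Finset.mem_filter]; exact ⟨hm, h2⟩⟩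
    · exact absurd (by linarith) hn0
  have hs1 : γ₁ ∈ Submodule.span ℚ (insert γ₁ (perp R Φ μ : Set E)) :=
    Submodule.subset_span (by simp)
  have hs2 : ∀ z ∈ perp R Φ μ, z ∈ Submodule.span ℚ (insert γ₁ (perp R Φ μ : Set E)) :=
    fun z hz => Submodule.subset_span (by simp [hz])
  rcases key γ hγ γ₁ hγ₁ h h₁ hne with ⟨-, h2⟩ | h2
  · have : γ = R.refl γ₁ γ + R.co γ₁ γ • γ₁ := by rw [refl_apply]; abel
    rw [this]
    exact add_mem (hs2 _ h2) (Submodule.smul_mem _ _ hs1)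
  rcases key γ₁ hγ₁ γ hγ h₁ h (by rwa [form_comm]) with ⟨-, h3⟩ | h3
  · have h4 : R.co γ γ₁ • γ = γ₁ - R.refl γ γ₁ := by rw [refl_apply]; abel
    rw [← Submodule.smul_mem_iff _ (show R.co γ γ₁ ≠ 0 by rw [h2]; norm_num), h4]
    exact _root_.sub_mem hs1 (hs2 _ h3)
  · have e1 := R.two_form γ γ₁
    have e2 := R.two_form γ₁ γ
    rw [h2] at e1
    rw [h3] at e2
    have : γ - γ₁ = 0 := by
      apply R.eq_zero_of_form_self
      simp only [map_sub, LinearMap.sub_apply]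
      have := R.form_comm γ γ₁
      linarith
    rw [sub_eq_zero.1 this]; exact hs1

lemma component_le_span (W : R.WeightFrame r) (hΦ : R.IsComponent Φ) {μ γ₀ : E} (hμ : μ ∈ W.S)
    (hγ₀ : γ₀ ∈ Φ) (h₀ : R.co γ₀ μ = 1) :
    (Φ : Set E) ⊆ Submodule.span ℚ (insert γ₀ (perp R Φ μ : Set E)) := by
  classical
  set T := Submodule.span ℚ (insert γ₀ (perp R Φ μ : Set E)) with hT
  have hzT : ∀ z ∈ perp R Φ μ, z ∈ T := fun z hz => Submodule.subset_span (by simp [hz])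
  let A := Φ.filter fun x => x ∈ T ∧
    (R.co x μ ≠ 0 ∨ ∃ γ ∈ Φ, R.co γ μ = 1 ∧ γ ∈ T ∧ R.form x γ ≠ 0)
  have hA : A = Φ := by
    apply hΦ.irreducible A (Finset.filter_subset _ _)
    · refine ⟨γ₀, Finset.mem_filter.2 ⟨hγ₀, Submodule.subset_span (by simp), Or.inl ?_⟩⟩
      rw [h₀]; norm_num
    · intro a ha b hb hbA
      have hC : ∀ γ ∈ Φ, R.co γ μ = 1 → γ ∈ T → R.form γ b = 0 := by
        intro γ hγ h1 h2
        by_contra hne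
        apply hbA
        by_cases hbT : b ∈ T
        · exact Finset.mem_filter.2 ⟨hb, hbT, Or.inr ⟨γ, hγ, h1, h2, by rwa [form_comm]⟩⟩
        · exfalso; apply hbT
          have hle : Submodule.span ℚ (insert γ (perp R Φ μ : Set E)) ≤ T := by
            rw [Submodule.span_le]
            intro x hx
            rcases hx with rfl | hx
            · exact h2
            · exact hzT x hx
          rcases W.co_cases (hΦ.subset hb) hμ with h3 | h3 | h3
          · have := W.mem_span_perp hΦ hμ (hΦ.neg_mem hb) hγ (by rw [co_neg_left, h3]; norm_num)
              h1 (by simpa [R.form_comm b γ] using hne)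
            simpa using hle this
          · exact hzT b (Finset.mem_filter.2 ⟨hb, h3⟩)
          · exact hle (W.mem_span_perp hΦ hμ hb hγ h3 h1 (by rwa [form_comm]))
      obtain ⟨haΦ, haT, ha2⟩ := Finset.mem_filter.1 ha
      rcases W.co_cases (hΦ.subset haΦ) hμ with h3 | h3 | h3
      · have := hC (-a) (hΦ.neg_mem haΦ) (by rw [co_neg_left, h3]; norm_num) (by simpa using haT)
        simpa using this
      · obtain ⟨γ, hγ, h4, h5, h6⟩ := ha2.resolve_left (by simp [h3])
        have haμ : R.refl a μ = μ := by rw [refl_apply, h3]; simp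
        have e1 := hC γ hγ h4 h5
        have e2 := hC (R.refl a γ) (hΦ.refl_mem haΦ hγ) (by rw [co_refl, haμ, h4])
          (by rw [refl_apply]; exact _root_.sub_mem h5 (Submodule.smul_mem _ _ haT))
        rw [refl_apply] at e2
        simp only [map_sub, map_smul, LinearMap.sub_apply, LinearMap.smul_apply, e1, smul_eq_mul,
          zero_sub, neg_eq_zero, mul_eq_zero] at e2
        refine e2.resolve_left ?_
        rw [R.co_eq_zero_iff (R.ne_zero (hΦ.subset haΦ)), form_comm]
        exact h6
      · exact hC a haΦ h3 haT
  intro x hx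
  rw [← hA] at hx
  exact (Finset.mem_filter.1 hx).2.1

/-- A Coxeter-like element for a component and a weight not orthogonal to the component. -/
lemma exists_coxeter (hΦ : R.IsComponent Φ) {μ γ : E} (hμ : μ ∈ W.S) (hγ : γ ∈ Φ)
    (h : R.co γ μ ≠ 0) : ∃ c : E ≃ₗ[ℚ] E, (∀ x y, R.form (c x) (c y) = R.form x y) ∧
      (∀ π ∈ W.S, c π ∈ W.S) ∧ (∀ x, c x - x ∈ Submodule.span ℚ (Φ : Set E)) ∧
      (∀ x, (∀ β ∈ Φ, R.form x β = 0) ↔ c x = x) ∧ (∀ β ∈ Φ, c β ∈ Φ) ∧ μ - c μ ∈ Φ := by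
  obtain ⟨γ₀, hγ₀, h₀⟩ : ∃ γ₀ ∈ Φ, R.co γ₀ μ = 1 := by
    rcases W.co_cases (hΦ.subset hγ) hμ with h1 | h1 | h1
    · exact ⟨-γ, hΦ.neg_mem hγ, by rw [co_neg_left, h1]; norm_num⟩
    · exact absurd h1 h
    · exact ⟨γ, hγ, h1⟩
  obtain ⟨l, hl, hind, hspan⟩ := exists_indep [γ₀]
    (by simpa [Indep] using R.ne_zero (hΦ.subset hγ₀)) (perp R Φ μ)
  have hlΦ : ∀ a ∈ l, a ∈ Φ := fun a ha => (Finset.mem_filter.1 (hl a ha)).1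
  have hl' : ∀ a ∈ l ++ [γ₀], a ∈ Φ := by
    intro a ha
    rcases List.mem_append.1 ha with ha | ha
    · exact hlΦ a ha
    · rw [List.mem_singleton.1 ha]; exact hγ₀
  refine ⟨R.prodRefl (l ++ [γ₀]), fun x y => form_prodRefl _ x y, fun π hπ => ?_, fun x => ?_,
    fun x => ⟨fun hx => ?_, fun hx => ?_⟩, fun β hβ => ?_, ?_⟩
  · exact prodRefl_mem (fun a ha x hx => W.refl_mem a (hΦ.subset (hl' a ha)) x hx) hπ
  · exact Submodule.span_mono (fun y hy => hl' y hy) (R.prodRefl_sub_mem _ x)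
  · exact prodRefl_eq_self _ fun a ha => hx a (hl' a ha)
  · have h1 := form_eq_zero_of_prodRefl _ hind hx
    have h2 : Submodule.span ℚ {a | a ∈ l ++ [γ₀]} ≤ LinearMap.ker (R.form x) := by
      rw [Submodule.span_le]; exact fun a ha => h1 a ha
    have h3 : Submodule.span ℚ (insert γ₀ (perp R Φ μ : Set E)) ≤
        Submodule.span ℚ {a | a ∈ l ++ [γ₀]} := by
      rw [Submodule.span_le]
      intro a ha
      rcases ha with rfl | ha
      · exact Submodule.subset_span (by simp)
      · exact hspan a ha
    intro β hβ
    exact h2 (h3 (W.component_le_span hΦ hμ hγ₀ h₀ hβ))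
  · exact prodRefl_mem (fun a ha x hx => hΦ.refl_mem (hl' a ha) hx) hβ
  · rw [prodRefl_append, prodRefl_cons, prodRefl_nil, refl_apply, h₀, one_smul, map_sub,
      prodRefl_eq_self l (x := μ), sub_sub_cancel]
    · exact prodRefl_mem (fun a ha x hx => hΦ.refl_mem (hlΦ a ha) hx) hγ₀
    · intro a ha
      have := Finset.mem_filter.1 (hl a ha)
      exact (R.co_eq_zero_iff (R.ne_zero (hΦ.subset this.1))).1 this.2

end WeightFrame

end RootFrame

namespace RootFrame

namespace WeightFrame

variable {E : Type*} [AddCommGroup E] [Module ℚ E] {R : RootFrame E}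
  {r : ℕ} (W : R.WeightFrame r) {Φ : Finset E}

/-- The isometries preserving the weights and a component which act trivially orthogonally
to the component. -/
def autGroup (W : R.WeightFrame r) (Φ : Finset E) : Subgroup (E ≃ₗ[ℚ] E) where
  carrier := {g | (∀ x y, R.form (g x) (g y) = R.form x y) ∧ (∀ x, g x ∈ W.S ↔ x ∈ W.S) ∧
    (∀ x, g x ∈ Φ ↔ x ∈ Φ) ∧ (∀ x, g x - x ∈ Submodule.span ℚ (Φ : Set E)) ∧
    ∀ x, (∀ β ∈ Φ, R.form x β = 0) → g x = x}
  mul_mem' := by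
    rintro a b ⟨a1, a2, a3, a4, a5⟩ ⟨b1, b2, b3, b4, b5⟩
    refine ⟨fun x y => ?_, fun x => ?_, fun x => ?_, fun x => ?_, fun x hx => ?_⟩
    · simp [LinearEquiv.mul_apply, a1, b1]
    · simp [LinearEquiv.mul_apply, a2, b2]
    · simp [LinearEquiv.mul_apply, a3, b3]
    · simpa [LinearEquiv.mul_apply] using add_mem (a4 (b x)) (b4 x)
    · rw [LinearEquiv.mul_apply, b5 x hx, a5 x hx]
  one_mem' := by simp
  inv_mem' := by
    rintro a ⟨a1, a2, a3, a4, a5⟩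
    have ha : ∀ x, a (a⁻¹ x) = x := fun x => a.apply_symm_apply x
    refine ⟨fun x y => ?_, fun x => ?_, fun x => ?_, fun x => ?_, fun x hx => ?_⟩
    · rw [← a1, ha, ha]
    · rw [← a2, ha]
    · rw [← a3, ha]
    · rw [← Submodule.neg_mem_iff, neg_sub]
      simpa [ha] using a4 (a⁻¹ x)
    · apply a.injective
      rw [ha, a5 x hx]

lemma mem_iff_of_forall_mem {A : Finset E} {c : E ≃ₗ[ℚ] E} (h : ∀ x ∈ A, c x ∈ A) (x : E) :
    c x ∈ A ↔ x ∈ A := by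
  classical
  refine ⟨fun hx => ?_, h x⟩
  have h1 : A.image c = A := by
    apply Finset.eq_of_subset_of_card_le
    · exact Finset.image_subset_iff.2 h
    · rw [Finset.card_image_of_injective _ c.injective]
  rw [← h1, Finset.mem_image] at hx
  obtain ⟨y, hy, hxy⟩ := hx
  rwa [← c.injective hxy]

lemma eq_zero_of_mem_span {x : E} (hx : x ∈ Submodule.span ℚ (Φ : Set E))
    (h : ∀ β ∈ Φ, R.form x β = 0) : x = 0 := by
  apply R.eq_zero_of_form_self
  have : Submodule.span ℚ (Φ : Set E) ≤ LinearMap.ker (R.form x) := by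
    rw [Submodule.span_le]; exact fun a ha => h a ha
  exact this hx

open Classical in
/-- The weights differing from `lam` by a vector orthogonal to the component. -/
noncomputable def fiber (W : R.WeightFrame r) (Φ : Finset E) (lam : E) : Finset E :=
  W.S.filter fun π => ∀ β ∈ Φ, R.form (π - lam) β = 0

section

variable {c : E ≃ₗ[ℚ] E} {lam : E}

lemma le_card_mul_fiber (hΦ : R.IsComponent Φ) (hc : c ∈ W.autGroup Φ)
    (hfix : ∀ x, c x = x → ∀ β ∈ Φ, R.form x β = 0) (hlam : lam ∈ W.S) {ι : Type*}
    (s : Finset ι) (hs : s.Nonempty) (k : ι → ℤ)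
    (hk : c (∑ j ∈ s, (c ^ k j) lam) = ∑ j ∈ s, (c ^ k j) lam) :
    r ≤ s.card * (W.fiber Φ lam).card := by
  have hz : ∀ k : ℤ, c ^ k ∈ W.autGroup Φ := fun k => zpow_mem hc k
  have hY : (W.fiber Φ lam).Nonempty := ⟨lam, by simp [fiber, hlam]⟩
  rw [← Finset.card_product]
  apply W.le_card_of_orthogonal (s ×ˢ W.fiber Φ lam) (hs.product hY)
    (fun q => (c ^ k q.1) q.2)
  · intro q hq
    exact ((hz _).2.1 _).2 (Finset.mem_filter.1 (Finset.mem_product.1 hq).2).1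
  · intro β hβ
    by_cases hβΦ : β ∈ Φ
    · have h1 : ∀ q ∈ s ×ˢ W.fiber Φ lam, R.form ((c ^ k q.1) q.2) β =
          R.form ((c ^ k q.1) lam) β := by
        intro q hq
        have h2 := (Finset.mem_filter.1 (Finset.mem_product.1 hq).2).2
        have h3 := (hz (k q.1)).2.2.2.2 _ h2
        rw [map_sub, sub_eq_iff_eq_add] at h3
        rw [h3, map_add, LinearMap.add_apply, h2 β hβΦ, zero_add]
      rw [map_sum, LinearMap.sum_apply, Finset.sum_congr rfl h1, Finset.sum_product]
      simp only [Finset.sum_const, ← Finset.smul_sum]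
      rw [← LinearMap.sum_apply, ← map_sum, hfix _ hk β hβΦ, smul_zero]
    · have h0 : ∀ a ∈ Φ, R.form a β = 0 := fun a ha => hΦ.orthogonal a ha β hβ hβΦ
      have h0' : ∀ x ∈ Submodule.span ℚ (Φ : Set E), R.form x β = 0 := by
        intro x hx
        have : Submodule.span ℚ (Φ : Set E) ≤ LinearMap.ker (R.form β) := by
          rw [Submodule.span_le]
          intro a ha
          simpa [R.form_comm β a] using h0 a ha
        rw [R.form_comm]; exact this hx
      have h1 : ∀ q ∈ s ×ˢ W.fiber Φ lam, R.form ((c ^ k q.1) q.2) β = R.form q.2 β := by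
        intro q hq
        have := h0' _ ((hz (k q.1)).2.2.2.1 q.2)
        rwa [map_sub, LinearMap.sub_apply, sub_eq_zero] at this
      rw [map_sum, LinearMap.sum_apply, Finset.sum_congr rfl h1, Finset.sum_product_right]
      simp only [Finset.sum_const, ← Finset.smul_sum]
      rw [← LinearMap.sum_apply, ← map_sum, form_sum_eq_zero (R.ne_zero hβ), smul_zero]
      intro π hπ
      obtain ⟨h2, h3⟩ := Finset.mem_filter.1 hπ
      refine Finset.mem_filter.2 ⟨W.refl_mem β hβ π h2, fun a ha => ?_⟩
      have h4 := h3 a ha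
      rw [refl_apply, sub_right_comm, map_sub, LinearMap.sub_apply, h4, map_smul,
        LinearMap.smul_apply, R.form_comm β a, h0 a ha]
      simp

end

lemma exists_cycle (hΦ : R.IsComponent Φ) {lam γ : E} (hlam : lam ∈ W.S) (hγ : γ ∈ Φ)
    (hne : R.co γ lam ≠ 0) : ∃ d : ℕ, 2 ≤ d ∧ ∃ p : ℤ → E, (∀ i, p i ∈ W.S) ∧
      (∀ i j, p i = p j ↔ (d : ℤ) ∣ i - j) ∧ (∀ i, p i - p (i + 1) ∈ Φ) ∧
      (∀ a b i, p a - p b = p i - p (i + 1) → p a = p i) ∧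
      (∀ i, p i - p 0 ∈ Submodule.span ℚ (Φ : Set E)) ∧
      ∀ π ∈ W.S, π - p 0 ∈ Submodule.span ℚ (Φ : Set E) → ∃ i, π = p i := by
  classical
  obtain ⟨c, c1, c2, c3, c4, c5, c6⟩ := W.exists_coxeter hΦ hlam hγ hne
  have hc : c ∈ W.autGroup Φ :=
    ⟨c1, mem_iff_of_forall_mem c2, mem_iff_of_forall_mem c5, c3, fun x => (c4 x).1⟩
  have hfix : ∀ x, c x = x → ∀ β ∈ Φ, R.form x β = 0 := fun x => (c4 x).2
  have hz : ∀ k : ℤ, c ^ k ∈ W.autGroup Φ := fun k => zpow_mem hc k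
  have hQ := fun (ι : Type) => W.le_card_mul_fiber (ι := ι) hΦ hc hfix hlam
  set e : ℤ → E := fun k => (c ^ k) lam with he
  have e0 : e 0 = lam := by simp [he]
  have eS : ∀ k, e k ∈ W.S := fun k => ((hz k).2.1 _).2 hlam
  have eadd : ∀ j k, (c ^ j) (e k) = e (j + k) := fun j k => by
    simp [he, zpow_add, LinearEquiv.mul_apply]
  have esucc : ∀ k, c (e k) = e (k + 1) := fun k => by
    rw [add_comm, ← eadd 1 k, zpow_one]
  have eU : ∀ j k, e j - e k ∈ Submodule.span ℚ (Φ : Set E) := fun j k => by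
    have := (hz (j - k)).2.2.2.1 (e k)
    rwa [eadd, sub_add_cancel] at this
  have hU0 : ∀ x, x ∈ Submodule.span ℚ (Φ : Set E) → c x = x → x = 0 := fun x hx h =>
    eq_zero_of_mem_span hx (hfix x h)
  set d := MulAction.period c lam with hd
  have hper : ∀ i j, e i = e j ↔ (d : ℤ) ∣ i - j := by
    intro i j
    rw [hd, ← MulAction.zpow_smul_eq_iff_period_dvd]
    change _ ↔ (c ^ (i - j)) lam = lam
    rw [← (c ^ (-j)).injective.eq_iff, eadd, eadd, neg_add_cancel, e0, neg_add_eq_sub]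
  have hd0 : d ≠ 0 := by
    intro h
    have hinj : Function.Injective fun k : ℤ => (⟨e k, eS k⟩ : W.S) := by
      intro i j hij
      have := (hper i j).1 (congrArg Subtype.val hij)
      rw [h] at this
      simpa [sub_eq_zero] using this
    exact not_injective_infinite_finite _ hinj
  have hd1 : d ≠ 1 := by
    intro h
    have h1 : e 0 = e 1 := (hper 0 1).2 (by simp [h])
    have h2 := R.ne_zero (hΦ.subset c6)
    rw [← e0, esucc, zero_add, h1, sub_self] at h2
    exact h2 rfl
  set Y := W.fiber Φ lam with hYdef
  have hYpos : 0 < Y.card := Finset.card_pos.2 ⟨lam, by simp [hYdef, fiber, hlam]⟩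
  have hYc : ∀ π ∈ Y, ∀ k : ℤ, (c ^ k) π = e k + (π - lam) := by
    intro π hπ k
    have := (hz k).2.2.2.2 _ (Finset.mem_filter.1 hπ).2
    rw [map_sub, sub_eq_iff_eq_add] at this
    rw [this, add_comm]
  have hinj : Set.InjOn (fun q : ℕ × E => (c ^ (q.1 : ℤ)) q.2)
      (Finset.range d ×ˢ Y : Finset (ℕ × E)) := by
    rintro ⟨i, π⟩ hi ⟨j, π'⟩ hj hij
    simp only [Finset.mem_coe, Finset.mem_product, Finset.mem_range] at hi hj
    simp only [hYc π hi.2, hYc π' hj.2] at hij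
    have h1 : e i - e j = (π' - lam) - (π - lam) := by
      rw [sub_eq_sub_iff_add_eq_add, hij]; abel
    have h2 : e i - e j = 0 := by
      apply eq_zero_of_mem_span (eU _ _) (R := R)
      intro β hβ
      rw [h1, map_sub, LinearMap.sub_apply, (Finset.mem_filter.1 hj.2).2 β hβ,
        (Finset.mem_filter.1 hi.2).2 β hβ, sub_zero]
    have h3 : i = j := by
      have h4 := (hper i j).1 (sub_eq_zero.1 h2)
      have h5 : ((i : ℤ) - j) = 0 := Int.eq_zero_of_abs_lt_dvd h4 (by
        rw [abs_lt]; omega)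
      omega
    subst h3
    simpa using hij
  have hmap : ∀ q ∈ Finset.range d ×ˢ Y, (c ^ (q.1 : ℤ)) q.2 ∈ W.S := fun q hq =>
    ((hz _).2.1 _).2 (Finset.mem_filter.1 (Finset.mem_product.1 hq).2).1
  have hle : r ≤ d * Y.card := by
    have := hQ ℕ (Finset.range d) (by simpa using hd0) (fun i => (i : ℤ)) (by
      change c (∑ i ∈ Finset.range d, e i) = ∑ i ∈ Finset.range d, e i
      have h1 := Finset.sum_range_succ (fun i : ℕ => e i) d
      rw [Finset.sum_range_succ'] at h1
      have h2 : e (d : ℤ) = e ((0 : ℕ) : ℤ) := (hper _ _).2 (by simp)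
      rw [h2, add_left_inj] at h1
      rw [map_sum]
      simpa only [esucc, Nat.cast_add, Nat.cast_one] using h1)
    simpa using this
  have himg : (Finset.range d ×ˢ Y).image (fun q : ℕ × E => (c ^ (q.1 : ℤ)) q.2) = W.S := by
    apply Finset.eq_of_subset_of_card_le
    · exact Finset.image_subset_iff.2 hmap
    · rw [Finset.card_image_of_injOn hinj, W.card_eq]
      simpa using hle
  have hge : d * Y.card ≤ r := by
    rw [← W.card_eq, ← himg, Finset.card_image_of_injOn hinj]; simp
  refine ⟨d, by omega, e, eS, hper, ?_, ?_, fun i => eU i 0, ?_⟩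
  · intro i
    have := ((hz i).2.2.1 _).2 c6
    rwa [map_sub, ← e0, esucc, eadd, eadd, add_zero, zero_add] at this
  · have claim : ∀ a b, e a + e 1 = e 0 + e b → e a = e 0 := by
      intro a b h
      have hi : ∀ k, e (a + k) + e (k + 1) - e k - e (b + k) = 0 := by
        intro k
        have := congrArg (c ^ k) h
        rw [map_add, map_add, eadd, eadd, eadd, eadd, add_zero] at this
        rw [add_comm a, add_comm b, this]; abel
      have hii : ∀ k, e k + e (k - b) - e (k - 1) - e (k - a) = 0 := by
        have hz0 : e 0 + e (-b) - e (-1) - e (-a) = 0 := by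
          apply R.eq_zero_of_form_self
          set z := e 0 + e (-b) - e (-1) - e (-a) with hz'
          have hf : ∀ k, R.form z (e (-k)) = R.form ((c ^ k) z) (e 0) := by
            intro k
            rw [← (hz k).1 z, eadd, add_neg_cancel]
          have : z + (c ^ b) z - (c ^ (1 : ℤ)) z - (c ^ a) z = 0 := by
            have h1 := hi 0
            have h2 := hi (-b)
            have h3 := hi (-1)
            have h4 := hi (-a)
            simp only [add_zero, zero_add, add_neg_cancel, neg_add_cancel] at h1 h2 h3 h4
            rw [← sub_eq_zero.2 (show (0 : E) + 0 = 0 + 0 by simp)]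
            nth_rewrite 1 [← h3]
            nth_rewrite 1 [← h4]
            nth_rewrite 1 [← h1]
            nth_rewrite 1 [← h2]
            simp only [hz', map_add, map_sub, eadd, add_zero, add_neg_cancel]
            rw [add_comm (1 : ℤ) (-b), add_comm (1 : ℤ) (-a)]
            abel
          conv_lhs => enter [2]; rw [hz']
          rw [map_sub, map_sub, map_add, hf, hf, hf]
          rw [← LinearMap.add_apply, ← LinearMap.sub_apply, ← LinearMap.sub_apply, ← map_add,
            ← map_sub, ← map_sub, this, map_zero, LinearMap.zero_apply]
        intro k
        have := congrArg (c ^ k) hz0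
        rw [map_sub, map_sub, map_add, map_zero, eadd, eadd, eadd, eadd, add_zero] at this
        simpa only [sub_eq_add_neg] using this
      have hv : e 0 + e b - e a - e (a + b) = 0 := by
        apply hU0
        · have := add_mem (eU 0 a) (eU b (a + b))
          convert this using 1
          abel
        · simp only [map_add, map_sub, esucc, zero_add]
          have h1 := hii (a + b + 1)
          rw [show a + b + 1 - b = a + 1 by ring, show a + b + 1 - 1 = a + b by ring,
            show a + b + 1 - a = b + 1 by ring] at h1
          rw [← sub_eq_zero, ← sub_eq_zero.2 h, ← sub_zero (e a + e 1 - _), ← h1]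
          abel
      set g := MulAction.period c (e 0 + e b) with hg
      have hgdvd : ∀ k : ℤ, (c ^ k) (e 0 + e b) = e 0 + e b → (g : ℤ) ∣ k := fun k hk =>
        MulAction.zpow_smul_eq_iff_period_dvd.1 hk
      have hga : (g : ℤ) ∣ a := hgdvd a (by
        rw [map_add, eadd, eadd, add_zero]
        rw [sub_sub, sub_eq_zero] at hv
        exact hv.symm)
      have hgd : g ∣ d := by
        rw [← Int.natCast_dvd_natCast]
        refine hgdvd d ?_
        rw [map_add, eadd, eadd, (hper (d + 0) 0).2 (by simp), (hper (d + b) b).2 (by simp)]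
      have hg0 : g ≠ 0 := by rintro h; rw [h, zero_dvd_iff] at hgd; exact hd0 hgd
      have hgle : r ≤ g * 2 * Y.card := by
        have := hQ (ℕ × Bool) (Finset.range g ×ˢ Finset.univ) (by simpa using hg0)
          (fun q => if q.2 then (q.1 : ℤ) else q.1 + b) (by
          have key : ∑ q ∈ Finset.range g ×ˢ (Finset.univ : Finset Bool),
              (c ^ (if q.2 then (q.1 : ℤ) else q.1 + b)) lam =
              ∑ i ∈ Finset.range g, (c ^ (i : ℤ)) (e 0 + e b) := by
            rw [Finset.sum_product]
            refine Finset.sum_congr rfl fun i _ => ?_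
            rw [map_add, eadd, eadd, add_zero]
            simp [he]
          rw [key]
          have h1 := Finset.sum_range_succ (fun i : ℕ => (c ^ (i : ℤ)) (e 0 + e b)) g
          rw [Finset.sum_range_succ'] at h1
          have h2 : (c ^ (g : ℤ)) (e 0 + e b) = (c ^ ((0 : ℕ) : ℤ)) (e 0 + e b) := by
            have : (c ^ (g : ℤ)) • (e 0 + e b) = e 0 + e b :=
              MulAction.zpow_smul_eq_iff_period_dvd.2 dvd_rfl
            simpa using this
          rw [h2, add_left_inj] at h1
          rw [map_sum, ← h1]
          refine Finset.sum_congr rfl fun i _ => ?_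
          rw [map_add, map_add, map_add, eadd, eadd, eadd, eadd, esucc, esucc]
          push_cast
          congr 2
          ring)
        simpa using this
      have hd2 : (d : ℤ) ∣ 2 * a := by
        have h1 : d ≤ g * 2 := Nat.le_of_mul_le_mul_right (hge.trans hgle) hYpos
        obtain ⟨m, hm⟩ := hgd
        obtain ⟨a', ha'⟩ := hga
        rw [hm] at h1
        have hm2 : m ≤ 2 := Nat.le_of_mul_le_mul_left h1 (Nat.pos_of_ne_zero hg0)
        have hm0 : m ≠ 0 := by rintro rfl; simp at hm; exact hd0 hm
        rw [hm, ha']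
        interval_cases m
        · exact absurd rfl hm0
        · exact ⟨2 * a', by push_cast; ring⟩
        · exact ⟨a', by push_cast; ring⟩
      have h2a : e (a + a) = e 0 := (hper _ _).2 (by rwa [sub_zero, ← two_mul])
      have hab : e (a + 1) = e b := by
        have h1 := hi a
        rw [h2a, add_comm b a] at h1
        have h2 : e (a + 1) - e b = (e 0 + e (a + 1) - e a - e (a + b)) -
            (e 0 + e b - e a - e (a + b)) := by abel
        rw [h1, hv, sub_zero] at h2
        exact sub_eq_zero.1 h2
      have hw : e 0 - e a = 0 := by
        apply hU0 _ (eU 0 a)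
        rw [map_sub, esucc, esucc, hab, zero_add, sub_eq_sub_iff_add_eq_add, add_comm (e 1), h]
      exact (sub_eq_zero.1 hw).symm
    intro a b i h
    have h1 := congrArg (c ^ (-i)) h
    rw [map_sub, map_sub, eadd, eadd, eadd, eadd, neg_add_cancel, neg_add_cancel_left] at h1
    have h2 := claim (-i + a) (-i + b) (by rw [sub_eq_sub_iff_add_eq_add] at h1; exact h1)
    have h3 := congrArg (c ^ i) h2
    rwa [eadd, eadd, add_neg_cancel_left, add_zero] at h3
  · intro π hπ hU
    rw [← himg, Finset.mem_image] at hπ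
    obtain ⟨⟨i, π'⟩, hq, rfl⟩ := hπ
    obtain ⟨hi, hπ'⟩ := Finset.mem_product.1 hq
    refine ⟨i, ?_⟩
    simp only [hYc π' hπ'] at hU ⊢
    rw [add_sub_right_comm, Submodule.add_mem_iff_right _ (eU _ _)] at hU
    rw [eq_zero_of_mem_span hU (Finset.mem_filter.1 hπ').2, add_zero]

end WeightFrame

end RootFrame

/-- A split semisimple Lie algebra with root system the given frame, described by root vectors. -/
structure SplitDatum (K L : Type*) [Field K] [CharZero K] [LieRing L] [LieAlgebra K L]
    {E : Type*} [AddCommGroup E] [Module ℚ E] (R : RootFrame E) where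
  t : E →+ L
  e : E → L
  f : E → L
  killing : LinearMap.BilinForm K L
  lie_t_t : ∀ x y, ⁅t x, t y⁆ = 0
  lie_t_e : ∀ β ∈ R.roots, ∀ x, ⁅t x, e β⁆ = ((R.form x β : ℚ) : K) • e β
  lie_t_f : ∀ β ∈ R.roots, ∀ x, ⁅t x, f β⁆ = -(((R.form x β : ℚ) : K) • f β)
  lie_e_f : ∀ β ∈ R.roots, ⁅e β, f β⁆ = t β
  form_eq : ∀ x y, R.form x y = ∑ β ∈ R.roots, R.form x β * R.form y β
  f_eq : ∀ β ∈ R.roots, ∃ c : K, c ≠ 0 ∧ f β = c • e (-β)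
  lie_e_e : ∀ β ∈ R.roots, ∀ γ ∈ R.roots, β + γ ∈ R.roots → ∃ c : K, ⁅e β, e γ⁆ = c • e (β + γ)
  lie_e_e_eq_zero : ∀ β ∈ R.roots, ∀ γ ∈ R.roots, β + γ ∉ R.roots → β + γ ≠ 0 → ⁅e β, e γ⁆ = 0
  killing_symm : ∀ x y, killing x y = killing y x
  killing_lie : ∀ x y z, killing ⁅x, y⁆ z = killing x ⁅y, z⁆
  killing_f_e : ∀ β ∈ R.roots, killing (f β) (e β) = 1
  killing_f_e_of_ne : ∀ β ∈ R.roots, ∀ γ ∈ R.roots, β ≠ γ → killing (f β) (e γ) = 0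
  killing_f_t : ∀ β ∈ R.roots, ∀ x, killing (f β) (t x) = 0
  dual : ∀ y, y = ∑ β ∈ R.roots, (killing (t β) y • t β + killing (f β) y • e β)
  dual' : ∀ y, y = ∑ β ∈ R.roots, (killing (t β) y • t β + killing (e β) y • f β)

namespace SplitDatum

open RootFrame

variable {K L : Type*} [Field K] [CharZero K] [LieRing L] [LieAlgebra K L]
  {E : Type*} [AddCommGroup E] [Module ℚ E] {R : RootFrame E} (D : SplitDatum K L R)

variable {M : Type*} [AddCommGroup M] [Module K M] [LieRingModule L M] [LieModule K L M]

lemma ratCast_form_injective {x y : E} (h : ∀ z, ((R.form z x : ℚ) : K) = ((R.form z y : ℚ) : K)) :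
    x = y := by
  rw [← sub_eq_zero]
  apply R.eq_zero_of_form_self
  rw [map_sub, sub_eq_zero]
  exact_mod_cast h (x - y)

/-- `v` is a (possibly zero) vector of weight `x`. -/
def IsWt (x : E) (v : M) : Prop := ∀ y, ⁅D.t y, v⁆ = ((R.form y x : ℚ) : K) • v

variable {D}

lemma IsWt.lie_e {x β : E} {v : M} (h : D.IsWt x v) (hβ : β ∈ R.roots) :
    D.IsWt (x + β) ⁅D.e β, v⁆ := by
  intro y
  rw [leibniz_lie, D.lie_t_e β hβ, h y, lie_smul, smul_lie, map_add, Rat.cast_add]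
  module

lemma IsWt.lie_f {x β : E} {v : M} (h : D.IsWt x v) (hβ : β ∈ R.roots) :
    D.IsWt (x - β) ⁅D.f β, v⁆ := by
  intro y
  rw [leibniz_lie, D.lie_t_f β hβ, h y, lie_smul, neg_lie, smul_lie, map_sub, Rat.cast_sub]
  module

lemma IsWt.smul {x : E} {v : M} (h : D.IsWt x v) (a : K) : D.IsWt x (a • v) := by
  intro y
  rw [lie_smul, h y, smul_comm]

lemma IsWt.map {x : E} {v : M} (h : D.IsWt x v) {φ : Module.End K M}
    (hφ : ∀ (y : L) (m : M), φ ⁅y, m⁆ = ⁅y, φ m⁆) : D.IsWt x (φ v) := by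
  intro y
  rw [← hφ, h y, map_smul]

/-- A basis is a weight basis if its elements are weight vectors of the given weights. -/
def IsWtBasis (D : SplitDatum K L R) {ι : Type*} (b : Module.Basis ι K M) (wt : ι → E) : Prop :=
  ∀ i, D.IsWt (wt i) (b i)

section basis

variable {ι : Type*} [Finite ι] {b : Module.Basis ι K M} {wt : ι → E}

lemma IsWtBasis.repr (hb : D.IsWtBasis b wt) {x : E} {v : M} (hv : D.IsWt x v) {i : ι}
    (hi : b.repr v i ≠ 0) : wt i = x := by
  have := Fintype.ofFinite ι
  apply ratCast_form_injective (K := K) (R := R)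
  intro y
  have h1 := congrArg (fun w => b.repr w i) (hv y)
  nth_rewrite 1 [← b.sum_repr v] at h1
  simp only [lie_sum, lie_smul, hb _ y, map_smul, Finsupp.smul_apply, smul_eq_mul, map_sum,
    Module.Basis.repr_self, Finsupp.coe_finsetSum, Finset.sum_apply] at h1
  rw [Finset.sum_eq_single i] at h1
  · simp only [Finsupp.single_eq_same, mul_one] at h1
    rw [mul_comm] at h1
    exact mul_right_cancel₀ hi h1
  · intro j _ hj
    rw [Finsupp.single_eq_of_ne (by exact hj.symm)]; simp
  · simp

lemma IsWtBasis.exists_of_ne_zero (hb : D.IsWtBasis b wt) {x : E} {v : M} (hv : D.IsWt x v)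
    (h : v ≠ 0) : ∃ i, wt i = x := by
  obtain ⟨i, hi⟩ := Finsupp.ne_iff.1 ((b.repr.map_ne_zero_iff).2 h)
  exact ⟨i, hb.repr hv hi⟩

end basis

lemma exists_wtBasis [FiniteDimensional K M] {P : E → Prop}
    (h : Submodule.span K {v : M | ∃ x, P x ∧ D.IsWt x v} = ⊤) :
    ∃ (ι : Type) (_ : Fintype ι) (b : Module.Basis ι K M) (wt : ι → E), D.IsWtBasis b wt ∧
      ∀ i, P (wt i) := by
  classical
  let b := Module.Basis.ofSpan h.ge
  have hb : ∀ i, b i ∈ {v : M | ∃ x, P x ∧ D.IsWt x v} := fun i =>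
    Module.Basis.ofSpan_subset h.ge (Set.mem_range_self i)
  have : Finite _ := Module.Finite.finite_basis b
  obtain ⟨n, ⟨g⟩⟩ := Finite.exists_equiv_fin
    ((linearIndepOn_empty K id).extend (Set.empty_subset {v : M | ∃ x, P x ∧ D.IsWt x v}))
  choose wt hP hwt using fun i => hb (g.symm i)
  refine ⟨Fin n, inferInstance, b.reindex g, wt, fun i => ?_, hP⟩
  rw [Module.Basis.reindex_apply]; exact hwt i

variable (D) in
/-- The Casimir operator. -/
noncomputable def casimir (M : Type*) [AddCommGroup M] [Module K M] [LieRingModule L M]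
    [LieModule K L M] : Module.End K M :=
  ∑ β ∈ R.roots, (LieModule.toEnd K L M (D.t β) * LieModule.toEnd K L M (D.t β) +
    LieModule.toEnd K L M (D.e β) * LieModule.toEnd K L M (D.f β))

lemma casimir_apply (m : M) : D.casimir M m =
    ∑ β ∈ R.roots, (⁅D.t β, ⁅D.t β, m⁆⁆ + ⁅D.e β, ⁅D.f β, m⁆⁆) := by
  simp [casimir, LinearMap.sum_apply]

lemma lie_sum_dual {κ : LinearMap.BilinForm K L} (hs : ∀ x y, κ x y = κ y x)
    (hl : ∀ x y z, κ ⁅x, y⁆ z = κ x ⁅y, z⁆) {ι : Type*} (s : Finset ι) (a b : ι → L)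
    (h1 : ∀ y, y = ∑ i ∈ s, κ (b i) y • a i) (h2 : ∀ y, y = ∑ i ∈ s, κ (a i) y • b i)
    (x : L) (m : M) : ⁅x, ∑ i ∈ s, ⁅a i, ⁅b i, m⁆⁆⁆ = ∑ i ∈ s, ⁅a i, ⁅b i, ⁅x, m⁆⁆⁆ := by
  have e1 : ∀ i ∈ s, ⁅x, ⁅a i, ⁅b i, m⁆⁆⁆ = ⁅⁅x, a i⁆, ⁅b i, m⁆⁆ + ⁅a i, ⁅⁅x, b i⁆, m⁆⁆ +
      ⁅a i, ⁅b i, ⁅x, m⁆⁆⁆ := by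
    intro i _
    rw [leibniz_lie x (a i), leibniz_lie x (b i), lie_add, add_assoc]
  rw [lie_sum, Finset.sum_congr rfl e1, Finset.sum_add_distrib, add_eq_right,
    Finset.sum_add_distrib]
  have e2 : ∑ i ∈ s, ⁅⁅x, a i⁆, ⁅b i, m⁆⁆ =
      ∑ i ∈ s, ∑ j ∈ s, κ (b j) ⁅x, a i⁆ • ⁅a j, ⁅b i, m⁆⁆ := by
    refine Finset.sum_congr rfl fun i _ => ?_
    conv_lhs => rw [h1 ⁅x, a i⁆]
    simp [sum_lie]
  have e3 : ∑ i ∈ s, ⁅a i, ⁅⁅x, b i⁆, m⁆⁆ =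
      ∑ i ∈ s, ∑ j ∈ s, κ (a j) ⁅x, b i⁆ • ⁅a i, ⁅b j, m⁆⁆ := by
    refine Finset.sum_congr rfl fun i _ => ?_
    conv_lhs => rw [h2 ⁅x, b i⁆]
    simp [sum_lie, lie_sum]
  rw [e2, e3, Finset.sum_comm, ← Finset.sum_add_distrib]
  refine Finset.sum_eq_zero fun i _ => ?_
  rw [← Finset.sum_add_distrib]
  refine Finset.sum_eq_zero fun j _ => ?_
  rw [← add_smul]
  have : κ (b i) ⁅x, a j⁆ = - κ (a j) ⁅x, b i⁆ := by
    rw [hs, hl, ← hl, ← lie_skew, map_neg, LinearMap.neg_apply, hl]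
  rw [this, neg_add_cancel, zero_smul]

lemma casimir_lie (x : L) (m : M) : D.casimir M ⁅x, m⁆ = ⁅x, D.casimir M m⁆ := by
  have h := lie_sum_dual D.killing_symm D.killing_lie (R.roots.disjSum R.roots)
    (Sum.elim (fun β => D.t β) D.e) (Sum.elim (fun β => D.t β) D.f)
    (fun y => by
      rw [Finset.sum_disjSum]
      simpa [Finset.sum_add_distrib] using D.dual y)
    (fun y => by
      rw [Finset.sum_disjSum]
      simpa [Finset.sum_add_distrib] using D.dual' y) x m
  rw [casimir_apply, casimir_apply, Finset.sum_add_distrib, Finset.sum_add_distrib]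
  simpa [Finset.sum_disjSum] using h.symm

end SplitDatum

namespace SplitDatum

open RootFrame

variable {K L : Type*} [Field K] [CharZero K] [LieRing L] [LieAlgebra K L]
  {E : Type*} [AddCommGroup E] [Module ℚ E] {R : RootFrame E} {D : SplitDatum K L R}

variable {M : Type*} [AddCommGroup M] [Module K M] [LieRingModule L M] [LieModule K L M]

/-- The formal character of a module, twisted by an endomorphism. -/
noncomputable def char {ι : Type*} [Fintype ι] (b : Module.Basis ι K M) (wt : ι → E) :
    Module.End K M →ₗ[K] AddMonoidAlgebra K E :=
  ∑ i, (AddMonoidAlgebra.coeffLinearEquiv K).symm.toLinearMap ∘ₗ Finsupp.lsingle (wt i) ∘ₗ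
    Finsupp.lapply i ∘ₗ b.repr.toLinearMap ∘ₗ LinearMap.applyₗ (b i)

section char

variable {ι : Type*} [Fintype ι] {b : Module.Basis ι K M} {wt : ι → E}

lemma char_apply (φ : Module.End K M) :
    char b wt φ = ∑ i, AddMonoidAlgebra.single (wt i) (b.repr (φ (b i)) i) := by
  simp [char, LinearMap.sum_apply]

lemma coeff_char_one [DecidableEq E] (x : E) :
    (char b wt 1).coeff x = (((Finset.univ.filter fun i => wt i = x).card : ℕ) : K) := by
  rw [char_apply, AddMonoidAlgebra.coeff_sum, Finsupp.finsetSum_apply, Finset.card_filter,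
    Nat.cast_sum]
  refine Finset.sum_congr rfl fun i _ => ?_
  simp [Finsupp.single_apply]

lemma coeff_char_one_ne_zero {x : E} : (char b wt (1 : Module.End K M)).coeff x ≠ 0 ↔
    ∃ i, wt i = x := by
  classical
  rw [coeff_char_one, Nat.cast_ne_zero, Finset.card_ne_zero]
  simp [Finset.filter_nonempty_iff]

lemma exists_of_coeff_char_ne_zero {φ : Module.End K M} {x : E}
    (h : (char b wt φ).coeff x ≠ 0) : ∃ i, wt i = x ∧ φ (b i) ≠ 0 := by
  classical
  rw [char_apply, AddMonoidAlgebra.coeff_sum, Finsupp.finsetSum_apply] at h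
  obtain ⟨i, -, hi⟩ := Finset.exists_ne_zero_of_sum_ne_zero h
  rw [AddMonoidAlgebra.coeff_single, Finsupp.single_apply] at hi
  split_ifs at hi with hx
  · refine ⟨i, hx, fun h0 => hi ?_⟩
    rw [h0]; simp
  · exact absurd rfl hi

lemma char_mul_lie_t (hb : D.IsWtBasis b wt) (φ : Module.End K M) (y : E) :
    char b wt (φ * LieModule.toEnd K L M (D.t y)) = R.der K y (char b wt φ) := by
  rw [char_apply, char_apply, map_sum]
  refine Finset.sum_congr rfl fun i _ => ?_
  rw [der, diag_single]
  simp [hb i y, R.form_comm y]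

lemma char_mul_e_mul_f (hb : D.IsWtBasis b wt) (φ : Module.End K M)
    (hφ : ∀ (y : L) (m : M), φ ⁅y, m⁆ = ⁅y, φ m⁆) {β : E} (hβ : β ∈ R.roots) :
    char b wt (φ * LieModule.toEnd K L M (D.e β) * LieModule.toEnd K L M (D.f β)) =
      AddMonoidAlgebra.single β 1 *
      char b wt (φ * LieModule.toEnd K L M (D.f β) * LieModule.toEnd K L M (D.e β)) := by
  have h1 : ∀ i, b.repr (φ ⁅D.e β, ⁅D.f β, b i⁆⁆) i =
      ∑ j, b.repr ⁅D.f β, b i⁆ j * b.repr (φ ⁅D.e β, b j⁆) i := by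
    intro i
    nth_rewrite 1 [← b.sum_repr ⁅D.f β, b i⁆]
    simp only [lie_sum, map_sum, lie_smul, map_smul, Finsupp.finsetSum_apply,
      Finsupp.smul_apply, smul_eq_mul]
  have h2 : ∀ j, b.repr (φ ⁅D.f β, ⁅D.e β, b j⁆⁆) j =
      ∑ i, b.repr (φ ⁅D.e β, b j⁆) i * b.repr ⁅D.f β, b i⁆ j := by
    intro j
    rw [hφ]
    nth_rewrite 1 [← b.sum_repr (φ ⁅D.e β, b j⁆)]
    simp only [lie_sum, map_sum, lie_smul, map_smul, Finsupp.finsetSum_apply,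
      Finsupp.smul_apply, smul_eq_mul]
  rw [char_apply, char_apply, Finset.mul_sum]
  simp only [Module.End.mul_apply, LieModule.toEnd_apply_apply, h1, h2,
    AddMonoidAlgebra.single_mul_single, one_mul]
  have h3 : ∀ (x : E) (g : ι → K), AddMonoidAlgebra.single x (∑ j, g j) =
      ∑ j, AddMonoidAlgebra.single x (g j) := fun x g =>
    map_sum ((AddMonoidAlgebra.coeffLinearEquiv K).symm.toLinearMap ∘ₗ Finsupp.lsingle x) g _
  simp only [h3]
  rw [Finset.sum_comm]
  refine Finset.sum_congr rfl fun j _ => Finset.sum_congr rfl fun i _ => ?_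
  by_cases h : b.repr ⁅D.f β, b i⁆ j = 0
  · simp [h]
  · rw [hb.repr ((hb i).lie_f hβ) h, mul_comm, add_sub_cancel]

variable (D M) in
/-- The Casimir operator shifted by the square length of `rho`. -/
noncomputable def casimirRho : Module.End K M :=
  D.casimir M + ((R.form R.rho R.rho : ℚ) : K) • 1

lemma casimirRho_lie (x : L) (m : M) : D.casimirRho M ⁅x, m⁆ = ⁅x, D.casimirRho M m⁆ := by
  simp [casimirRho, casimir_lie]

lemma lap_denom_mul_char (hb : D.IsWtBasis b wt) (φ : Module.End K M)
    (hφ : ∀ (y : L) (m : M), φ ⁅y, m⁆ = ⁅y, φ m⁆) :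
    R.lap K (R.denom K * char b wt φ) = R.denom K * char b wt (φ * D.casimirRho M) := by
  rw [R.lap_denom_mul (char b wt φ)
    (fun β => char b wt (φ * LieModule.toEnd K L M (D.e β) * LieModule.toEnd K L M (D.f β)))]
  · congr 1
    rw [casimirRho, casimir, mul_add, Finset.mul_sum, map_add, map_sum]
    simp only [mul_add, map_add, Finset.sum_add_distrib, ← mul_assoc]
    have h : R.lap K (char b wt φ) = ∑ β ∈ R.roots, char b wt
        (φ * LieModule.toEnd K L M (D.t β) * LieModule.toEnd K L M (D.t β)) := by
      simp only [char_mul_lie_t hb]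
      rw [char_apply, map_sum]
      simp only [map_sum]
      rw [Finset.sum_comm]
      refine Finset.sum_congr rfl fun i _ => ?_
      simp only [lap, der, diag_single]
      have h3 : ∀ (x : E) (g : E → K), AddMonoidAlgebra.single x (∑ j ∈ R.roots, g j) =
        ∑ j ∈ R.roots, AddMonoidAlgebra.single x (g j) := fun x g =>
        map_sum ((AddMonoidAlgebra.coeffLinearEquiv K).symm.toLinearMap ∘ₗ Finsupp.lsingle x) g _
      rw [← h3, D.form_eq, Rat.cast_sum, Finset.sum_mul]
      simp [mul_assoc]
    rw [h, mul_smul_comm, mul_one, map_smul]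
    abel
  · intro β hβ
    have h1 := char_mul_e_mul_f hb φ hφ hβ
    have h2 : char b wt (φ * LieModule.toEnd K L M (D.e β) * LieModule.toEnd K L M (D.f β)) -
        char b wt (φ * LieModule.toEnd K L M (D.f β) * LieModule.toEnd K L M (D.e β)) =
        R.der K β (char b wt φ) := by
      rw [← char_mul_lie_t hb, ← D.lie_e_f β hβ, ← map_sub]
      congr 1
      ext m
      simp
    set T := char b wt (φ * LieModule.toEnd K L M (D.e β) * LieModule.toEnd K L M (D.f β))
    set U := char b wt (φ * LieModule.toEnd K L M (D.f β) * LieModule.toEnd K L M (D.e β))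
    rw [← h2, theta, sub_mul, mul_sub]
    congr 1
    rw [h1, ← mul_assoc, AddMonoidAlgebra.single_mul_single]
    congr 2
    · module
    · simp

lemma aeval_casimirRho_lie (p : Polynomial K) (y : L) (m : M) :
    Polynomial.aeval (D.casimirRho M) p ⁅y, m⁆ = ⁅y, Polynomial.aeval (D.casimirRho M) p m⁆ := by
  have h : Commute (D.casimirRho M) (LieModule.toEnd K L M y) := by
    ext m
    simp [casimirRho_lie]
  have h2 : Commute (Polynomial.aeval (D.casimirRho M) p) (LieModule.toEnd K L M y) :=
    by
      induction p using Polynomial.induction_on' with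
      | add p q hp hq => rw [map_add]; exact hp.add_left hq
      | monomial n a =>
        rw [Polynomial.aeval_monomial]
        exact (Algebra.commute_algebraMap_left a _).mul_left (h.pow_left n)
  exact LinearMap.congr_fun h2 m

lemma coeff_denom_mul_char_aeval (hb : D.IsWtBasis b wt) (p : Polynomial K) (x : E) :
    (R.denom K * char b wt (Polynomial.aeval (D.casimirRho M) p)).coeff x =
      p.eval ((R.form x x : ℚ) : K) * (R.denom K * char b wt 1).coeff x := by
  induction p using Polynomial.induction_on with
  | C a => simp [Algebra.algebraMap_eq_smul_one]
  | add p q hp hq => simp [mul_add, hp, hq, add_mul]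
  | monomial n a h =>
    have h1 : Polynomial.aeval (D.casimirRho M) (Polynomial.C a * Polynomial.X ^ (n + 1)) =
        Polynomial.aeval (D.casimirRho M) (Polynomial.C a * Polynomial.X ^ n) *
          D.casimirRho M := by
      rw [pow_succ, ← mul_assoc, map_mul _ _ Polynomial.X, Polynomial.aeval_X]
    rw [h1, ← lap_denom_mul_char hb _ (aeval_casimirRho_lie _), lap, coeff_diag, h]
    simp only [Polynomial.eval_mul, Polynomial.eval_C, Polynomial.eval_pow, Polynomial.eval_X]
    ring

end char

lemma casimirRho_of_highest {τ : E} {v : M} (hv : D.IsWt τ v)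
    (he : ∀ β ∈ R.pos, ⁅D.e β, v⁆ = 0) :
    D.casimirRho M v = ((R.form (τ + R.rho) (τ + R.rho) : ℚ) : K) • v := by
  have h1 : ∑ β ∈ R.roots, ⁅D.t β, ⁅D.t β, v⁆⁆ = ((R.form τ τ : ℚ) : K) • v := by
    simp only [hv _, lie_smul, smul_smul]
    rw [← Finset.sum_smul, D.form_eq τ τ]
    congr 1
    push_cast
    exact Finset.sum_congr rfl fun β _ => by rw [R.form_comm β τ]
  have h2 : ∑ β ∈ R.roots, ⁅D.e β, ⁅D.f β, v⁆⁆ = ((2 * R.form R.rho τ : ℚ) : K) • v := by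
    rw [R.sum_roots]
    have : ∀ β ∈ R.pos, ⁅D.e β, ⁅D.f β, v⁆⁆ + ⁅D.e (-β), ⁅D.f (-β), v⁆⁆ =
        ((R.form β τ : ℚ) : K) • v := by
      intro β hβ
      have hr := (R.mem_pos.1 hβ).1
      obtain ⟨c, -, hc⟩ := D.f_eq (-β) (R.neg_mem β hr)
      rw [hc, neg_neg, smul_lie, he β hβ, smul_zero, lie_zero, add_zero, leibniz_lie,
        D.lie_e_f β hr, he β hβ, lie_zero, add_zero, hv]
    rw [Finset.sum_congr rfl this, ← Finset.sum_smul]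
    congr 1
    rw [rho, map_smul, LinearMap.smul_apply, smul_eq_mul, map_sum, LinearMap.sum_apply]
    push_cast
    ring
  rw [casimirRho, LinearMap.add_apply, casimir_apply, Finset.sum_add_distrib, h1, h2]
  simp only [map_add, LinearMap.add_apply, LinearMap.smul_apply, Module.End.one_apply,
    R.form_comm τ R.rho]
  push_cast
  module

lemma form_nonneg_of_dominant {x q : E} (hx : ∀ β ∈ R.pos, 0 ≤ R.co β x) (hq : q ∈ R.cone) :
    0 ≤ R.form x q :=
  R.form_nonneg_of_simple (fun α hα =>
    (R.co_nonneg_iff (R.ne_zero (R.mem_pos.1 hα.1).1)).1 (hx α hα.1)) hq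

lemma eq_of_form_add_rho_eq {x q : E} (hx : ∀ β ∈ R.pos, 0 ≤ R.co β x) (hq : q ∈ R.cone)
    (h : R.form (x + R.rho + q) (x + R.rho + q) = R.form (x + R.rho) (x + R.rho)) : q = 0 := by
  by_contra h0
  have h1 := form_nonneg_of_dominant hx hq
  have h2 := R.form_rho_pos hq h0
  have h3 := R.form_self_nonneg q
  have h4 := R.form_comm q x
  have h5 := R.form_comm q R.rho
  simp only [map_add, LinearMap.add_apply] at h
  linarith

/-- A nonzero coefficient of the product of the Weyl denominator with the character at a shifted
dominant weight gives a highest weight vector. -/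
lemma exists_highest [FiniteDimensional K M] {ι : Type*} [Fintype ι] {b : Module.Basis ι K M}
    {wt : ι → E} (hb : D.IsWtBasis b wt) {κ : E} (hκ : ∀ β ∈ R.pos, 0 ≤ R.co β κ)
    (h : (R.denom K * char b wt (1 : Module.End K M)).coeff (κ + R.rho) ≠ 0) :
    ∃ v : M, v ≠ 0 ∧ D.IsWt κ v ∧ ∀ β ∈ R.pos, ⁅D.e β, v⁆ = 0 := by
  classical
  set s : K := ((R.form (κ + R.rho) (κ + R.rho) : ℚ) : K) with hs
  obtain ⟨q, hq, hqd⟩ := Polynomial.exists_eq_pow_rootMultiplicity_mul_and_not_dvd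
    (D.casimirRho M).charpoly (LinearMap.charpoly_monic _).ne_zero s
  rw [Polynomial.dvd_iff_isRoot, Polynomial.IsRoot.def] at hqd
  set m := Polynomial.rootMultiplicity s (D.casimirRho M).charpoly
  set φ := Polynomial.aeval (D.casimirRho M) q with hφ
  have hφc : ∀ (y : L) (m : M), φ ⁅y, m⁆ = ⁅y, φ m⁆ := aeval_casimirRho_lie q
  have hne : (R.denom K * char b wt φ).coeff (κ + R.rho) ≠ 0 := by
    rw [coeff_denom_mul_char_aeval hb, ← hs]
    exact mul_ne_zero hqd h
  have hzero : ∀ w, ((D.casimirRho M - algebraMap K _ s) ^ m) (φ w) = 0 := by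
    intro w
    have h1 := (D.casimirRho M).aeval_self_charpoly
    rw [hq, map_mul, map_pow, map_sub, Polynomial.aeval_X, Polynomial.aeval_C] at h1
    exact LinearMap.congr_fun h1 w
  obtain ⟨x, y, hx, hy, hxy⟩ := exists_of_coeff_mul_ne_zero hne
  have hcone := (R.leading_denom K).2 x hx
  obtain ⟨i, rfl, hi⟩ := exists_of_coeff_char_ne_zero hy
  let A : Finset E := (Finset.univ.image wt).filter fun τ => τ - κ ∈ R.cone ∧
    ∃ w, D.IsWt τ w ∧ φ w ≠ 0
  obtain ⟨τ, hτA, hmax⟩ := Finset.exists_max_image A R.ht ⟨wt i, Finset.mem_filter.2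
    ⟨by simp, by
      convert hcone using 1
      rw [sub_eq_sub_iff_add_eq_add, add_comm, hxy, add_comm], b i, hb i, hi⟩⟩
  obtain ⟨-, hτκ, w, hw, hw0⟩ := Finset.mem_filter.1 hτA
  have hφw : D.IsWt τ (φ w) := hw.map hφc
  have he : ∀ β ∈ R.pos, ⁅D.e β, φ w⁆ = 0 := by
    intro β hβ
    by_contra hc
    have hβ' := R.mem_pos.1 hβ
    rw [← hφc] at hc
    have hc' : ⁅D.e β, w⁆ ≠ 0 := fun h0 => hc (by rw [h0, map_zero])
    obtain ⟨j, hj⟩ := hb.exists_of_ne_zero (hw.lie_e hβ'.1) hc'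
    have := hmax (τ + β) (Finset.mem_filter.2 ⟨by rw [← hj]; simp, by
      rw [add_sub_right_comm]
      exact add_mem hτκ (AddSubmonoid.subset_closure hβ), _, hw.lie_e hβ'.1, hc⟩)
    rw [map_add] at this
    linarith
  have hcas := casimirRho_of_highest hφw he
  have h3 : (((R.form (τ + R.rho) (τ + R.rho) : ℚ) : K) - s) ^ m • φ w = 0 := by
    rw [← hzero w]
    have : ∀ k : ℕ, ((D.casimirRho M - algebraMap K _ s) ^ k) (φ w) =
        (((R.form (τ + R.rho) (τ + R.rho) : ℚ) : K) - s) ^ k • φ w := by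
      intro k
      induction k with
      | zero => simp
      | succ k ih =>
        rw [pow_succ', Module.End.mul_apply, ih, map_smul, LinearMap.sub_apply, hcas,
          Module.algebraMap_end_apply, ← sub_smul, smul_smul, pow_succ]
    exact (this m).symm
  rw [smul_eq_zero, or_iff_left hw0] at h3
  have h4 := eq_zero_of_pow_eq_zero h3
  rw [sub_eq_zero, hs, Rat.cast_inj] at h4
  have h5 : τ - κ = 0 := by
    apply eq_of_form_add_rho_eq hκ hτκ
    have h6 : κ + R.rho + (τ - κ) = τ + R.rho := by abel
    rw [h6, h4]
  rw [sub_eq_zero] at h5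
  subst h5
  exact ⟨φ w, hw0, hφw, he⟩

end SplitDatum

namespace SplitDatum

open RootFrame

variable {K L : Type*} [Field K] [CharZero K] [LieRing L] [LieAlgebra K L]
  {E : Type*} [AddCommGroup E] [Module ℚ E] {R : RootFrame E} {D : SplitDatum K L R}

variable {M : Type*} [AddCommGroup M] [Module K M] [LieRingModule L M] [LieModule K L M]

lemma e_neg_eq {β : E} (hβ : β ∈ R.roots) : ∃ c : K, D.e (-β) = c • D.f β := by
  obtain ⟨c, hc, h⟩ := D.f_eq β hβ
  exact ⟨c⁻¹, by rw [h, smul_smul, inv_mul_cancel₀ hc, one_smul]⟩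

/-- A subspace stable under the `t x` and the positive and negative root vectors is stable. -/
lemma lie_mem_of_stable (N : Submodule K M) (ht : ∀ y, ∀ m ∈ N, ⁅D.t y, m⁆ ∈ N)
    (he : ∀ β ∈ R.pos, ∀ m ∈ N, ⁅D.e β, m⁆ ∈ N) (hf : ∀ β ∈ R.pos, ∀ m ∈ N, ⁅D.f β, m⁆ ∈ N)
    (x : L) {m : M} (hm : m ∈ N) : ⁅x, m⁆ ∈ N := by
  rw [D.dual x, sum_lie]
  refine sum_mem fun β hβ => ?_
  rw [add_lie, smul_lie, smul_lie]
  refine add_mem (N.smul_mem _ (ht _ _ hm)) (N.smul_mem _ ?_)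
  rcases R.pos_or_neg hβ with h | h
  · exact he β h m hm
  · obtain ⟨c, hc⟩ := e_neg_eq (D := D) (R.mem_pos.1 h).1
    rw [neg_neg] at hc
    rw [hc, smul_lie]
    exact N.smul_mem _ (hf _ h m hm)

variable (D) in
/-- The vectors obtained from `v` by applying negative root vectors. -/
inductive Desc (v : M) (ν : E) : M → E → Prop
  | base : Desc v ν v ν
  | step {w : M} {τ β : E} (hβ : β ∈ R.pos) (h : Desc v ν w τ) : Desc v ν ⁅D.f β, w⁆ (τ - β)

lemma Desc.isWt {v w : M} {ν τ : E} (h : D.Desc v ν w τ) (hv : D.IsWt ν v) : D.IsWt τ w := by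
  induction h with
  | base => exact hv
  | step hβ _ ih => exact ih.lie_f (R.mem_pos.1 hβ).1

lemma Desc.sub_mem {v w : M} {ν τ : E} (h : D.Desc v ν w τ) : ν - τ ∈ R.cone := by
  induction h with
  | base => rw [sub_self]; exact zero_mem _
  | step hβ _ ih =>
    rw [sub_sub_eq_add_sub, add_sub_right_comm]
    exact add_mem ih (AddSubmonoid.subset_closure hβ)

lemma lie_f_mem_span_desc {v : M} {ν β : E} (hβ : β ∈ R.pos) {m : M}
    (hm : m ∈ Submodule.span K {w | ∃ τ, D.Desc v ν w τ}) :
    ⁅D.f β, m⁆ ∈ Submodule.span K {w | ∃ τ, D.Desc v ν w τ} := by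
  induction hm using Submodule.span_induction with
  | mem x hx =>
    obtain ⟨τ, h⟩ := hx
    exact Submodule.subset_span ⟨_, h.step hβ⟩
  | zero => simp
  | add x y _ _ hx hy => rw [lie_add]; exact add_mem hx hy
  | smul a x _ hx => rw [lie_smul]; exact Submodule.smul_mem _ _ hx

lemma Desc.lie_e_mem {v w : M} {ν τ : E} (h : D.Desc v ν w τ) (hv : D.IsWt ν v)
    (he : ∀ β ∈ R.pos, ⁅D.e β, v⁆ = 0) : ∀ γ ∈ R.pos,
    ⁅D.e γ, w⁆ ∈ Submodule.span K {w | ∃ τ, D.Desc v ν w τ} := by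
  induction h with
  | base => intro γ hγ; rw [he γ hγ]; exact zero_mem _
  | @step w τ β hβ h ih =>
    intro γ hγ
    have hβr := (R.mem_pos.1 hβ).1
    have hγr := (R.mem_pos.1 hγ).1
    rw [leibniz_lie]
    refine add_mem ?_ (lie_f_mem_span_desc hβ (ih γ hγ))
    have hw : w ∈ Submodule.span K {w | ∃ τ, D.Desc v ν w τ} := Submodule.subset_span ⟨_, h⟩
    by_cases hγβ : γ = β
    · subst hγβ
      rw [D.lie_e_f _ hγr, h.isWt hv]
      exact Submodule.smul_mem _ _ hw
    obtain ⟨c, -, hc⟩ := D.f_eq β hβr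
    rw [hc, lie_smul, smul_lie]
    apply Submodule.smul_mem
    by_cases hr : γ + -β ∈ R.roots
    · obtain ⟨c', hc'⟩ := D.lie_e_e γ hγr (-β) (R.neg_mem β hβr) hr
      rw [hc', smul_lie]
      apply Submodule.smul_mem
      rcases R.pos_or_neg hr with h1 | h1
      · exact ih _ h1
      · obtain ⟨c'', hc''⟩ := e_neg_eq (D := D) (R.mem_pos.1 h1).1
        rw [neg_neg] at hc''
        rw [hc'', smul_lie]
        exact Submodule.smul_mem _ _ (lie_f_mem_span_desc h1 hw)
    · rw [D.lie_e_e_eq_zero γ hγr (-β) (R.neg_mem β hβr) hr (by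
        rwa [← sub_eq_add_neg, sub_ne_zero]), zero_lie]
      exact zero_mem _

/-- A module generated by a highest weight vector is spanned by vectors of smaller weight. -/
lemma span_wt_eq_top {v : M} {ν : E} (hv : D.IsWt ν v) (he : ∀ β ∈ R.pos, ⁅D.e β, v⁆ = 0)
    (hgen : LieSubmodule.lieSpan K L {v} = ⊤) :
    Submodule.span K {w : M | ∃ x, ν - x ∈ R.cone ∧ D.IsWt x w} = ⊤ := by
  let N : LieSubmodule K L M :=
    { Submodule.span K {w | ∃ τ, D.Desc v ν w τ} with
      lie_mem := fun {x m} hm => lie_mem_of_stable _ (fun y m hm => by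
          induction hm using Submodule.span_induction with
          | mem x hx =>
            obtain ⟨τ, h⟩ := hx
            rw [h.isWt hv]
            exact Submodule.smul_mem _ _ (Submodule.subset_span ⟨τ, h⟩)
          | zero => simp
          | add x y _ _ hx hy => rw [lie_add]; exact add_mem hx hy
          | smul a x _ hx => rw [lie_smul]; exact Submodule.smul_mem _ _ hx)
        (fun γ hγ m hm => by
          induction hm using Submodule.span_induction with
          | mem x hx =>
            obtain ⟨τ, h⟩ := hx
            exact h.lie_e_mem hv he γ hγ
          | zero => simp
          | add x y _ _ hx hy => rw [lie_add]; exact add_mem hx hy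
          | smul a x _ hx => rw [lie_smul]; exact Submodule.smul_mem _ _ hx)
        (fun β hβ m hm => lie_f_mem_span_desc hβ hm) x hm }
  have h1 : (⊤ : LieSubmodule K L M) ≤ N := by
    rw [← hgen, LieSubmodule.lieSpan_le, Set.singleton_subset_iff]
    exact Submodule.subset_span (s := {w | ∃ τ, D.Desc v ν w τ}) ⟨ν, Desc.base⟩
  rw [eq_top_iff]
  intro m _
  have h2 : m ∈ Submodule.span K {w | ∃ τ, D.Desc v ν w τ} := h1 (LieSubmodule.mem_top m)
  refine Submodule.span_mono ?_ h2
  rintro w ⟨τ, h⟩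
  exact ⟨τ, h.sub_mem, h.isWt hv⟩

lemma casimirRho_eq_smul {v : M} {ν : E} (hv : D.IsWt ν v) (he : ∀ β ∈ R.pos, ⁅D.e β, v⁆ = 0)
    (hgen : LieSubmodule.lieSpan K L {v} = ⊤) :
    D.casimirRho M = ((R.form (ν + R.rho) (ν + R.rho) : ℚ) : K) • 1 := by
  set s := ((R.form (ν + R.rho) (ν + R.rho) : ℚ) : K)
  let N : LieSubmodule K L M :=
    { LinearMap.eqLocus (D.casimirRho M) (s • 1) with
      lie_mem := fun {x m} hm => by
        change D.casimirRho M m = s • m at hm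
        change D.casimirRho M ⁅x, m⁆ = s • ⁅x, m⁆
        rw [casimirRho_lie, hm, lie_smul] }
  have h1 : (⊤ : LieSubmodule K L M) ≤ N := by
    rw [← hgen, LieSubmodule.lieSpan_le, Set.singleton_subset_iff]
    exact casimirRho_of_highest hv he
  ext m
  exact h1 (LieSubmodule.mem_top m)

/-- Given a highest weight module of highest weight `ν` and a weight `μ` of maximal length of a
second module such that `ν + μ` is dominant, `ν + μ` is a highest weight of the tensor product. -/
lemma exists_highest_tensor [FiniteDimensional K M] {V : Type*} [AddCommGroup V] [Module K V]
    [LieRingModule L V] [LieModule K L V] [FiniteDimensional K V] {v : M} {ν μ : E} (hv0 : v ≠ 0)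
    (hv : D.IsWt ν v) (he : ∀ β ∈ R.pos, ⁅D.e β, v⁆ = 0)
    (hgen : LieSubmodule.lieSpan K L {v} = ⊤) {ι' : Type*} [Fintype ι']
    {b' : Module.Basis ι' K V} {wt' : ι' → E} (hb' : D.IsWtBasis b' wt')
    (hμ : ∃ i, wt' i = μ) (hmax : ∀ i, R.form (wt' i) (wt' i) ≤ R.form μ μ)
    (hdom : ∀ β ∈ R.pos, 0 ≤ R.co β (ν + μ)) :
    ∃ u : M ⊗[K] V, u ≠ 0 ∧ D.IsWt (ν + μ) u ∧ ∀ β ∈ R.pos, ⁅D.e β, u⁆ = 0 := by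
  classical
  obtain ⟨ι, _, b, wt, hb, hwt⟩ := exists_wtBasis (span_wt_eq_top hv he hgen)
  have hbt : D.IsWtBasis (b.tensorProduct b') fun i => wt i.1 + wt' i.2 := by
    intro i y
    rw [Module.Basis.tensorProduct_apply', TensorProduct.LieModule.lie_tmul_right, hb, hb',
      ← TensorProduct.smul_tmul', TensorProduct.tmul_smul, ← add_smul, map_add, Rat.cast_add]
  apply exists_highest hbt hdom
  have hchar : char (b.tensorProduct b') (fun i => wt i.1 + wt' i.2) 1 =
      char b wt 1 * char b' wt' 1 := by
    simp only [char_apply, Module.End.one_apply, Module.Basis.repr_self, Finsupp.single_eq_same,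
      Finset.sum_mul_sum, AddMonoidAlgebra.single_mul_single, one_mul, Fintype.sum_prod_type]
  have hcas := casimirRho_eq_smul hv he hgen
  have hsupp : ∀ x, (R.denom K * char b wt 1).coeff x ≠ 0 →
      R.form x x = R.form (ν + R.rho) (ν + R.rho) := by
    intro x hx
    have h1 := coeff_denom_mul_char_aeval hb Polynomial.X x
    rw [Polynomial.aeval_X, Polynomial.eval_X, hcas, map_smul, mul_smul_comm,
      AddMonoidAlgebra.coeff_smul_apply, smul_eq_mul] at h1
    exact_mod_cast (mul_right_cancel₀ hx h1).symm
  have hchM : ∀ y, (char b wt (1 : Module.End K M)).coeff y ≠ 0 → ν - y ∈ R.cone := by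
    intro y hy
    obtain ⟨i, rfl⟩ := coeff_char_one_ne_zero.1 hy
    exact hwt i
  have hlead : (R.denom K * char b wt 1).coeff (R.rho + ν) ≠ 0 := by
    rw [coeff_mul_of_unique, (R.leading_denom K).1, one_mul, coeff_char_one_ne_zero]
    · exact hb.exists_of_ne_zero hv hv0
    · intro x y hx hy hxy
      apply R.eq_of_sub_mem_cone _ ((R.leading_denom K).2 x hx)
      convert hchM y hy using 1
      rw [sub_eq_sub_iff_add_eq_add, hxy, add_comm]
  rw [hchar, ← mul_assoc, show ν + μ + R.rho = R.rho + ν + μ by abel, coeff_mul_of_unique]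
  · exact mul_ne_zero hlead (coeff_char_one_ne_zero.2 hμ)
  · intro x y hx hy hxy
    obtain ⟨x1, x2, hx1, hx2, h12⟩ := exists_of_coeff_mul_ne_zero hx
    have hq : R.rho + ν - x ∈ R.cone := by
      convert add_mem ((R.leading_denom K).2 x1 hx1) (hchM x2 hx2) using 1
      rw [← h12]; abel
    obtain ⟨j, rfl⟩ := coeff_char_one_ne_zero.1 hy
    by_contra hne
    have hq0 : R.rho + ν - x ≠ 0 := fun h => hne (sub_eq_zero.1 h).symm
    set q := R.rho + ν - x with hqdef
    have hxq : x = R.rho + ν - q := by rw [hqdef]; abel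
    have hjq : wt' j = μ + q := by
      rw [hqdef, add_sub, eq_sub_iff_add_eq, add_comm, hxy]; abel
    have h1 := hsupp x hx
    have h2 := hmax j
    have h3 := form_nonneg_of_dominant hdom hq
    have h4 := R.form_rho_pos hq hq0
    rw [hxq] at h1
    rw [hjq] at h2
    have c1 := R.form_comm q R.rho
    have c2 := R.form_comm q ν
    have c3 := R.form_comm q μ
    have c4 := R.form_comm R.rho ν
    simp only [map_add, map_sub, LinearMap.add_apply, LinearMap.sub_apply] at h1 h2 h3
    linarith

end SplitDatum

namespace IsSl2Triple

variable {K L M : Type*} [Field K] [CharZero K] [LieRing L] [LieAlgebra K L]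
  [AddCommGroup M] [Module K M] [LieRingModule L M] [LieModule K L M]

lemma exists_hasPrimitiveVectorWith_pow [FiniteDimensional K M] {h e f : L}
    (t : IsSl2Triple h e f) {m : M} (hm0 : m ≠ 0) {μ : K} (hm : ⁅h, m⁆ = μ • m) :
    ∃ k : ℕ, t.HasPrimitiveVectorWith ((LieModule.toEnd K L M e ^ k) m) (μ + 2 * k) := by
  have h_exists_zero : ∃ k, (LieModule.toEnd K L M e ^ k) m = 0 := by
    by_contra! contra
    have h_inj : Function.Injective fun n : ℕ => μ + 2 * (n : K) := fun a b hab => by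
      simpa [add_right_inj, mul_eq_mul_left_iff, Nat.cast_inj] using hab
    have aux (ν : Set.range fun n : ℕ => μ + 2 * (n : K)) :
        (LieModule.toEnd K L M h).HasEigenvector ν
          ((LieModule.toEnd K L M e ^ ν.property.choose) m) := by
      refine ⟨?_, contra _⟩
      rw [Module.End.mem_eigenspace_iff, LieModule.toEnd_apply_apply]
      nth_rewrite 2 [← ν.property.choose_spec]
      exact t.lie_h_pow_toEnd_e hm _
    have _i := ((LieModule.toEnd K L M h).eigenvectors_linearIndependent _ _ aux).finite
    exact (Set.infinite_range_of_injective h_inj) (Set.toFinite _)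
  obtain ⟨n, hn_ne, hn_zero⟩ := Nat.exists_not_and_succ_of_not_zero_of_exists hm0 h_exists_zero
  exact ⟨n, hn_ne, t.lie_h_pow_toEnd_e hm n, by rwa [lie_e_pow_toEnd_e n]⟩

lemma exists_int_of_lie_h [FiniteDimensional K M] {h e f : L}
    (t : IsSl2Triple h e f) {m : M} (hm0 : m ≠ 0) {μ : K} (hm : ⁅h, m⁆ = μ • m) :
    ∃ z : ℤ, μ = z := by
  obtain ⟨k, hk⟩ := t.exists_hasPrimitiveVectorWith_pow hm0 hm
  obtain ⟨n, hn⟩ := hk.exists_nat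
  exact ⟨n - 2 * k, by push_cast; linear_combination hn⟩

end IsSl2Triple

namespace SplitDatum

open RootFrame

variable {K L : Type*} [Field K] [CharZero K] [LieRing L] [LieAlgebra K L]
  {E : Type*} [AddCommGroup E] [Module ℚ E] {R : RootFrame E} {D : SplitDatum K L R}

variable {M : Type*} [AddCommGroup M] [Module K M] [LieRingModule L M] [LieModule K L M]

lemma e_ne_zero {β : E} (hβ : β ∈ R.roots) : D.e β ≠ 0 := fun h => by
  simpa [h] using D.killing_f_e β hβ

lemma t_ne_zero {β : E} (hβ : β ∈ R.roots) : D.t β ≠ 0 := fun h => by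
  have h1 := D.lie_t_e β hβ β
  rw [h, zero_lie, eq_comm, smul_eq_zero, or_iff_left (e_ne_zero hβ)] at h1
  exact (R.form_pos β (R.ne_zero hβ)).ne' (by exact_mod_cast h1)

lemma isSl2Triple {β : E} (hβ : β ∈ R.roots) :
    IsSl2Triple (((2 / R.form β β : ℚ) : K) • D.t β) (D.e β)
      (((2 / R.form β β : ℚ) : K) • D.f β) := by
  have h0 : R.form β β ≠ 0 := (R.form_pos β (R.ne_zero hβ)).ne'
  have h1 : ((2 / R.form β β : ℚ) : K) * ((R.form β β : ℚ) : K) = 2 := by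
    rw [← Rat.cast_mul, div_mul_cancel₀ _ h0]; simp
  refine ⟨smul_ne_zero ?_ (t_ne_zero hβ), by rw [lie_smul, D.lie_e_f β hβ], ?_, ?_⟩
  · exact_mod_cast div_ne_zero two_ne_zero h0
  · rw [smul_lie, D.lie_t_e β hβ, smul_smul, h1, ofNat_smul_eq_nsmul]
  · rw [smul_lie, lie_smul, D.lie_t_f β hβ, smul_neg, smul_neg, smul_smul _ _ (D.f β), h1,
      ofNat_smul_eq_nsmul, smul_comm]

lemma IsWt.lie_co {x β : E} {v : M} (h : D.IsWt x v) :
    ⁅((2 / R.form β β : ℚ) : K) • D.t β, v⁆ = ((R.co β x : ℚ) : K) • v := by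
  rw [smul_lie, h β, smul_smul, ← Rat.cast_mul, R.co_apply, R.form_comm β x]
  rw [div_mul_eq_mul_div]

lemma IsWt.exists_int [FiniteDimensional K M] {x β : E} {v : M} (h : D.IsWt x v) (hv : v ≠ 0)
    (hβ : β ∈ R.roots) : ∃ n : ℤ, R.co β x = n := by
  obtain ⟨n, hn⟩ := (isSl2Triple hβ).exists_int_of_lie_h hv h.lie_co
  exact ⟨n, by exact_mod_cast hn⟩

lemma IsWt.pow_e {x β : E} {v : M} (h : D.IsWt x v) (hβ : β ∈ R.roots) (k : ℕ) :
    D.IsWt (x + k • β) ((LieModule.toEnd K L M (D.e β) ^ k) v) := by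
  induction k with
  | zero => simpa using h
  | succ k ih =>
    rw [pow_succ', Module.End.mul_apply, succ_nsmul, ← add_assoc]
    exact ih.lie_e hβ

lemma IsWt.pow_f {x β : E} {v : M} (h : D.IsWt x v) (hβ : β ∈ R.roots) (a : K) (k : ℕ) :
    D.IsWt (x - k • β) ((LieModule.toEnd K L M (a • D.f β) ^ k) v) := by
  induction k with
  | zero => simpa using h
  | succ k ih =>
    rw [pow_succ', Module.End.mul_apply, succ_nsmul, ← sub_sub, LieModule.toEnd_apply_apply,
      smul_lie]
    exact (ih.lie_f hβ).smul a

lemma IsWt.refl_of_nonneg [FiniteDimensional K M] {x β : E} {v : M} (h : D.IsWt x v) (hv : v ≠ 0)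
    (hβ : β ∈ R.roots) (hc : 0 ≤ R.co β x) : ∃ w : M, w ≠ 0 ∧ D.IsWt (R.refl β x) w := by
  obtain ⟨z, hz⟩ := h.exists_int hv hβ
  lift z to ℕ using by rw [hz] at hc; exact_mod_cast hc
  obtain ⟨k, hk⟩ := (isSl2Triple hβ).exists_hasPrimitiveVectorWith_pow hv h.lie_co
  have hk2 : ((R.co β x : ℚ) : K) + 2 * k = ((z + 2 * k : ℕ) : K) := by
    rw [hz]; push_cast; rfl
  refine ⟨_, hk.pow_toEnd_f_ne_zero_of_eq_nat hk2 (i := k + z) (by omega), ?_⟩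
  convert (h.pow_e hβ k).pow_f hβ _ (k + z) using 1
  rw [refl_apply, hz, add_nsmul, ← Nat.cast_smul_eq_nsmul ℚ z]
  push_cast
  abel

lemma IsWt.refl [FiniteDimensional K M] {x β : E} {v : M} (h : D.IsWt x v) (hv : v ≠ 0)
    (hβ : β ∈ R.roots) : ∃ w : M, w ≠ 0 ∧ D.IsWt (R.refl β x) w := by
  rcases le_total 0 (R.co β x) with hc | hc
  · exact h.refl_of_nonneg hv hβ hc
  · have := h.refl_of_nonneg hv (R.neg_mem β hβ) (by rw [co_neg_left]; linarith)
    rwa [refl_apply, co_neg_left, neg_smul, smul_neg, neg_neg, ← refl_apply] at this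

lemma IsWt.lie_f_ne_zero [FiniteDimensional K M] {x β : E} {v : M} (h : D.IsWt x v) (hv : v ≠ 0)
    (hβ : β ∈ R.roots) (hc : 0 < R.co β x) : ⁅D.f β, v⁆ ≠ 0 := by
  intro h0
  have P : (isSl2Triple (D := D) hβ).symm.HasPrimitiveVectorWith v (-((R.co β x : ℚ) : K)) :=
    ⟨hv, by rw [neg_lie, h.lie_co, neg_smul], by rw [smul_lie, h0, smul_zero]⟩
  obtain ⟨n, hn⟩ := P.exists_nat
  have : - R.co β x = (n : ℚ) := by exact_mod_cast hn
  have : (0 : ℚ) ≤ n := n.cast_nonneg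
  linarith

lemma IsWt.lie_f_eq_zero [FiniteDimensional K M] {x β : E} {v : M} (h : D.IsWt x v)
    (hβ : β ∈ R.roots) (he : ⁅D.e β, v⁆ = 0) (hc : R.co β x = 0) : ⁅D.f β, v⁆ = 0 := by
  by_cases hv : v = 0
  · rw [hv, lie_zero]
  have P : (isSl2Triple (D := D) hβ).HasPrimitiveVectorWith v (((R.co β x : ℚ) : K)) :=
    ⟨hv, h.lie_co, he⟩
  have := P.pow_toEnd_f_eq_zero_of_eq_nat (n := 0) (by simp [hc])
  rw [zero_add, pow_one, LieModule.toEnd_apply_apply, smul_lie, smul_eq_zero] at this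
  refine this.resolve_left ?_
  exact_mod_cast div_ne_zero two_ne_zero (R.form_pos β (R.ne_zero hβ)).ne'

lemma IsWt.lie_e_ne_zero [FiniteDimensional K M] {x β : E} {v : M} (h : D.IsWt x v) (hv : v ≠ 0)
    (hβ : β ∈ R.roots) (hc : R.co β x < 0) : ⁅D.e β, v⁆ ≠ 0 := by
  have h1 := h.lie_f_ne_zero hv (R.neg_mem β hβ) (by rw [co_neg_left]; linarith)
  obtain ⟨c, -, hcc⟩ := D.f_eq _ (R.neg_mem β hβ)
  rw [hcc, neg_neg, smul_lie] at h1
  exact right_ne_zero_of_smul h1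

end SplitDatum

section tensorPower

variable (K : Type*) [Field K] {L : Type*} [LieRing L] [LieAlgebra K L]
  (V : Type*) [AddCommGroup V] [Module K V] [LieRingModule L V] [LieModule K L V]

/-- The `(k + 1)`-st tensor power in terms of the `k`-th one. -/
noncomputable def tensorPowerSucc (k : ℕ) : (⨂[K]^k V) ⊗[K] V ≃ₗ[K] ⨂[K]^(k + 1) V :=
  (TensorProduct.congr (LinearEquiv.refl K _)
    (PiTensorProduct.subsingletonEquiv (R := K) (s := fun _ : Fin 1 => V) 0).symm) ≪≫ₗ
    TensorPower.mulEquiv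

variable {K V}

lemma tensorPowerSucc_tprod_tmul {k : ℕ} (w : Fin k → V) (v : V) :
    tensorPowerSucc K V k (PiTensorProduct.tprod K w ⊗ₜ v) =
      PiTensorProduct.tprod K (Fin.snoc w v : Fin (k + 1) → V) := by
  rw [tensorPowerSucc, LinearEquiv.trans_apply, TensorProduct.congr_tmul, LinearEquiv.refl_apply,
    PiTensorProduct.subsingletonEquiv_symm_apply', ← TensorPower.gMul_def,
    TensorPower.tprod_mul_tprod]
  congr 1
  exact Fin.append_right_eq_snoc w _

lemma tensorPowerLieAction_tprod {k : ℕ} (x : L) (w : Fin k → V) :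
    tensorPowerLieAction K L V k x (PiTensorProduct.tprod K w) =
      ∑ i, PiTensorProduct.tprod K (Function.update w i ⁅x, w i⁆) := by
  rw [tensorPowerLieAction, LinearMap.sum_apply]
  refine Finset.sum_congr rfl fun i _ => ?_
  rw [PiTensorProduct.map_tprod]
  congr 1
  ext j
  by_cases h : j = i
  · subst h; simp
  · simp [h]

lemma tensorPowerLieAction_succ {k : ℕ} (x : L) (a : ⨂[K]^k V) (v : V) :
    tensorPowerLieAction K L V (k + 1) x (tensorPowerSucc K V k (a ⊗ₜ v)) =
      tensorPowerSucc K V k (tensorPowerLieAction K L V k x a ⊗ₜ v + a ⊗ₜ ⁅x, v⁆) := by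
  induction a using PiTensorProduct.induction_on with
  | add a b ha hb =>
    rw [TensorProduct.add_tmul, map_add, map_add, ha, hb, ← map_add, map_add (tensorPowerLieAction K L V k x),
      TensorProduct.add_tmul, TensorProduct.add_tmul]
    congr 1; abel
  | smul_tprod c w =>
    simp only [map_smul, ← TensorProduct.smul_tmul', ← smul_add]
    congr 1
    rw [tensorPowerSucc_tprod_tmul, tensorPowerLieAction_tprod, tensorPowerLieAction_tprod,
      TensorProduct.sum_tmul, map_add, map_sum, Fin.sum_univ_castSucc]
    simp only [tensorPowerSucc_tprod_tmul, Fin.snoc_castSucc, Fin.snoc_last, Fin.snoc_update,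
      Fin.update_snoc_last]

end tensorPower

namespace SplitDatum

open RootFrame

universe u v w

variable {K : Type u} {L : Type w} [Field K] [CharZero K] [LieRing L] [LieAlgebra K L]
  {E : Type*} [AddCommGroup E] [Module ℚ E] {R : RootFrame E} (D : SplitDatum K L R)

variable {V : Type v} [AddCommGroup V] [Module K V] [LieRingModule L V] [LieModule K L V]

variable (V) in
/-- `ν` is the weight of a highest weight vector in the `k`-th tensor power of `V`. -/
def Occ (k : ℕ) (ν : E) : Prop :=
  ∃ (M : Type (max u v)) (_ : AddCommGroup M) (_ : Module K M) (_ : LieRingModule L M)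
    (_ : LieModule K L M) (_ : FiniteDimensional K M) (j : M →ₗ[K] ⨂[K]^k V),
    Function.Injective j ∧ (∀ (x : L) m, j ⁅x, m⁆ = tensorPowerLieAction K L V k x (j m)) ∧
    ∃ m : M, m ≠ 0 ∧ D.IsWt ν m ∧ (∀ β ∈ R.pos, ⁅D.e β, m⁆ = 0) ∧
      LieSubmodule.lieSpan K L {m} = ⊤

variable {D}

lemma occ_zero : D.Occ V 0 0 := by
  let _ : LieRingModule L (⨂[K]^0 V) :=
    { bracket := fun _ _ => 0
      add_lie := fun _ _ _ => (add_zero _).symm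
      lie_add := fun _ _ _ => (add_zero _).symm
      leibniz_lie := fun _ _ _ => (add_zero _).symm }
  have hz : ∀ (x : L) (m : ⨂[K]^0 V), ⁅x, m⁆ = 0 := fun _ _ => rfl
  let _ : LieModule K L (⨂[K]^0 V) :=
    { smul_lie := fun t x m => by rw [hz, hz, smul_zero]
      lie_smul := fun t x m => by rw [hz, hz, smul_zero] }
  let φ := PiTensorProduct.isEmptyEquiv (Fin 0) (R := K) (s := fun _ => V)
  refine ⟨⨂[K]^0 V, inferInstance, inferInstance, inferInstance, inferInstance,
    Module.Finite.equiv φ.symm, LinearMap.id, fun _ _ h => h, fun x m => ?_, φ.symm 1,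
    by simp, fun y => by simp [hz], fun _ _ => hz _ _, ?_⟩
  · rw [hz]; simp [tensorPowerLieAction]
  · rw [eq_top_iff]
    intro m _
    have : m = φ m • φ.symm 1 := by rw [← map_smul, smul_eq_mul, mul_one, φ.symm_apply_apply]
    rw [this]
    exact Submodule.smul_mem _ _ (LieSubmodule.subset_lieSpan rfl)

lemma lieSpan_singleton_eq_top {M : Type*} [AddCommGroup M] [Module K M] [LieRingModule L M]
    [LieModule K L M] (u : M) :
    LieSubmodule.lieSpan K L
      {(⟨u, LieSubmodule.subset_lieSpan rfl⟩ : LieSubmodule.lieSpan K L {u})} = ⊤ := by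
  set N := LieSubmodule.lieSpan K L {u}
  set u' : N := ⟨u, LieSubmodule.subset_lieSpan rfl⟩
  have h : N ≤ (LieSubmodule.lieSpan K L {u'}).map N.incl := by
    rw [LieSubmodule.lieSpan_le, Set.singleton_subset_iff]
    exact LieSubmodule.mem_map_of_mem (f := N.incl) (LieSubmodule.subset_lieSpan (Set.mem_singleton u'))
  rw [eq_top_iff]
  intro m _
  obtain ⟨m', hm', h'⟩ := LieSubmodule.mem_map _ |>.1 (h m.2)
  rwa [← Subtype.ext h']

lemma Occ.succ [FiniteDimensional K V] {ι : Type*} [Fintype ι] {b : Module.Basis ι K V}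
    {wt : ι → E} (hb : D.IsWtBasis b wt) {k : ℕ} {ν μ : E} (h : D.Occ V k ν)
    (hμ : ∃ i, wt i = μ) (hmax : ∀ i, R.form (wt i) (wt i) ≤ R.form μ μ)
    (hdom : ∀ β ∈ R.pos, 0 ≤ R.co β (ν + μ)) : D.Occ V (k + 1) (ν + μ) := by
  obtain ⟨M, _, _, _, _, _, j, hj, hjl, m, hm0, hm, he, hgen⟩ := h
  obtain ⟨u, hu0, hu, hue⟩ := exists_highest_tensor hm0 hm he hgen hb hμ hmax hdom
  have hinj : Function.Injective ((tensorPowerSucc K V k).toLinearMap ∘ₗ j.rTensor V) := by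
    rw [LinearMap.coe_comp]
    exact (tensorPowerSucc K V k).injective.comp (Module.Flat.rTensor_preserves_injective_linearMap j hj)
  have hlie : ∀ (x : L) (z : M ⊗[K] V), tensorPowerSucc K V k (j.rTensor V ⁅x, z⁆) =
      tensorPowerLieAction K L V (k + 1) x (tensorPowerSucc K V k (j.rTensor V z)) := by
    intro x z
    induction z using TensorProduct.induction_on with
    | zero => simp
    | tmul a v =>
      rw [LinearMap.rTensor_tmul, tensorPowerLieAction_succ, TensorProduct.LieModule.lie_tmul_right,
        map_add, LinearMap.rTensor_tmul, LinearMap.rTensor_tmul, hjl]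
    | add y z hy hz => rw [lie_add, map_add, map_add, hy, hz, map_add, map_add, map_add]
  refine ⟨LieSubmodule.lieSpan K L {u}, inferInstance, inferInstance, inferInstance, inferInstance,
    inferInstance, ((tensorPowerSucc K V k).toLinearMap ∘ₗ j.rTensor V) ∘ₗ Submodule.subtype _,
    hinj.comp Subtype.val_injective, fun x z => hlie x z,
    ⟨u, LieSubmodule.subset_lieSpan rfl⟩, fun h => hu0 (congrArg Subtype.val h),
    fun y => Subtype.ext (hu y), fun β hβ => Subtype.ext (hue β hβ), lieSpan_singleton_eq_top u⟩

lemma Occ.le {r n : ℕ} (hinv : ∀ n : ℕ, 1 ≤ n → n < r → tensorPowerInvariants K L V n = ⊥)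
    (hn : 1 ≤ n) (h : D.Occ V n 0) : r ≤ n := by
  obtain ⟨M, _, _, _, _, _, j, hj, hjl, m, hm0, hm, he, -⟩ := h
  by_contra! hlt
  have hf : ∀ β ∈ R.pos, ⁅D.f β, m⁆ = 0 := fun β hβ =>
    hm.lie_f_eq_zero (R.mem_pos.1 hβ).1 (he β hβ) (map_zero _)
  have hz : ∀ x : L, ⁅x, m⁆ = 0 := by
    intro x
    rw [D.dual x, sum_lie]
    refine Finset.sum_eq_zero fun β hβ => ?_
    rw [add_lie, smul_lie, smul_lie, hm, map_zero, Rat.cast_zero, zero_smul, smul_zero, zero_add]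
    rcases R.pos_or_neg hβ with h | h
    · rw [he β h, smul_zero]
    · obtain ⟨c, hc⟩ := e_neg_eq (D := D) (R.mem_pos.1 h).1
      rw [neg_neg] at hc
      rw [hc, smul_lie, hf _ h, smul_zero, smul_zero]
  have h1 : j m ∈ tensorPowerInvariants K L V n := by
    rw [tensorPowerInvariants, Submodule.mem_iInf]
    intro x
    rw [LinearMap.mem_ker, ← hjl, hz, map_zero]
  rw [hinv n hn hlt, Submodule.mem_bot] at h1
  exact hm0 (hj (by rw [h1, map_zero]))

open Classical in
/-- The weight frame of a representation without small tensor invariants. -/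
noncomputable def weightFrame [FiniteDimensional K V] {ι : Type*} [Fintype ι] [Nonempty ι]
    {b : Module.Basis ι K V} {wt : ι → E} (hb : D.IsWtBasis b wt) {r : ℕ}
    (hr : r = Module.finrank K V)
    (hinv : ∀ n : ℕ, 1 ≤ n → n < r → tensorPowerInvariants K L V n = ⊥) : R.WeightFrame r where
  S := Finset.univ.image wt
  Occ := D.Occ V
  refl_mem := by
    simp only [Finset.mem_image, Finset.mem_univ, true_and, forall_exists_index,
      forall_apply_eq_imp_iff]
    intro β hβ i
    obtain ⟨w, hw, h⟩ := (hb i).refl (b.ne_zero i) hβ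
    exact hb.exists_of_ne_zero h hw
  exists_int := by
    simp only [Finset.mem_image, Finset.mem_univ, true_and, forall_exists_index,
      forall_apply_eq_imp_iff]
    exact fun β hβ i => (hb i).exists_int (b.ne_zero i) hβ
  sub_mem := by
    simp only [Finset.mem_image, Finset.mem_univ, true_and, forall_exists_index,
      forall_apply_eq_imp_iff]
    exact fun β hβ i hc => hb.exists_of_ne_zero ((hb i).lie_f hβ)
      ((hb i).lie_f_ne_zero (b.ne_zero i) hβ hc)
  card_le := by
    rw [hr, Module.finrank_eq_card_basis b]
    exact Finset.card_image_le
  occ_zero := occ_zero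
  occ_succ := fun k ν μ h hμ hmax hdom => h.succ hb (by simpa using hμ) (by simpa using hmax) hdom
  le_of_occ := fun n hn h => h.le hinv hn
  nonempty := Finset.univ_nonempty.image wt

end SplitDatum

section matrix

attribute [local instance] LieRing.ofAssociativeRing

variable {K : Type*} [Field K] {d : ℕ} {q : ℤ → Fin d}

lemma mem_of_trace_eq_zero (hq : Function.Surjective q)
    (hqd : ∀ i j, q i = q j ↔ (d : ℤ) ∣ i - j)
    (N : LieSubalgebra K (Matrix (Fin d) (Fin d) K))
    (h : ∀ i, Matrix.single (q i) (q (i + 1)) 1 ∈ N) {A : Matrix (Fin d) (Fin d) K}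
    (hA : A.trace = 0) : A ∈ N := by
  have hstep : ∀ k : ℕ, k + 1 < d → ∀ i : ℤ, Matrix.single (q i) (q (i + (k + 1 : ℕ))) 1 ∈ N := by
    intro k
    induction k with
    | zero => intro _ i; exact_mod_cast h i
    | succ k ih =>
      intro hk i
      have h1 := N.lie_mem (ih (by omega) i) (h (i + (k + 1 : ℕ)))
      have hne : q (i + (k + 1 : ℕ) + 1) ≠ q i := by
        rw [Ne, hqd]
        rintro ⟨c, hc⟩
        have h2 : (d : ℤ) * c = (k + 1 + 1 : ℕ) := by push_cast at hc ⊢; linarith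
        have h3 : (d : ℤ) ∣ (k + 1 + 1 : ℕ) := ⟨c, h2.symm⟩
        have := Nat.le_of_dvd (by omega) (Int.natCast_dvd_natCast.1 h3)
        omega
      rw [Ring.lie_def, Matrix.single_mul_single_same, Matrix.single_mul_single_of_ne _ _ _ _ hne,
        sub_zero, mul_one] at h1
      convert h1 using 3
      push_cast; ring
  have hoff : ∀ a b : Fin d, a ≠ b → ∀ c : K, Matrix.single a b c ∈ N := by
    intro a b hab c
    obtain ⟨i, rfl⟩ := hq a
    obtain ⟨j, rfl⟩ := hq b
    have hd : (0 : ℤ) < d := by exact_mod_cast (q i).pos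
    have h1 := Int.emod_nonneg (j - i) hd.ne'
    have h2 := Int.emod_lt_of_pos (j - i) hd
    have h3 : q j = q (i + (j - i) % d) := by
      rw [hqd]
      exact ⟨(j - i) / d, by linarith [Int.emod_add_mul_ediv (j - i) d]⟩
    have h0 : (j - i) % d ≠ 0 := fun h0 => hab (by rw [h3, h0, add_zero])
    obtain ⟨k, hk⟩ : ∃ k : ℕ, (j - i) % d = ((k + 1 : ℕ) : ℤ) :=
      ⟨((j - i) % d - 1).toNat, by omega⟩
    have := N.smul_mem c (hstep k (by omega) i)
    rwa [Matrix.smul_single, smul_eq_mul, mul_one, ← hk, ← h3] at this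
  have hdiag : ∀ a b : Fin d, ∀ c : K, Matrix.single a a c - Matrix.single b b c ∈ N := by
    intro a b c
    by_cases hab : a = b
    · rw [hab, sub_self]; exact N.zero_mem
    · have := N.lie_mem (hoff a b hab 1) (hoff b a (Ne.symm hab) c)
      rwa [Ring.lie_def, Matrix.single_mul_single_same, Matrix.single_mul_single_same, one_mul,
        mul_one] at this
  have hA2 : A = ∑ a, ∑ b ∈ Finset.univ.erase a, Matrix.single a b (A a b) +
      ∑ a, (Matrix.single a a (A a a) - Matrix.single (q 0) (q 0) (A a a)) := by
    have h1 : ∑ a, Matrix.single (q 0) (q 0) (A a a) = 0 := by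
      have h2 := map_sum (Matrix.singleLinearMap K (q 0) (q 0)) (fun a => A a a) Finset.univ
      rw [show ∑ a, A a a = 0 from hA, map_zero] at h2
      exact h2.symm
    rw [Finset.sum_sub_distrib, h1, sub_zero, ← Finset.sum_add_distrib]
    nth_rewrite 1 [Matrix.matrix_eq_sum_single A]
    exact Finset.sum_congr rfl fun a _ => (Finset.sum_erase_add _ _ (Finset.mem_univ a)).symm
  rw [hA2]
  exact N.add_mem (sum_mem fun a _ => sum_mem fun b hb => hoff a b (Finset.ne_of_mem_erase hb).symm _)
    (sum_mem fun a _ => hdiag _ _ _)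

/-- A simple Lie algebra with a representation by matrices containing the cyclic matrix units is
of type `A`. -/
lemma isTypeA_of_cyclic [CharZero K] {I : Type*} [LieRing I] [LieAlgebra K I]
    (hI : LieAlgebra.IsSimple K I) (hd : 2 ≤ d) (hq : Function.Surjective q)
    (hqd : ∀ i j, q i = q j ↔ (d : ℤ) ∣ i - j) (ρ : I →ₗ⁅K⁆ Matrix (Fin d) (Fin d) K)
    (h : ∀ i, ∃ x, ∃ c : K, c ≠ 0 ∧ ρ x = Matrix.single (q i) (q (i + 1)) c) : IsTypeA K I := by
  refine ⟨d, hd, ?_⟩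
  have hker : ρ.ker = ⊥ := by
    refine (hI.eq_bot_or_eq_top ρ.ker).resolve_right fun htop => ?_
    obtain ⟨x, c, hc, hx⟩ := h 0
    have : x ∈ ρ.ker := htop ▸ LieSubmodule.mem_top x
    rw [LieHom.mem_ker, hx] at this
    exact hc (by simpa using congrFun (congrFun this (q 0)) (q (0 + 1)))
  have hinj : Function.Injective ρ := (LieHom.ker_eq_bot _).1 hker
  let T : LieIdeal K I :=
    { LinearMap.ker (Matrix.traceLinearMap (Fin d) K K ∘ₗ (ρ : I →ₗ[K] Matrix (Fin d) (Fin d) K)) with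
      lie_mem := fun {x m} _ => by
        change Matrix.trace (ρ ⁅x, m⁆) = 0
        rw [LieHom.map_lie, Ring.lie_def, Matrix.trace_sub, Matrix.trace_mul_comm, sub_self] }
  have hTmem : ∀ x, x ∈ T ↔ (ρ x).trace = 0 := fun x => Iff.rfl
  have hT : T = ⊤ := by
    refine (hI.eq_bot_or_eq_top T).resolve_left fun hbot => hI.non_abelian ⟨fun x y => ?_⟩
    have : ⁅x, y⁆ ∈ T := by
      rw [hTmem, LieHom.map_lie, Ring.lie_def, Matrix.trace_sub, Matrix.trace_mul_comm, sub_self]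
    rwa [hbot, LieSubmodule.mem_bot] at this
  have hrange : ρ.range = LieAlgebra.SpecialLinear.sl (Fin d) K := by
    ext A
    constructor
    · rintro ⟨x, rfl⟩
      exact (hTmem x).1 (hT ▸ LieSubmodule.mem_top x)
    · intro hA
      refine mem_of_trace_eq_zero hq hqd ρ.range (fun i => ?_) hA
      obtain ⟨x, c, hc, hx⟩ := h i
      refine ⟨c⁻¹ • x, ?_⟩
      rw [LieHom.coe_toLinearMap, map_smul, hx, Matrix.smul_single, smul_eq_mul,
        inv_mul_cancel₀ hc]
  exact ⟨(LieEquiv.ofInjective ρ hinj).trans (LieEquiv.ofEq _ _ (by rw [hrange]))⟩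

end matrix

namespace SplitDatum

open RootFrame

variable {K L : Type*} [Field K] [CharZero K] [LieRing L] [LieAlgebra K L]
  {E : Type*} [AddCommGroup E] [Module ℚ E] {R : RootFrame E} (D : SplitDatum K L R)

/-- The span of the `t β` and the root vectors for `β` in a set of roots. -/
def rootSpan (A : Finset E) : Submodule K L :=
  Submodule.span K ((fun β => D.t β) '' (A : Set E) ∪ D.e '' (A : Set E))

variable {D}

lemma t_mem_rootSpan {A : Finset E} {β : E} (hβ : β ∈ A) : D.t β ∈ D.rootSpan A :=
  Submodule.subset_span (Or.inl ⟨β, hβ, rfl⟩)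

lemma e_mem_rootSpan {A : Finset E} {β : E} (hβ : β ∈ A) : D.e β ∈ D.rootSpan A :=
  Submodule.subset_span (Or.inr ⟨β, hβ, rfl⟩)

lemma rootSpan_le {A : Finset E} {N : Submodule K L} (ht : ∀ β ∈ A, D.t β ∈ N)
    (he : ∀ β ∈ A, D.e β ∈ N) : D.rootSpan A ≤ N := by
  rw [rootSpan, Submodule.span_le]
  rintro _ (⟨β, hβ, rfl⟩ | ⟨β, hβ, rfl⟩)
  exacts [ht β hβ, he β hβ]

lemma lie_mem_rootSpan {A : Finset E} (hA : A ⊆ R.roots)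
    (hcl : ∀ β ∈ A, ∀ γ ∈ R.roots, R.form β γ ≠ 0 → γ ∈ A) (x : L) {y : L}
    (hy : y ∈ D.rootSpan A) : ⁅x, y⁆ ∈ D.rootSpan A := by
  have het : ∀ δ ∈ R.roots, ∀ β ∈ A, ⁅D.e δ, D.t β⁆ ∈ D.rootSpan A := by
    intro δ hδ β hβ
    rw [← lie_skew, D.lie_t_e δ hδ]
    by_cases h0 : R.form β δ = 0
    · simp [h0]
    · exact neg_mem (Submodule.smul_mem _ _ (e_mem_rootSpan (hcl β hβ δ hδ h0)))
  have hee : ∀ δ ∈ R.roots, ∀ β ∈ A, ⁅D.e δ, D.e β⁆ ∈ D.rootSpan A := by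
    intro δ hδ β hβ
    by_cases h0 : δ + β = 0
    · obtain ⟨c, hc⟩ := e_neg_eq (D := D) (hA hβ)
      rw [eq_neg_of_add_eq_zero_left h0, hc, smul_lie, ← lie_skew, D.lie_e_f β (hA hβ)]
      exact Submodule.smul_mem _ _ (neg_mem (t_mem_rootSpan hβ))
    by_cases hr : δ + β ∈ R.roots
    · obtain ⟨c, hc⟩ := D.lie_e_e δ hδ β (hA hβ) hr
      rw [hc]
      refine Submodule.smul_mem _ _ (e_mem_rootSpan ?_)
      by_cases h1 : R.form β (δ + β) = 0
      · have hβp := R.form_pos β (R.ne_zero (hA hβ))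
        have hsp := R.form_pos _ h0
        have hc1 := R.form_comm β δ
        simp only [map_add, LinearMap.add_apply] at h1 hsp
        have hδ' : δ ∈ A := hcl β hβ δ hδ (by intro h; linarith)
        refine hcl δ hδ' _ hr ?_
        rw [map_add]
        intro h
        linarith
      · exact hcl β hβ _ hr h1
    · rw [D.lie_e_e_eq_zero δ hδ β (hA hβ) hr h0]; exact zero_mem _
  have key : ∀ z, (∀ β ∈ A, ⁅z, D.t β⁆ ∈ D.rootSpan A) → (∀ β ∈ A, ⁅z, D.e β⁆ ∈ D.rootSpan A) →
      ⁅z, y⁆ ∈ D.rootSpan A := fun z h1 h2 =>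
    rootSpan_le (N := (D.rootSpan A).comap (LieModule.toEnd K L L z)) h1 h2 hy
  rw [D.dual x, sum_lie]
  refine sum_mem fun δ hδ => ?_
  rw [add_lie, smul_lie, smul_lie]
  refine add_mem (Submodule.smul_mem _ _ (key _ (fun β hβ => ?_) fun β hβ => ?_))
    (Submodule.smul_mem _ _ (key _ (het δ hδ) (hee δ hδ)))
  · rw [D.lie_t_t]; exact zero_mem _
  · rw [D.lie_t_e β (hA hβ)]; exact Submodule.smul_mem _ _ (e_mem_rootSpan hβ)

variable {I : LieIdeal K L}

lemma t_mem_of_e_mem {β : E} (hβ : β ∈ R.roots) (h : D.e β ∈ I) : D.t β ∈ I := by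
  rw [← D.lie_e_f β hβ, ← lie_skew]
  exact neg_mem (lie_mem_right K L I _ _ h)

lemma e_mem_of_form_ne_zero {β γ : E} (hβ : β ∈ R.roots) (hγ : γ ∈ R.roots) (h : D.e β ∈ I)
    (hne : R.form β γ ≠ 0) : D.e γ ∈ I := by
  have h1 : ⁅D.t β, D.e γ⁆ ∈ I := by
    rw [← lie_skew]
    exact neg_mem (lie_mem_right K L I _ _ (t_mem_of_e_mem hβ h))
  rw [D.lie_t_e γ hγ] at h1
  exact (Submodule.smul_mem_iff (I : Submodule K L) (by exact_mod_cast hne)).1 h1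

open Classical in
variable (D I) in
/-- The roots whose root vectors lie in `I`. -/
noncomputable def idealRoots : Finset E := R.roots.filter fun β => D.e β ∈ I

lemma mem_idealRoots {β : E} : β ∈ D.idealRoots I ↔ β ∈ R.roots ∧ D.e β ∈ I := by
  simp [idealRoots]

lemma rootSpan_eq_of_isSimple (hI : LieAlgebra.IsSimple K I) {A : Finset E}
    (hA : A ⊆ D.idealRoots I) (hne : A.Nonempty)
    (hcl : ∀ β ∈ A, ∀ γ ∈ R.roots, R.form β γ ≠ 0 → γ ∈ A) :
    D.rootSpan A = (I : Submodule K L) := by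
  have hAr : A ⊆ R.roots := fun β hβ => (mem_idealRoots.1 (hA hβ)).1
  have hle : D.rootSpan A ≤ (I : Submodule K L) := rootSpan_le
    (fun β hβ => t_mem_of_e_mem (hAr hβ) (mem_idealRoots.1 (hA hβ)).2)
    (fun β hβ => (mem_idealRoots.1 (hA hβ)).2)
  let N : LieIdeal K I :=
    { (D.rootSpan A).comap (I : Submodule K L).subtype with
      lie_mem := fun {x m} hm => lie_mem_rootSpan hAr hcl (x : L) hm }
  obtain ⟨β, hβ⟩ := hne
  have hN : N = ⊤ := by
    refine (hI.eq_bot_or_eq_top N).resolve_left fun hbot => ?_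
    have h1 : (⟨D.e β, (mem_idealRoots.1 (hA hβ)).2⟩ : I) ∈ N := e_mem_rootSpan hβ
    rw [hbot, LieSubmodule.mem_bot] at h1
    exact e_ne_zero (hAr hβ) (congrArg Subtype.val h1)
  refine le_antisymm hle fun y hy => ?_
  have h1 : (⟨y, hy⟩ : I) ∈ N := hN ▸ LieSubmodule.mem_top _
  exact h1

lemma mem_of_mem_idealRoots {β γ : E} (hβ : β ∈ D.idealRoots I) (hγ : γ ∈ R.roots)
    (h : R.form β γ ≠ 0) : γ ∈ D.idealRoots I :=
  mem_idealRoots.2 ⟨hγ, e_mem_of_form_ne_zero (mem_idealRoots.1 hβ).1 hγ (mem_idealRoots.1 hβ).2 h⟩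

lemma isComponent_idealRoots (hI : LieAlgebra.IsSimple K I) : R.IsComponent (D.idealRoots I) where
  subset := fun β hβ => (mem_idealRoots.1 hβ).1
  orthogonal := fun β hβ γ hγ h => by
    by_contra hne
    exact h (mem_of_mem_idealRoots hβ hγ hne)
  irreducible := fun A hA hne h => by
    have h1 := rootSpan_eq_of_isSimple hI hA hne fun β hβ γ hγ hf => by
      by_contra hc
      exact hf (h β hβ γ (mem_of_mem_idealRoots (hA hβ) hγ hf) hc)
    refine hA.antisymm fun γ hγ => ?_
    by_contra hc
    have hγr := (mem_idealRoots.1 hγ).1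
    have h2 : D.rootSpan A ≤ LinearMap.ker (D.killing (D.f γ)) := rootSpan_le
      (fun β _ => D.killing_f_t γ hγr β)
      (fun β hβ => D.killing_f_e_of_ne γ hγr β (mem_idealRoots.1 (hA hβ)).1 (by
        rintro rfl; exact hc hβ))
    rw [h1] at h2
    have h3 : D.killing (D.f γ) (D.e γ) = 0 := h2 (mem_idealRoots.1 hγ).2
    rw [D.killing_f_e γ hγr] at h3
    exact one_ne_zero h3

lemma idealRoots_nonempty (h : ∃ (x : E) (v : I), v ≠ 0 ∧ D.IsWt x v) :
    (D.idealRoots I).Nonempty := by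
  obtain ⟨x, ⟨v, hvI⟩, hv0, hv⟩ := h
  have hv0 : v ≠ 0 := fun h => hv0 (Subtype.ext h)
  have hv : D.IsWt x v := fun y => congrArg Subtype.val (hv y)
  by_cases hex : ∃ β ∈ R.roots, D.killing (D.f β) v ≠ 0
  · obtain ⟨β, hβ, hne⟩ := hex
    have hx : ∀ γ ∈ R.roots, D.killing (D.f γ) v ≠ 0 → γ = x := by
      intro γ hγ h
      apply ratCast_form_injective (K := K) (R := R)
      intro y
      have h1 := D.killing_lie (D.f γ) (D.t y) v
      rw [← lie_skew, D.lie_t_f γ hγ, neg_neg, hv, map_smul, map_smul, LinearMap.smul_apply] at h1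
      exact mul_right_cancel₀ h h1
    have ht : ∀ γ, D.killing (D.t γ) v = 0 := by
      intro γ
      obtain rfl := hx β hβ hne
      have h1 := D.killing_lie (D.t γ) (D.t β) v
      rw [D.lie_t_t, map_zero, LinearMap.zero_apply, hv, map_smul, eq_comm, smul_eq_zero] at h1
      refine h1.resolve_left ?_
      exact_mod_cast (R.form_pos β (R.ne_zero hβ)).ne'
    refine ⟨β, mem_idealRoots.2 ⟨hβ, ?_⟩⟩
    have h1 := D.dual v
    rw [Finset.sum_eq_single β, ht, zero_smul, zero_add] at h1
    · rw [h1] at hvI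
      exact (Submodule.smul_mem_iff (I : Submodule K L) hne).1 hvI
    · intro γ hγ hne'
      rw [ht, zero_smul, zero_add]
      by_cases h0 : D.killing (D.f γ) v = 0
      · rw [h0, zero_smul]
      · exact absurd ((hx γ hγ h0).trans (hx β hβ hne).symm) hne'
    · exact fun h => absurd hβ h
  · push Not at hex
    have h1 : v = ∑ β ∈ R.roots, D.killing (D.t β) v • D.t β := by
      nth_rewrite 1 [D.dual v]
      exact Finset.sum_congr rfl fun β hβ => by rw [hex β hβ, zero_smul, add_zero]
    have h2 : ∀ γ ∈ R.roots, ∃ s : K, ⁅v, D.e γ⁆ = s • D.e γ := by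
      intro γ hγ
      refine ⟨∑ β ∈ R.roots, D.killing (D.t β) v * ((R.form β γ : ℚ) : K), ?_⟩
      nth_rewrite 1 [h1]
      rw [sum_lie, Finset.sum_smul]
      exact Finset.sum_congr rfl fun β _ => by rw [smul_lie, D.lie_t_e γ hγ, smul_smul]
    by_contra hemp
    apply hv0
    rw [h1]
    refine Finset.sum_eq_zero fun γ hγ => ?_
    obtain ⟨s, hs⟩ := h2 γ hγ
    have hs0 : s = 0 := by
      by_contra hs0
      have h3 : ⁅v, D.e γ⁆ ∈ I := by
        rw [← lie_skew]; exact neg_mem (lie_mem_right K L I _ _ hvI)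
      rw [hs] at h3
      exact hemp ⟨γ, mem_idealRoots.2
        ⟨hγ, (Submodule.smul_mem_iff (I : Submodule K L) hs0).1 h3⟩⟩
    rw [D.killing_symm, ← D.lie_e_f γ hγ, ← D.killing_lie, hs, hs0, zero_smul, map_zero,
      LinearMap.zero_apply, zero_smul]

end SplitDatum

section matrix

attribute [local instance] LieRing.ofAssociativeRing

/-- The matrix representation of `L` on the span of part of a basis. -/
noncomputable def subbasisRep {K L V : Type*} [Field K] [LieRing L] [LieAlgebra K L]
    [AddCommGroup V] [Module K V] [LieRingModule L V] [LieModule K L V] {ι : Type*} [Fintype ι]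
    (b : Module.Basis ι K V) {d : ℕ} {idx : Fin d → ι} (hidx : Function.Injective idx)
    (h : ∀ (x : L) (l : Fin d) (j : ι), b.repr ⁅x, b (idx l)⁆ j ≠ 0 → j ∈ Set.range idx) :
    L →ₗ⁅K⁆ Matrix (Fin d) (Fin d) K where
  toFun x := Matrix.of fun k l => b.repr ⁅x, b (idx l)⁆ (idx k)
  map_add' x y := by ext k l; simp
  map_smul' a x := by ext k l; simp
  map_lie' := by
    intro x y
    have hsum : ∀ (y : L) (l : Fin d),
        ⁅y, b (idx l)⁆ = ∑ m, b.repr ⁅y, b (idx l)⁆ (idx m) • b (idx m) := by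
      intro y l
      nth_rewrite 1 [← b.sum_repr ⁅y, b (idx l)⁆]
      exact (Fintype.sum_of_injective idx hidx _ _ (fun j hj => by
        by_contra hne
        exact hj (h y l j fun h0 => hne (by rw [h0, zero_smul]))) fun _ => rfl).symm
    have hmul : ∀ (x y : L) (k l : Fin d), b.repr ⁅x, ⁅y, b (idx l)⁆⁆ (idx k) =
        ∑ m, b.repr ⁅x, b (idx m)⁆ (idx k) * b.repr ⁅y, b (idx l)⁆ (idx m) := by
      intro x y k l
      nth_rewrite 1 [hsum y l]
      simp [lie_sum, Finset.sum_apply, mul_comm]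
    ext k l
    rw [Ring.lie_def, Matrix.of_apply, Matrix.sub_apply, Matrix.mul_apply, Matrix.mul_apply]
    simp only [Matrix.of_apply, lie_lie, map_sub, Finsupp.sub_apply, hmul]

lemma subbasisRep_apply {K L V : Type*} [Field K] [LieRing L] [LieAlgebra K L]
    [AddCommGroup V] [Module K V] [LieRingModule L V] [LieModule K L V] {ι : Type*} [Fintype ι]
    (b : Module.Basis ι K V) {d : ℕ} {idx : Fin d → ι} (hidx : Function.Injective idx)
    (h : ∀ (x : L) (l : Fin d) (j : ι), b.repr ⁅x, b (idx l)⁆ j ≠ 0 → j ∈ Set.range idx)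
    (x : L) (k l : Fin d) : subbasisRep b hidx h x k l = b.repr ⁅x, b (idx l)⁆ (idx k) := rfl

end matrix

lemma exists_periodic_enum {d : ℕ} (hd : 2 ≤ d) :
    ∃ q : ℤ → Fin d, Function.Surjective q ∧ ∀ i j, q i = q j ↔ (d : ℤ) ∣ i - j := by
  have hd0 : (0 : ℤ) < d := by omega
  refine ⟨fun i => ⟨(i % d).toNat, by
    have := Int.emod_nonneg i hd0.ne'
    have := Int.emod_lt_of_pos i hd0
    omega⟩, fun k => ⟨k, Fin.ext ?_⟩, fun i j => ?_⟩
  · have : ((k : ℕ) : ℤ) % d = k := Int.emod_eq_of_lt (by omega) (by have := k.2; omega)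
    simp [this]
  · rw [Fin.mk.injEq, ← Int.emod_eq_emod_iff_emod_sub_eq_zero.trans Int.dvd_iff_emod_eq_zero.symm]
    have := Int.emod_nonneg i hd0.ne'
    have := Int.emod_nonneg j hd0.ne'
    omega

namespace SplitDatum

open RootFrame

variable {K L : Type*} [Field K] [CharZero K] [LieRing L] [LieAlgebra K L]
  {E : Type*} [AddCommGroup E] [Module ℚ E] {R : RootFrame E} {D : SplitDatum K L R}
  {V : Type*} [AddCommGroup V] [Module K V] [LieRingModule L V] [LieModule K L V]

lemma span_isWt_eq_top [LieModule.IsIrreducible K L V] (h : ∃ (x : E) (v : V), v ≠ 0 ∧ D.IsWt x v) :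
    Submodule.span K {v : V | ∃ x, True ∧ D.IsWt x v} = ⊤ := by
  set P := Submodule.span K {v : V | ∃ x, True ∧ D.IsWt x v} with hP
  have key : ∀ m ∈ P, ∀ z : L, (∀ x (v : V), D.IsWt x v → ⁅z, v⁆ ∈ P) → ⁅z, m⁆ ∈ P := by
    intro m hm z hz
    have h1 : P ≤ P.comap (LieModule.toEnd K L V z) := by
      nth_rewrite 1 [hP]
      rw [Submodule.span_le]
      rintro v ⟨x, -, hv⟩
      exact hz x v hv
    exact h1 hm
  let N : LieSubmodule K L V :=
    { P with
      lie_mem := by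
        intro z m hm
        change ⁅z, m⁆ ∈ P
        rw [D.dual z, sum_lie]
        refine sum_mem fun β hβ => ?_
        rw [add_lie, smul_lie, smul_lie]
        refine add_mem (Submodule.smul_mem _ _ (key m hm _ fun x v hv => ?_))
          (Submodule.smul_mem _ _ (key m hm _ fun x v hv => ?_))
        · exact Submodule.subset_span ⟨x, trivial, by rw [hv β]; exact hv.smul _⟩
        · exact Submodule.subset_span ⟨_, trivial, hv.lie_e hβ⟩ }
  have hN : N = ⊤ := by
    refine (eq_bot_or_eq_top N).resolve_left fun hbot => ?_
    obtain ⟨x, v, hv0, hv⟩ := h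
    have h1 : v ∈ N := Submodule.subset_span ⟨x, trivial, hv⟩
    rw [hbot, LieSubmodule.mem_bot] at h1
    exact hv0 h1
  exact congrArg LieSubmodule.toSubmodule hN

theorem isTypeA [FiniteDimensional K V] [LieModule.IsIrreducible K L V]
    (hfaithful : Function.Injective (LieModule.toEnd K L V)) {r : ℕ} (hr : r = Module.finrank K V)
    (hinv : ∀ n : ℕ, 1 ≤ n → n < r → tensorPowerInvariants K L V n = ⊥)
    {I : LieIdeal K L} (hI : LieAlgebra.IsSimple K I)
    (hV : ∃ (x : E) (v : V), v ≠ 0 ∧ D.IsWt x v) (hIW : ∃ (x : E) (v : I), v ≠ 0 ∧ D.IsWt x v) :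
    IsTypeA K I := by
  classical
  obtain ⟨ι, _, b, wt, hb, -⟩ := exists_wtBasis (span_isWt_eq_top hV)
  have : Nonempty ι := by
    obtain ⟨x, v, hv0, hv⟩ := hV
    exact ⟨(hb.exists_of_ne_zero hv hv0).choose⟩
  let W := weightFrame hb hr hinv
  have hS : ∀ π, π ∈ W.S ↔ ∃ i, wt i = π := by simp [W, weightFrame]
  have hinj : Function.Injective wt := by
    have h1 : (Finset.univ.image wt).card = (Finset.univ : Finset ι).card := by
      rw [Finset.card_univ, ← Module.finrank_eq_card_basis b, ← hr, ← W.card_eq]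
      exact congrArg Finset.card (Finset.ext fun π => by simp [hS])
    exact Set.injOn_univ.1 (by simpa using Finset.card_image_iff.1 h1)
  have hΦ := isComponent_idealRoots (D := D) hI
  obtain ⟨γ, hγ⟩ := idealRoots_nonempty (D := D) hIW
  obtain ⟨i₀, hi₀⟩ : ∃ i, R.co γ (wt i) ≠ 0 := by
    by_contra! hall
    have hγr := (mem_idealRoots.1 hγ).1
    apply t_ne_zero (D := D) hγr
    apply hfaithful
    rw [map_zero]
    refine b.ext fun i => ?_
    rw [LieModule.toEnd_apply_apply, hb i, R.form_comm,
      (R.co_eq_zero_iff (R.ne_zero hγr)).1 (hall i)]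
    simp
  obtain ⟨d, hd, p, hpS, hpp, hpΦ, hpu, hp0, hpe⟩ :=
    W.exists_cycle hΦ ((hS _).2 ⟨i₀, rfl⟩) hγ hi₀
  obtain ⟨q, hq, hqd⟩ := exists_periodic_enum hd
  choose s hs using hq
  have hpq : ∀ i, p (s (q i)) = p i := fun i => by rw [hpp, ← hqd, hs]
  choose j hj using fun i => (hS _).1 (hpS i)
  let idx : Fin d → ι := fun k => j (s k)
  have hwidx : ∀ k, wt (idx k) = p (s k) := fun k => hj _
  have hidx : Function.Injective idx := fun k l h => by
    have h1 : p (s k) = p (s l) := by rw [← hwidx, ← hwidx, h]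
    rwa [hpp, ← hqd, hs, hs] at h1
  have hrange : ∀ i a, wt i = p a → i = idx (q a) := fun i a h =>
    hinj (by rw [h, hwidx, hpq])
  have hwl : ∀ x : L, x ∈ I → ∀ l m, b.repr ⁅x, b (idx l)⁆ m ≠ 0 → m ∈ Set.range idx := by
    intro x hx l m
    contrapose!
    intro hm
    have hx' : x ∈ D.rootSpan (D.idealRoots I) := by
      rw [rootSpan_eq_of_isSimple hI subset_rfl ⟨γ, hγ⟩
        fun β hβ δ hδ h => mem_of_mem_idealRoots hβ hδ h]
      exact hx
    refine rootSpan_le (N := LinearMap.ker (Finsupp.lapply m ∘ₗ b.repr.toLinearMap ∘ₗ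
      (LieModule.toEnd K L V : L →ₗ[K] Module.End K V).flip (b (idx l)))) (fun β hβ => ?_)
      (fun β hβ => ?_) hx'
    · change b.repr ⁅D.t β, b (idx l)⁆ m = 0
      rw [hb _ β, map_smul, b.repr_self, Finsupp.smul_apply, Finsupp.single_eq_of_ne, smul_zero]
      rintro rfl
      exact hm ⟨l, rfl⟩
    · change b.repr ⁅D.e β, b (idx l)⁆ m = 0
      by_contra hne
      have hβr := (mem_idealRoots.1 hβ).1
      have h1 := hb.repr ((hb (idx l)).lie_e hβr) hne
      obtain ⟨a, ha⟩ := hpe (wt m) ((hS _).2 ⟨m, rfl⟩) (by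
        rw [h1, hwidx, add_sub_right_comm]
        exact add_mem (hp0 _) (Submodule.subset_span hβ))
      exact hm ⟨q a, (hrange m a ha).symm⟩
  refine isTypeA_of_cyclic hI hd (fun k => ⟨s k, hs k⟩) hqd
    (subbasisRep (L := I) b hidx fun x => hwl x x.2) fun i => ?_
  have hβ := hpΦ i
  have hβr := (mem_idealRoots.1 hβ).1
  have hco : R.co (p i - p (i + 1)) (p (i + 1)) < 0 := by
    have h1 := R.co_self (R.ne_zero hβr)
    rw [(R.co (p i - p (i + 1))).map_sub] at h1
    have h2 := W.co_cases hβr (hpS i)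
    have h3 := W.co_cases hβr (hpS (i + 1))
    grind
  have hlp : wt (idx (q (i + 1))) = p (i + 1) := by rw [hwidx, hpq]
  have hwt := (hb (idx (q (i + 1)))).lie_e hβr
  have hne := (hb (idx (q (i + 1)))).lie_e_ne_zero (b.ne_zero _) hβr (by rwa [hlp])
  rw [hlp, add_sub_cancel] at hwt
  have hwts : ∀ m, b.repr ⁅D.e (p i - p (i + 1)), b (idx (q (i + 1)))⁆ m ≠ 0 → m = idx (q i) :=
    fun m hm => hrange m i (hb.repr hwt hm)
  refine ⟨⟨D.e _, (mem_idealRoots.1 hβ).2⟩,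
    b.repr ⁅D.e (p i - p (i + 1)), b (idx (q (i + 1)))⁆ (idx (q i)), ?_, ?_⟩
  · obtain ⟨m, hm⟩ := Finsupp.ne_iff.1 ((b.repr.map_ne_zero_iff).2 hne)
    rw [← hwts m hm]; exact hm
  · ext k l
    rw [subbasisRep_apply, Matrix.single_apply]
    change b.repr ⁅D.e (p i - p (i + 1)), b (idx l)⁆ (idx k) = _
    split_ifs with h
    · rw [← h.1, ← h.2]
    · by_contra hne
      have h1 := hb.repr ((hb (idx l)).lie_e hβr) hne
      rw [hwidx, hwidx] at h1
      have h2 := hpu (s k) (s l) i (by rw [h1]; abel)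
      have h3 : p (s l) = p (i + 1) := by
        rw [h2] at h1
        have h4 : p (s l) = p i - (p i - p (i + 1)) := by nth_rewrite 1 [h1]; abel
        rw [h4]; abel
      rw [hpp, ← hqd, hs] at h2 h3
      exact h ⟨h2.symm, h3.symm⟩

end SplitDatum

section rationalForm

open LieAlgebra LieAlgebra.IsKilling LieModule

variable {K L : Type*} [Field K] [CharZero K] [LieRing L] [LieAlgebra K L]
  [IsKilling K L] [FiniteDimensional K L]
  {H : LieSubalgebra K L} [H.IsCartanSubalgebra] [IsTriangularizable K H L]

lemma killingForm_cartanEquivDual_symm (x : Module.Dual K H) (h : H) :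
    killingForm K L ((cartanEquivDual H).symm x) h = x h :=
  LinearMap.congr_fun ((cartanEquivDual H).apply_symm_apply x) h

lemma apply_cartanEquivDual_symm_comm (x y : Module.Dual K H) :
    x ((cartanEquivDual H).symm y) = y ((cartanEquivDual H).symm x) := by
  rw [← killingForm_cartanEquivDual_symm, ← killingForm_cartanEquivDual_symm,
    LieModule.traceForm_comm]

lemma apply_cartanEquivDual_symm_eq_sum (x y : Module.Dual K H) :
    x ((cartanEquivDual H).symm y) =
      ∑ α ∈ H.root, x ((cartanEquivDual H).symm α) * y ((cartanEquivDual H).symm α) := by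
  have h := LinearMap.congr_fun₂ (restrict_killingForm_eq_sum (K := K) (H := H))
    ((cartanEquivDual H).symm x) ((cartanEquivDual H).symm y)
  rw [← killingForm_cartanEquivDual_symm]
  refine h.trans ?_
  rw [LinearMap.sum_apply, LinearMap.sum_apply]
  refine Finset.sum_congr rfl fun α _ => ?_
  rw [LinearMap.smulRight_apply, LinearMap.smul_apply, smul_eq_mul,
    apply_cartanEquivDual_symm_comm _ x, apply_cartanEquivDual_symm_comm _ y]

lemma two_mul_apply_cartanEquivDual_symm {α : Weight K H L} (hα : α.IsNonZero)
    (x : Module.Dual K H) : 2 * x ((cartanEquivDual H).symm α) =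
      α ((cartanEquivDual H).symm α) * x (coroot α) := by
  have := root_apply_cartanEquivDual_symm_ne_zero hα
  simp only [coroot, map_nsmul, map_smul, smul_eq_mul, nsmul_eq_mul, Nat.cast_ofNat]
  field_simp

lemma exists_rat_root_apply {α : Weight K H L} (hα : α.IsNonZero) :
    ∃ q : ℚ, α ((cartanEquivDual H).symm α) = q := by
  have h := apply_cartanEquivDual_symm_eq_sum (α : Module.Dual K H) α
  have h0 := root_apply_cartanEquivDual_symm_ne_zero hα
  set c := α ((cartanEquivDual H).symm α) with hc
  have h1 : ∀ β ∈ H.root, (α : Module.Dual K H) ((cartanEquivDual H).symm (β : Weight K H L)) =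
      c * ((((chainBotCoeff α β - chainTopCoeff α β : ℤ) : ℚ) / 2 : ℚ) : K) := by
    intro β _
    have := two_mul_apply_cartanEquivDual_symm hα (β : Module.Dual K H)
    rw [← hc] at this
    rw [apply_cartanEquivDual_symm_comm]
    simp only [Weight.toLinear_apply, apply_coroot_eq_cast] at this ⊢
    push_cast at this ⊢
    linear_combination this / 2
  rw [Finset.sum_congr rfl fun β hβ => by rw [h1 β hβ]] at h
  set n : Weight K H L → ℚ := fun β => ((chainBotCoeff α β - chainTopCoeff α β : ℤ) : ℚ) / 2
  have h2 : c = c ^ 2 * ((∑ β ∈ H.root, n β * n β : ℚ) : K) := by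
    rw [Rat.cast_sum, Finset.mul_sum]
    refine h.trans (Finset.sum_congr rfl fun β _ => ?_)
    rw [Rat.cast_mul]; ring
  refine ⟨(∑ β ∈ H.root, n β * n β)⁻¹, ?_⟩
  rw [Rat.cast_inv]
  refine eq_inv_of_mul_eq_one_left (mul_left_cancel₀ h0 ?_)
  linear_combination -h2

variable (H) in
/-- The rational form of the dual of a Cartan subalgebra. -/
noncomputable def ratDual : Submodule ℚ (Module.Dual K H) where
  carrier := {x | ∀ α : Weight K H L, α.IsNonZero →
    ∃ q : ℚ, x ((cartanEquivDual H).symm α) = q}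
  add_mem' {x y} hx hy α hα := by
    obtain ⟨a, ha⟩ := hx α hα
    obtain ⟨b, hb⟩ := hy α hα
    exact ⟨a + b, by rw [LinearMap.add_apply, ha, hb, Rat.cast_add]⟩
  zero_mem' α hα := ⟨0, by simp⟩
  smul_mem' c x hx α hα := by
    obtain ⟨a, ha⟩ := hx α hα
    exact ⟨c * a, by rw [LinearMap.smul_apply, ha, Rat.smul_def, Rat.cast_mul]⟩

lemma mem_ratDual_of_coroot {x : Module.Dual K H}
    (h : ∀ α : Weight K H L, α.IsNonZero → ∃ z : ℤ, x (coroot α) = z) : x ∈ ratDual H := by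
  intro α hα
  obtain ⟨q, hq⟩ := exists_rat_root_apply hα
  obtain ⟨z, hz⟩ := h α hα
  refine ⟨q * z / 2, ?_⟩
  have := two_mul_apply_cartanEquivDual_symm hα x
  rw [hq, hz] at this
  push_cast
  linear_combination this / 2

lemma weight_mem_ratDual (β : Weight K H L) : (β : Module.Dual K H) ∈ ratDual H :=
  mem_ratDual_of_coroot fun α _ =>
    ⟨chainBotCoeff α β - chainTopCoeff α β, by rw [Weight.toLinear_apply, apply_coroot_eq_cast]⟩

lemma exists_rat_apply {x y : Module.Dual K H} (hx : x ∈ ratDual H) (hy : y ∈ ratDual H) :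
    ∃ q : ℚ, x ((cartanEquivDual H).symm y) = q := by
  have h : ∀ α : Weight K H L, ∃ a : ℚ, α.IsNonZero →
      x ((cartanEquivDual H).symm α) * y ((cartanEquivDual H).symm α) = a := by
    intro α
    by_cases hα : α.IsNonZero
    · obtain ⟨a, ha⟩ := hx α hα
      obtain ⟨b, hb⟩ := hy α hα
      exact ⟨a * b, fun _ => by rw [ha, hb, Rat.cast_mul]⟩
    · exact ⟨0, fun h => absurd h hα⟩
  choose f hf using h
  refine ⟨∑ α ∈ H.root, f α, ?_⟩
  rw [apply_cartanEquivDual_symm_eq_sum, Rat.cast_sum]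
  exact Finset.sum_congr rfl fun α hα => hf α (by simpa [LieSubalgebra.root] using hα)

variable (H) in
/-- The rational bilinear form on `ratDual H`. -/
noncomputable def ratForm : LinearMap.BilinForm ℚ (ratDual H) :=
  have h (x y : ratDual H) := (exists_rat_apply x.2 y.2).choose_spec
  LinearMap.mk₂ ℚ (fun x y => (exists_rat_apply x.2 y.2).choose)
    (fun x y z => Rat.cast_injective (α := K) (by
      rw [Rat.cast_add, ← h, ← h, ← h]; rfl))
    (fun c x y => Rat.cast_injective (α := K) (by
      rw [smul_eq_mul, Rat.cast_mul, ← h, ← h]; exact Rat.smul_def _ _))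
    (fun x y z => Rat.cast_injective (α := K) (by
      rw [Rat.cast_add, ← h, ← h, ← h]; simp))
    (fun c x y => Rat.cast_injective (α := K) (by
      rw [smul_eq_mul, Rat.cast_mul, ← h, ← h, apply_cartanEquivDual_symm_comm,
        apply_cartanEquivDual_symm_comm x.1]
      exact Rat.smul_def _ _))

lemma ratForm_cast (x y : ratDual H) :
    ((ratForm H x y : ℚ) : K) = x.1 ((cartanEquivDual H).symm y.1) :=
  (exists_rat_apply x.2 y.2).choose_spec.symm

open Classical in
variable (H) in
/-- The roots as elements of the rational form of the dual. -/
noncomputable def ratRoots : Finset (ratDual H) :=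
  H.root.image fun α : Weight K H L => ⟨(α : Module.Dual K H), weight_mem_ratDual α⟩

lemma mem_ratRoots {x : ratDual H} :
    x ∈ ratRoots H ↔ ∃ α : Weight K H L, α.IsNonZero ∧ (α : Module.Dual K H) = x.1 := by
  simp [ratRoots, LieSubalgebra.root, Subtype.ext_iff]

end rationalForm

section rootFrame

open LieAlgebra LieAlgebra.IsKilling LieModule

variable {K L : Type*} [Field K] [CharZero K] [LieRing L] [LieAlgebra K L]
  [IsKilling K L] [FiniteDimensional K L]
  {H : LieSubalgebra K L} [H.IsCartanSubalgebra] [IsTriangularizable K H L]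

lemma ratForm_comm (x y : ratDual H) : ratForm H x y = ratForm H y x := by
  apply Rat.cast_injective (α := K)
  rw [ratForm_cast, ratForm_cast, apply_cartanEquivDual_symm_comm]

lemma ratForm_eq_sum (x y : ratDual H) :
    ratForm H x y = ∑ β ∈ ratRoots H, ratForm H x β * ratForm H y β := by
  classical
  apply Rat.cast_injective (α := K)
  rw [ratForm_cast, Rat.cast_sum, ratRoots, Finset.sum_image,
    apply_cartanEquivDual_symm_eq_sum]
  · refine Finset.sum_congr rfl fun α _ => ?_
    rw [Rat.cast_mul, ratForm_cast, ratForm_cast]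
  · exact fun α _ β _ h => Weight.ext fun y => LinearMap.congr_fun (congrArg Subtype.val h) y

lemma eq_zero_of_ratForm {x : ratDual H} (h : ∀ β ∈ ratRoots H, ratForm H x β = 0) : x = 0 := by
  apply Subtype.ext
  apply (cartanEquivDual H).symm.injective
  rw [ZeroMemClass.coe_zero, map_zero]
  have h1 : ∀ α : Weight K H L, α ((cartanEquivDual H).symm x.1) = 0 := by
    intro α
    by_cases hα : α.IsZero
    · rw [hα.eq]; rfl
    · have h2 := h ⟨α, weight_mem_ratDual α⟩ (mem_ratRoots.2 ⟨α, hα, rfl⟩)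
      have h3 := ratForm_cast x ⟨α, weight_mem_ratDual α⟩
      rw [h2, Rat.cast_zero, apply_cartanEquivDual_symm_comm] at h3
      exact h3.symm
  have h2 := iInf_ker_weight_eq_bot (K := K) (L := L) (H := H)
  rw [← Submodule.mem_bot K, ← h2, Submodule.mem_iInf]
  exact h1

lemma ratForm_pos {x : ratDual H} (hx : x ≠ 0) : 0 < ratForm H x x := by
  rw [ratForm_eq_sum]
  refine lt_of_le_of_ne (Finset.sum_nonneg fun β _ => mul_self_nonneg _) fun h => hx ?_
  refine eq_zero_of_ratForm fun β hβ => ?_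
  exact mul_self_eq_zero.1
    ((Finset.sum_eq_zero_iff_of_nonneg fun β _ => mul_self_nonneg _).1 h.symm β hβ)

lemma ratForm_coroot (x : ratDual H) {α : Weight K H L} (hα : α.IsNonZero) {β : ratDual H}
    (hβ : (α : Module.Dual K H) = β.1) :
    ((2 * ratForm H x β / ratForm H β β : ℚ) : K) = x.1 (coroot α) := by
  have h := two_mul_apply_cartanEquivDual_symm hα x.1
  have h0 := root_apply_cartanEquivDual_symm_ne_zero hα
  rw [← Weight.toLinear_apply] at h h0
  push_cast
  rw [ratForm_cast, ratForm_cast, ← hβ, h, mul_div_cancel_left₀ _ h0]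

lemma exists_dual_ratRoots_ne_zero :
    ∃ f : ratDual H →ₗ[ℚ] ℚ, ∀ β ∈ ratRoots H, f β ≠ 0 := by
  obtain ⟨f, hf⟩ := Module.exists_dual_forall_apply_ne_zero (K := ℚ)
    (fun β : ratRoots H => (β : ratDual H)) fun β h => by
      obtain ⟨α, hα, h1⟩ := mem_ratRoots.1 β.2
      rw [h, ZeroMemClass.coe_zero] at h1
      exact hα (Weight.coe_toLinear_eq_zero_iff.1 h1)
  exact ⟨f, fun β hβ => hf ⟨β, hβ⟩⟩

variable (H) in
/-- The root frame of a split Lie algebra with nondegenerate Killing form. -/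
noncomputable def ratRootFrame : RootFrame (ratDual H) where
  form := ratForm H
  roots := ratRoots H
  ht := exists_dual_ratRoots_ne_zero.choose
  form_comm := ratForm_comm
  form_pos _ := ratForm_pos
  zero_notMem h := by
    obtain ⟨α, hα, h⟩ := mem_ratRoots.1 h
    exact hα (Weight.coe_toLinear_eq_zero_iff.1 h)
  neg_mem β h := by
    obtain ⟨α, hα, h⟩ := mem_ratRoots.1 h
    refine mem_ratRoots.2 ⟨-α, hα.neg, ?_⟩
    rw [Weight.toLinear_neg, h]; rfl
  refl_mem β hβ γ hγ := by
    obtain ⟨α, hα, h1⟩ := mem_ratRoots.1 hβ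
    obtain ⟨δ, hδ, h2⟩ := mem_ratRoots.1 hγ
    refine mem_ratRoots.2 ⟨reflectRoot α δ, reflectRoot_isNonZero α δ hδ, ?_⟩
    ext h
    have h3 := ratForm_coroot γ hα h1
    change δ h - δ (coroot α) * α h = γ.1 h - (2 * ratForm H γ β / ratForm H β β) • β.1 h
    rw [Rat.smul_def, h3, ← h1, ← h2]; rfl
  exists_int β hβ γ hγ := by
    obtain ⟨α, hα, h1⟩ := mem_ratRoots.1 hβ
    obtain ⟨δ, hδ, h2⟩ := mem_ratRoots.1 hγ
    refine ⟨chainBotCoeff α δ - chainTopCoeff α δ, Rat.cast_injective (α := K) ?_⟩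
    rw [ratForm_coroot γ hα h1, ← h2, Weight.toLinear_apply, apply_coroot_eq_cast, Rat.cast_intCast]
  eq_of_smul β hβ q hq := by
    obtain ⟨α, hα, h1⟩ := mem_ratRoots.1 hβ
    obtain ⟨δ, hδ, h2⟩ := mem_ratRoots.1 hq
    have h3 : (δ : H → K) = (q : K) • (α : H → K) := by
      ext h
      have h4 := LinearMap.congr_fun h2 h
      change δ h = q • β.1 h at h4
      rw [h4, Rat.smul_def, ← h1]; rfl
    rcases eq_neg_one_or_eq_zero_or_eq_one_of_eq_smul α δ hα _ h3 with h | h | h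
    · exact Or.inr (by exact_mod_cast h)
    · rw [h, zero_smul] at h3
      exact absurd h3 hδ
    · exact Or.inl (by exact_mod_cast h)
  sub_mem β hβ γ hγ hpos hne := by
    obtain ⟨α, hα, h1⟩ := mem_ratRoots.1 hβ
    obtain ⟨δ, hδ, h2⟩ := mem_ratRoots.1 hγ
    have h3 := ratForm_coroot β hδ h2
    rw [← h1, Weight.toLinear_apply, apply_coroot_eq_cast] at h3
    have h4 : (2 * ratForm H β γ / ratForm H γ γ) =
        ((chainBotCoeff δ α - chainTopCoeff δ α : ℤ) : ℚ) := by exact_mod_cast h3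
    have hγ0 : γ ≠ 0 := by
      rintro rfl
      exact hδ (Weight.coe_toLinear_eq_zero_iff.1 h2)
    have h5 : 0 < 2 * ratForm H β γ / ratForm H γ γ :=
      div_pos (mul_pos two_pos hpos) (ratForm_pos hγ0)
    rw [h4] at h5
    have h6 : (0 : ℤ) < chainBotCoeff δ α - chainTopCoeff δ α := by exact_mod_cast h5
    have h7 := (rootSpace_zsmul_add_ne_bot_iff δ α hδ (-1)).2 ⟨by omega, by omega⟩
    have h8 : ((-1 : ℤ) • (δ : H → K) + α) = ((β - γ).1 : Module.Dual K H) := by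
      ext h
      rw [AddSubgroupClass.coe_sub, ← h1, ← h2]
      simp [sub_eq_neg_add]
    refine mem_ratRoots.2 ⟨⟨_, h7⟩, fun h0 => hne ?_, LinearMap.ext fun h => congrFun h8 h⟩
    rw [← sub_eq_zero]
    apply Subtype.ext
    refine LinearMap.ext fun h => ?_
    exact (congrFun h8 h).symm.trans (congrFun h0 h)
  ht_ne_zero := exists_dual_ratRoots_ne_zero.choose_spec
  eq_zero_of_form _ := eq_zero_of_ratForm

end rootFrame

section splitDatum

open LieAlgebra LieAlgebra.IsKilling LieModule

variable {K L : Type*} [Field K] [CharZero K] [LieRing L] [LieAlgebra K L]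
  [IsKilling K L] [FiniteDimensional K L]
  {H : LieSubalgebra K L} [H.IsCartanSubalgebra] [IsTriangularizable K H L]

lemma exists_rootVectors : ∃ e f : ratDual H → L, ∀ β ∈ ratRoots H,
    e β ∈ rootSpace H β.1 ∧ f β ∈ rootSpace H (-β.1 : H → K) ∧ killingForm K L (f β) (e β) = 1 := by
  have h : ∀ β : ratDual H, ∃ e f : L, β ∈ ratRoots H →
      e ∈ rootSpace H β.1 ∧ f ∈ rootSpace H (-β.1 : H → K) ∧ killingForm K L f e = 1 := by
    intro β
    by_cases hβ : β ∈ ratRoots H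
    · obtain ⟨α, hα, h1⟩ := mem_ratRoots.1 hβ
      obtain ⟨h, e, f, ht, he, hf⟩ := exists_isSl2Triple_of_weight_isNonZero hα
      have h2 := lie_eq_killingForm_smul_of_mem_rootSpace_of_mem_rootSpace_neg he hf
      have h0 : killingForm K L e f ≠ 0 := fun h0 => ht.h_ne_zero (by
        rw [← ht.lie_e_f, h2, h0, zero_smul])
      refine ⟨e, (killingForm K L e f)⁻¹ • f, fun _ => ⟨?_, ?_, ?_⟩⟩
      · rw [← h1]; exact he
      · rw [← h1]; exact Submodule.smul_mem _ _ hf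
      · rw [map_smul, LinearMap.smul_apply, smul_eq_mul, LieModule.traceForm_comm K L L f,
          inv_mul_cancel₀ h0]
    · exact ⟨0, 0, fun h => absurd h hβ⟩
  choose e f h using h
  exact ⟨e, f, h⟩

lemma exists_eq_smul_of_mem_rootSpace {β : ratDual H} (hβ : β ∈ ratRoots H) {x y : L}
    (hx : x ∈ rootSpace H β.1) (hx0 : x ≠ 0) (hy : y ∈ rootSpace H β.1) : ∃ c : K, y = c • x := by
  obtain ⟨α, hα, h1⟩ := mem_ratRoots.1 hβ
  rw [← h1] at hx hy
  obtain ⟨c, hc⟩ := (finrank_eq_one_iff_of_nonzero' (⟨x, hx⟩ : rootSpace H α)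
    fun h => hx0 (congrArg Subtype.val h)).1 (finrank_rootSpace_eq_one α hα) ⟨y, hy⟩
  exact ⟨c, (congrArg Subtype.val hc).symm⟩

lemma sum_ratRoots {A : Type*} [AddCommMonoid A] (F : Module.Dual K H → A) :
    ∑ β ∈ ratRoots H, F β.1 = ∑ α ∈ H.root, F (α : Weight K H L) := by
  classical
  rw [ratRoots, Finset.sum_image]
  exact fun α _ β _ h => Weight.ext fun y => LinearMap.congr_fun (congrArg Subtype.val h) y

lemma sum_apply_smul_cartanEquivDual_symm (y : H) :
    ∑ β ∈ ratRoots H, β.1 y • (cartanEquivDual H).symm β.1 = y := by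
  rw [sum_ratRoots fun φ => φ y • (cartanEquivDual H).symm φ]
  apply (cartanEquivDual H).injective
  ext z
  have h := LinearMap.congr_fun₂ (restrict_killingForm_eq_sum (K := K) (H := H)) y z
  rw [LinearMap.sum_apply, LinearMap.sum_apply] at h
  refine Eq.trans ?_ h.symm
  simp only [map_sum, map_smul, LinearEquiv.apply_symm_apply, LinearMap.sum_apply]
  rfl

lemma eq_top_of_rootVectors_mem {e : ratDual H → L}
    (he : ∀ β ∈ ratRoots H, e β ∈ rootSpace H β.1 ∧ e β ≠ 0) {P : Submodule K L}
    (h1 : ∀ β ∈ ratRoots H, ((cartanEquivDual H).symm β.1 : L) ∈ P)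
    (h2 : ∀ β ∈ ratRoots H, e β ∈ P) : P = ⊤ := by
  have h := LieModule.iSup_genWeightSpace_eq_top' K H L
  rw [← LieSubmodule.toSubmodule_inj, LieSubmodule.iSup_toSubmodule,
    LieSubmodule.top_toSubmodule] at h
  rw [eq_top_iff, ← h, iSup_le_iff]
  intro α y hy
  by_cases hα : α.IsZero
  · have hy' : y ∈ H := by
      rw [hα.eq] at hy
      rwa [← LieSubalgebra.mem_toLieSubmodule, ← rootSpace_zero_eq K L H]
    have h3 := congrArg Subtype.val (sum_apply_smul_cartanEquivDual_symm (⟨y, hy'⟩ : H))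
    rw [AddSubmonoidClass.coe_finsetSum] at h3
    change ((⟨y, hy'⟩ : H) : L) ∈ P
    rw [← h3]
    exact sum_mem fun β hβ => Submodule.smul_mem _ _ (h1 β hβ)
  · have hβ : (⟨α, weight_mem_ratDual α⟩ : ratDual H) ∈ ratRoots H := mem_ratRoots.2 ⟨α, hα, rfl⟩
    obtain ⟨c, rfl⟩ := exists_eq_smul_of_mem_rootSpace hβ (he _ hβ).1 (he _ hβ).2 hy
    exact Submodule.smul_mem _ _ (h2 _ hβ)

lemma coe_mem_rootSpace_zero (h : H) : (h : L) ∈ rootSpace H (0 : H → K) := by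
  rw [rootSpace_zero_eq K L H]
  exact h.2

lemma rootSpace_eq_bot {x : ratDual H} (h : x ∉ ratRoots H) (h0 : x ≠ 0) :
    rootSpace H x.1 = ⊥ := by
  by_contra hne
  refine h (mem_ratRoots.2 ⟨⟨x.1, hne⟩, fun hz => h0 ?_, LinearMap.ext fun _ => rfl⟩)
  exact Subtype.ext (LinearMap.ext fun y => congrFun hz y)

lemma killingForm_eq_zero_of_ne {β γ : ratDual H} (h : β ≠ γ) {x y : L}
    (hx : x ∈ rootSpace H (-β.1 : H → K)) (hy : y ∈ rootSpace H γ.1) : killingForm K L x y = 0 := by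
  refine killingForm_apply_eq_zero_of_mem_rootSpace_of_add_ne_zero K L H hx hy fun h0 => h ?_
  refine Subtype.ext (LinearMap.ext fun z => ?_)
  have := congrFun h0 z
  simp only [Pi.add_apply, Pi.neg_apply, Pi.zero_apply] at this
  exact neg_add_eq_zero.1 this

lemma killingForm_rootVector_cartan {φ : Module.Dual K H} (h : φ ≠ 0) {x : L}
    (hx : x ∈ rootSpace H φ) (y : H) : killingForm K L x y = 0 := by
  refine killingForm_apply_eq_zero_of_mem_rootSpace_of_add_ne_zero K L H hx
    (coe_mem_rootSpace_zero y) fun h0 => h ?_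
  rw [add_zero] at h0
  exact LinearMap.ext fun z => congrFun h0 z

lemma eq_sum_dual {e f : ratDual H → L} (he : ∀ β ∈ ratRoots H, e β ∈ rootSpace H β.1)
    (hf : ∀ β ∈ ratRoots H, f β ∈ rootSpace H (-β.1 : H → K))
    (hfe : ∀ β ∈ ratRoots H, killingForm K L (f β) (e β) = 1) (y : L) :
    y = ∑ β ∈ ratRoots H, (killingForm K L ((cartanEquivDual H).symm β.1 : L) y •
      ((cartanEquivDual H).symm β.1 : L) + killingForm K L (f β) y • e β) := by
  have hne : ∀ β ∈ ratRoots H, β.1 ≠ 0 := fun β hβ h =>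
    (ratRootFrame H).zero_notMem (by rwa [show β = 0 from Subtype.ext h] at hβ)
  have he0 : ∀ β ∈ ratRoots H, e β ∈ rootSpace H β.1 ∧ e β ≠ 0 := fun β hβ =>
    ⟨he β hβ, fun h => by simpa [h] using hfe β hβ⟩
  let F : L →ₗ[K] L := ∑ β ∈ ratRoots H,
    ((killingForm K L ((cartanEquivDual H).symm β.1 : L)).smulRight
      ((cartanEquivDual H).symm β.1 : L) + (killingForm K L (f β)).smulRight (e β))
  have hF : ∀ y, F y = ∑ β ∈ ratRoots H, (killingForm K L ((cartanEquivDual H).symm β.1 : L) y •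
      ((cartanEquivDual H).symm β.1 : L) + killingForm K L (f β) y • e β) := fun y => by
    simp [F, LinearMap.sum_apply]
  rw [← hF]
  have htop := eq_top_of_rootVectors_mem he0 (P := LinearMap.eqLocus LinearMap.id F)
    (fun γ hγ => ?_) (fun γ hγ => ?_)
  · exact (htop ▸ Submodule.mem_top : y ∈ LinearMap.eqLocus LinearMap.id F)
  · change _ = F _
    rw [hF]
    have h3 := congrArg Subtype.val
      (sum_apply_smul_cartanEquivDual_symm ((cartanEquivDual H).symm γ.1))
    rw [AddSubmonoidClass.coe_finsetSum] at h3
    refine h3.symm.trans (Finset.sum_congr rfl fun β hβ => ?_)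
    have h4 : killingForm K L (f β) ((cartanEquivDual H).symm γ.1 : L) = 0 :=
      killingForm_rootVector_cartan (φ := -β.1) (neg_ne_zero.2 (hne β hβ)) (hf β hβ) _
    rw [h4, zero_smul, add_zero, killingForm_cartanEquivDual_symm]
    rfl
  · change _ = F _
    rw [hF, Finset.sum_eq_single γ]
    · rw [hfe γ hγ, one_smul, LieModule.traceForm_comm K L L,
        killingForm_rootVector_cartan (hne γ hγ) (he γ hγ), zero_smul, zero_add]
      rfl
    · intro β hβ hβγ
      rw [killingForm_eq_zero_of_ne hβγ (hf β hβ) (he γ hγ), LieModule.traceForm_comm K L L,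
        killingForm_rootVector_cartan (hne γ hγ) (he γ hγ), zero_smul, zero_smul, zero_add]
    · exact fun h => absurd hγ h

end splitDatum

section splitDatumExistence

open LieAlgebra LieAlgebra.IsKilling LieModule

variable {K L : Type*} [Field K] [CharZero K] [LieRing L] [LieAlgebra K L]
  [IsKilling K L] [FiniteDimensional K L]
  {H : LieSubalgebra K L} [H.IsCartanSubalgebra] [IsTriangularizable K H L]

variable (H) in
/-- The element of the Cartan subalgebra corresponding to a rational weight. -/
noncomputable def ratCartan : ratDual H →+ L where
  toFun x := ((cartanEquivDual H).symm x.1 : H)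
  map_zero' := by rw [ZeroMemClass.coe_zero, map_zero]; rfl
  map_add' x y := by rw [AddMemClass.coe_add, map_add]; rfl

lemma lie_ratCartan {φ : Module.Dual K H} {x : L} (hx : x ∈ rootSpace H φ) (y : ratDual H) :
    ⁅ratCartan H y, x⁆ = φ ((cartanEquivDual H).symm y.1) • x :=
  lie_eq_smul_of_mem_rootSpace hx _

lemma lie_mem_rootSpace_add {β γ : ratDual H} {x y : L} (hx : x ∈ rootSpace H β.1)
    (hy : y ∈ rootSpace H γ.1) : ⁅x, y⁆ ∈ rootSpace H (β + γ).1 :=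
  lie_mem_genWeightSpace_of_mem_genWeightSpace hx hy

lemma eq_sum_dual_symm {e f : ratDual H → L} (he : ∀ β ∈ ratRoots H, e β ∈ rootSpace H β.1)
    (hf : ∀ β ∈ ratRoots H, f β ∈ rootSpace H (-β.1 : H → K))
    (hfe : ∀ β ∈ ratRoots H, killingForm K L (f β) (e β) = 1) (y : L) :
    y = ∑ β ∈ ratRoots H, (killingForm K L (ratCartan H β) y • ratCartan H β +
      killingForm K L (e β) y • f β) := by
  have hneg : ∀ β ∈ ratRoots H, -β ∈ ratRoots H := (ratRootFrame H).neg_mem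
  have h1 : ∀ β : ratDual H, ((-β : ratDual H).1 : H → K) = -β.1 := fun β => by
    ext z
    simp
  have he' : ∀ β ∈ ratRoots H, e (-β) ∈ rootSpace H (-β.1 : H → K) := fun β hβ => by
    rw [← h1]
    exact he _ (hneg β hβ)
  have hf' : ∀ β ∈ ratRoots H, f (-β) ∈ rootSpace H β.1 := fun β hβ => by
    have h := hf _ (hneg β hβ)
    rwa [h1, neg_neg] at h
  have hfe' : ∀ β ∈ ratRoots H, killingForm K L (e (-β)) (f (-β)) = 1 := fun β hβ => by
    rw [LieModule.traceForm_comm]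
    exact hfe _ (hneg β hβ)
  refine (eq_sum_dual hf' he' hfe' y).trans ?_
  refine Finset.sum_nbij' (fun β => -β) (fun β => -β) hneg hneg (fun β _ => neg_neg β)
    (fun β _ => neg_neg β) fun β _ => ?_
  have h2 : ratCartan H (-β) = -ratCartan H β := by
    change (((cartanEquivDual H).symm (-β.1) : H) : L) = _
    rw [map_neg]
    rfl
  rw [h2, map_neg, LinearMap.neg_apply, neg_smul_neg]
  rfl

variable (H) in
lemma nonempty_splitDatum : Nonempty {D : SplitDatum K L (ratRootFrame H) // D.t = ratCartan H} := by
  obtain ⟨e, f, h⟩ := exists_rootVectors (H := H)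
  have he := fun β hβ => (h β hβ).1
  have hf := fun β hβ => (h β hβ).2.1
  have hfe := fun β hβ => (h β hβ).2.2
  have hne : ∀ β ∈ ratRoots H, β.1 ≠ 0 := fun β hβ h =>
    (ratRootFrame H).zero_notMem (by rwa [show β = 0 from Subtype.ext h] at hβ)
  have hneg : ∀ β ∈ ratRoots H, -β ∈ ratRoots H := (ratRootFrame H).neg_mem
  have he0 : ∀ β ∈ ratRoots H, e β ≠ 0 := fun β hβ h => by simpa [h] using hfe β hβ
  have hf0 : ∀ β ∈ ratRoots H, f β ≠ 0 := fun β hβ h => by simpa [h] using hfe β hβ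
  exact ⟨⟨{
    t := ratCartan H
    e := e
    f := f
    killing := killingForm K L
    lie_t_t := fun x y => congrArg Subtype.val
      (trivial_lie_zero H H ((cartanEquivDual H).symm x.1) ((cartanEquivDual H).symm y.1))
    lie_t_e := fun β hβ x => by
      rw [lie_ratCartan (he β hβ), ← ratForm_cast, ratForm_comm]; rfl
    lie_t_f := fun β hβ x => by
      rw [lie_ratCartan (φ := -β.1) (hf β hβ), LinearMap.neg_apply, neg_smul, ← ratForm_cast,
        ratForm_comm]; rfl
    lie_e_f := fun β hβ => by
      obtain ⟨α, hα, h1⟩ := mem_ratRoots.1 hβ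
      have h2 := he β hβ
      have h3 := hf β hβ
      rw [← h1] at h2 h3
      rw [lie_eq_killingForm_smul_of_mem_rootSpace_of_mem_rootSpace_neg h2 h3,
        LieModule.traceForm_comm K L L, hfe β hβ, one_smul, h1]
      rfl
    form_eq := ratForm_eq_sum
    f_eq := fun β hβ => by
      obtain ⟨c, hc⟩ := exists_eq_smul_of_mem_rootSpace (hneg β hβ) (he _ (hneg β hβ))
        (he0 _ (hneg β hβ)) (y := f β) (hf β hβ)
      exact ⟨c, fun h0 => hf0 β hβ (by rw [hc, h0, zero_smul]), hc⟩
    lie_e_e := fun β hβ γ hγ hβγ => exists_eq_smul_of_mem_rootSpace hβγ (he _ hβγ) (he0 _ hβγ)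
      (lie_mem_rootSpace_add (he β hβ) (he γ hγ))
    lie_e_e_eq_zero := fun β hβ γ hγ hβγ h0 => by
      have h1 := lie_mem_rootSpace_add (he β hβ) (he γ hγ)
      rwa [rootSpace_eq_bot hβγ h0, LieSubmodule.mem_bot] at h1
    killing_symm := fun x y => LieModule.traceForm_comm K L L x y
    killing_lie := fun x y z => LieModule.traceForm_apply_lie_apply K L L x y z
    killing_f_e := hfe
    killing_f_e_of_ne := fun β hβ γ hγ hβγ => killingForm_eq_zero_of_ne hβγ (hf β hβ) (he γ hγ)
    killing_f_t := fun β hβ x =>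
      killingForm_rootVector_cartan (φ := -β.1) (neg_ne_zero.2 (hne β hβ)) (hf β hβ) _
    dual := eq_sum_dual he hf hfe
    dual' := eq_sum_dual_symm he hf hfe }, rfl⟩⟩

lemma exists_isWt [IsAlgClosed K] {D : SplitDatum K L (ratRootFrame H)} (hD : D.t = ratCartan H)
    (M : Type*) [AddCommGroup M] [Module K M] [LieRingModule L M] [LieModule K L M]
    [FiniteDimensional K M] [Nontrivial M] : ∃ (x : ratDual H) (v : M), v ≠ 0 ∧ D.IsWt x v := by
  obtain ⟨χ, hχ⟩ := exists_nontrivial_weightSpace_of_isNilpotent K H M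
  obtain ⟨⟨v, hv⟩, hv0⟩ := exists_ne (0 : weightSpace M χ)
  have hv0 : v ≠ 0 := fun h => hv0 (Subtype.ext h)
  rw [mem_weightSpace] at hv
  have hχ : χ ∈ ratDual H := by
    refine mem_ratDual_of_coroot fun α hα => ?_
    obtain ⟨h, e, f, ht, he, hf⟩ := exists_isSl2Triple_of_weight_isNonZero hα
    have hh := ht.h_eq_coroot hα he hf
    refine ht.exists_int_of_lie_h hv0 (μ := χ (coroot α)) ?_
    rw [hh]
    exact hv (coroot α)
  refine ⟨⟨χ, hχ⟩, v, hv0, fun y => ?_⟩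
  rw [hD]
  refine (hv ((cartanEquivDual H).symm y.1)).trans ?_
  rw [← ratForm_cast ⟨χ, hχ⟩ y, ratForm_comm]
  rfl

end splitDatumExistence

/-- Let `𝔤` be a finite-dimensional semisimple Lie algebra over an
algebraically closed field `K` of characteristic `0` and let `V` be a faithful irreducible
`𝔤`-module of dimension `r` such that `(V^{⊗n})^𝔤 = 0` for all `1 ≤ n < r`. Then every
simple ideal of `𝔤` is of type `A`, i.e. isomorphic to `sl_m(K)` for some `m ≥ 2`. -/
theorem every_simple_ideal_is_typeA
    (K : Type*) [Field K] [IsAlgClosed K] [CharZero K]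
    (𝔤 : Type*) [LieRing 𝔤] [LieAlgebra K 𝔤] [FiniteDimensional K 𝔤]
    [LieAlgebra.IsSemisimple K 𝔤]
    (V : Type*) [AddCommGroup V] [Module K V] [LieRingModule 𝔤 V] [LieModule K 𝔤 V]
    [FiniteDimensional K V] [LieModule.IsIrreducible K 𝔤 V]
    (hfaithful : Function.Injective (LieModule.toEnd K 𝔤 V))
    (r : ℕ) (hr : r = Module.finrank K V)
    (hinv : ∀ n : ℕ, 1 ≤ n → n < r → tensorPowerInvariants K 𝔤 V n = ⊥)
    (I : LieIdeal K 𝔤) (hI : LieAlgebra.IsSimple K I) :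
    IsTypeA K I := by
  obtain ⟨H, hH⟩ : ∃ H : LieSubalgebra K 𝔤, H.IsCartanSubalgebra := by
    obtain ⟨x, hx⟩ := LieAlgebra.exists_isCartanSubalgebra_engel K 𝔤
    exact ⟨_, hx⟩
  obtain ⟨D, hD⟩ := nonempty_splitDatum H
  have hVn : Nontrivial V := LieModule.nontrivial_of_isIrreducible K 𝔤 V
  have hIn : Nontrivial I := by
    by_contra h
    rw [not_nontrivial_iff_subsingleton] at h
    exact hI.non_abelian ⟨fun _ _ => Subsingleton.elim _ _⟩
  exact SplitDatum.isTypeA hfaithful hr hinv hI (exists_isWt hD V) (exists_isWt hD I)
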